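/- arXiv:math/0611356 — 6 statements merged into one kernel-verified Lean document; each statement's English description precedes it below -/
import Mathlib

section
/- For A ∈ ℤ^{m×n} and b ∈ ℤ^m, the set N′(A,b) of all vertices of the convex hull of {x ∈ ℤⁿ : Ax = b, x ≥ 0} has the separation property. -/
/-- A set `X` of points of `ℝⁿ` has the *separation property* if for any two distinct
points `x, y ∈ X` there is an index `j` with `2 * y j < x j`. -/
def SeparationProperty {n : ℕ} (X : Set (Fin n → ℝ)) : Prop :=
  ∀ x ∈ X, ∀ y ∈ X, x ≠ y → ∃ j, 2 * y j < x j

/-- The set `{x ∈ ℤⁿ : Ax = b, x ≥ 0}`, viewed inside `ℝⁿ`. -/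
def eqIntPoints (m n : ℕ) (A : Matrix (Fin m) (Fin n) ℤ) (b : Fin m → ℤ) :
    Set (Fin n → ℝ) :=
  {x | (∀ j, ∃ z : ℤ, x j = (z : ℝ)) ∧
       (∀ i, ∑ j, (A i j : ℝ) * x j = (b i : ℝ)) ∧ ∀ j, 0 ≤ x j}

/-- `N′(A,b)`: the set of vertices (extreme points) of the convex hull of
`{x ∈ ℤⁿ : Ax = b, x ≥ 0}`. -/
def vertN' (m n : ℕ) (A : Matrix (Fin m) (Fin n) ℤ) (b : Fin m → ℤ) :
    Set (Fin n → ℝ) :=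
  Set.extremePoints ℝ (convexHull ℝ (eqIntPoints m n A b))

/-- The vertex set `N′(A,b)` of the convex hull of `{x ∈ ℤⁿ : Ax = b, x ≥ 0}` has the
separation property. -/
theorem vertN'_separationProperty (m n : ℕ) (A : Matrix (Fin m) (Fin n) ℤ)
    (b : Fin m → ℤ) : SeparationProperty (vertN' m n A b) := by
  intro x hx y hy hne
  by_contra hcon
  push Not at hcon
  have hxS : x ∈ eqIntPoints m n A b := extremePoints_convexHull_subset hx
  have hyS : y ∈ eqIntPoints m n A b := extremePoints_convexHull_subset hy
  obtain ⟨hx1, hx2, hx3⟩ := hxS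
  obtain ⟨hy1, hy2, hy3⟩ := hyS
  have hz : (fun j => 2 * y j - x j) ∈ eqIntPoints m n A b := by
    refine ⟨fun j => ?_, fun i => ?_, fun j => by linarith [hcon j]⟩
    · obtain ⟨p, hp⟩ := hx1 j
      obtain ⟨q, hq⟩ := hy1 j
      exact ⟨2 * q - p, by push_cast; rw [hp, hq]⟩
    · have : ∀ j, (A i j : ℝ) * (2 * y j - x j) = 2 * (A i j * y j) - A i j * x j :=
        fun j => by ring
      simp only [this, Finset.sum_sub_distrib, ← Finset.mul_sum, hx2, hy2]
      ring
  have hseg : y ∈ openSegment ℝ x (fun j => 2 * y j - x j) := by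
    refine ⟨1 / 2, 1 / 2, by norm_num, by norm_num, by norm_num, ?_⟩
    ext j
    simp only [Pi.add_apply, Pi.smul_apply, smul_eq_mul]
    ring
  exact hne (hy.2 hx.1 (subset_convexHull ℝ _ hz) hseg)
end

section
/- Let A ∈ ℤ^{m×n}, b ∈ ℤ^m, and let α = max{|a_{ij}| : i = 1,…,m; j = 1,…,n}. Then |N(A,b)| ≤ (1 + log₂(n+1) + n log₂(α√n))^{2n+m−1}. -/
/-- The set `M(A,b) = {x ∈ ℤⁿ : Ax ≤ b}`, viewed inside `ℝⁿ`. -/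
def intPoints (m n : ℕ) (A : Matrix (Fin m) (Fin n) ℤ) (b : Fin m → ℤ) :
    Set (Fin n → ℝ) :=
  {x | (∀ j, ∃ z : ℤ, x j = (z : ℝ)) ∧ ∀ i, ∑ j, (A i j : ℝ) * x j ≤ (b i : ℝ)}

/-- `N(A,b)`: the set of vertices (extreme points) of `P_I`, the convex hull of
`M(A,b) = {x ∈ ℤⁿ : Ax ≤ b}`. -/
def vertN (m n : ℕ) (A : Matrix (Fin m) (Fin n) ℤ) (b : Fin m → ℤ) :
    Set (Fin n → ℝ) :=
  Set.extremePoints ℝ (convexHull ℝ (intPoints m n A b))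

open Matrix

def VV {ι : Type*} {n : ℕ} (r : ι → Fin n → ℝ) (w : Fin n → ℝ) : Submodule ℝ (Fin n → ℝ) where
  carrier := {v | ∀ i, r i ⬝ᵥ w = 0 → r i ⬝ᵥ v = 0}
  add_mem' := by
    intro x y hx hy i hi
    rw [dotProduct_add, hx i hi, hy i hi, add_zero]
  zero_mem' := by
    intro i hi
    exact dotProduct_zero _
  smul_mem' := by
    intro c x hx i hi
    rw [dotProduct_smul, hx i hi, smul_zero]

lemma mem_VV {ι : Type*} {n : ℕ} {r : ι → Fin n → ℝ} {w v : Fin n → ℝ} :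
    v ∈ VV r w ↔ ∀ i, r i ⬝ᵥ w = 0 → r i ⬝ᵥ v = 0 := Iff.rfl

lemma VV_lt {ι : Type*} {n : ℕ} {r : ι → Fin n → ℝ} {w v : Fin n → ℝ} (hv : v ∈ VV r w)
    (t : ℝ) (i : ι) (hi : r i ⬝ᵥ w ≠ 0) (h0 : r i ⬝ᵥ (w + t • v) = 0) :
    VV r (w + t • v) < VV r w := by
  refine lt_of_le_of_ne ?_ ?_
  · intro x hx l hl
    apply hx l
    rw [dotProduct_add, dotProduct_smul, hl, hv l hl]; simp
  · intro he
    have : w ∈ VV r w := fun l hl => hl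
    rw [← he] at this
    exact hi (this i h0)

lemma step {ι : Type*} [Fintype ι] {n : ℕ} {r : ι → Fin n → ℝ}
    (hr : ∀ v, (∀ i, r i ⬝ᵥ v = 0) → v = 0) {w v : Fin n → ℝ} (hv : v ∈ VV r w) (hv0 : v ≠ 0) :
    ∃ (t : ℝ) (i : ι), r i ⬝ᵥ w ≠ 0 ∧ r i ⬝ᵥ v ≠ 0 ∧ t = -(r i ⬝ᵥ w) / (r i ⬝ᵥ v) ∧
      r i ⬝ᵥ (w + t • v) = 0 ∧ ∀ l, |t * (r l ⬝ᵥ v)| ≤ |r l ⬝ᵥ w| := by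
  classical
  have hne : (Finset.univ.filter fun i => r i ⬝ᵥ v ≠ 0).Nonempty := by
    by_contra h
    rw [Finset.not_nonempty_iff_eq_empty, Finset.filter_eq_empty_iff] at h
    exact hv0 (hr v fun i => by simpa using h (Finset.mem_univ i))
  obtain ⟨i, hi, hmin⟩ := Finset.exists_min_image _
    (fun i => |(-(r i ⬝ᵥ w) / (r i ⬝ᵥ v))|) hne
  simp only [Finset.mem_filter, Finset.mem_univ, true_and] at hi hmin
  refine ⟨_, i, fun h => hi (hv i h), hi, rfl, ?_, fun l => ?_⟩
  · rw [dotProduct_add, dotProduct_smul, smul_eq_mul]; field_simp; ring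
  · by_cases hl : r l ⬝ᵥ v = 0
    · simp [hl]
    · rw [abs_mul]
      calc _ ≤ |(-(r l ⬝ᵥ w) / (r l ⬝ᵥ v))| * |r l ⬝ᵥ v| := by
            exact mul_le_mul_of_nonneg_right (hmin l hl) (abs_nonneg _)
        _ = _ := by rw [← abs_mul, div_mul_cancel₀ _ hl, abs_neg]

lemma dot_cast {n : ℕ} (c g : Fin n → ℤ) :
    (fun j => (c j : ℝ)) ⬝ᵥ (fun j => (g j : ℝ)) = ((c ⬝ᵥ g : ℤ) : ℝ) := by
  simp [dotProduct]

lemma adj_bound {n : ℕ} (B : Matrix (Fin n) (Fin n) ℤ) (α : ℕ) (hB : ∀ i j, |B i j| ≤ α)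
    (k : Fin n) (c : Fin n → ℤ) (hc : ∀ j, |c j| ≤ α) :
    |c ⬝ᵥ (fun i => B.adjugate i k)| ≤ (n.factorial : ℤ) * (α : ℤ) ^ n := by
  have h1 : c ⬝ᵥ (fun i => B.adjugate i k) = (B.updateRow k c).det := by
    rw [Matrix.det_eq_sum_mul_adjugate_row _ k]
    simp [dotProduct, Matrix.adjugate_apply]
  rw [h1]
  have := Matrix.det_le (A := B.updateRow k c) (abv := AbsoluteValue.abs) (x := (α : ℤ)) (by
    intro i j
    by_cases h : i = k
    · subst h; simpa using hc j
    · simpa [Matrix.updateRow_ne h] using hB i j)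
  simpa using this

lemma circ_base {ι : Type*} [Fintype ι] {n : ℕ} (a : ι → Fin n → ℤ) (α : ℕ)
    (ha : ∀ i j, |a i j| ≤ α)
    (hr : ∀ v : Fin n → ℝ, (∀ i, (fun j => (a i j : ℝ)) ⬝ᵥ v = 0) → v = 0)
    (w : Fin n → ℝ) (hw : w ≠ 0)
    (hone : ∀ v ∈ VV (fun i j => (a i j : ℝ)) w, ∃ c : ℝ, v = c • w) :
    ∃ g : Fin n → ℤ, g ≠ 0 ∧
      (∀ c : Fin n → ℤ, (∀ j, |c j| ≤ α) → |c ⬝ᵥ g| ≤ (n.factorial : ℤ) * (α : ℤ) ^ n) ∧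
      ∃ c : ℝ, (fun j => (g j : ℝ)) = c • w := by
  classical
  set r : ι → Fin n → ℝ := fun i j => (a i j : ℝ) with hrdef
  obtain ⟨i0, hi0⟩ : ∃ i, r i ⬝ᵥ w ≠ 0 := by
    by_contra h; push Not at h; exact hw (hr w h)
  set t : Set (Fin n → ℝ) := r '' {i | r i ⬝ᵥ w = 0 ∨ i = i0} with ht
  have hspan : ⊤ ≤ Submodule.span ℝ t := by
    by_contra h
    obtain ⟨f, hf0, hf⟩ := Submodule.exists_le_ker_of_lt_top _ (lt_top_iff_ne_top.2 (fun h' => h h'.ge))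
    set v : Fin n → ℝ := fun j => f (Pi.single j 1)
    have hfv : ∀ x, f x = x ⬝ᵥ v := by
      intro x
      conv_lhs => rw [pi_eq_sum_univ' x]
      simp [dotProduct, v]
    have hz : ∀ i, (r i ⬝ᵥ w = 0 ∨ i = i0) → r i ⬝ᵥ v = 0 := by
      intro i hi
      rw [← hfv]
      exact hf (Submodule.subset_span ⟨i, hi, rfl⟩)
    obtain ⟨c, hc⟩ := hone v (fun i hi => hz i (Or.inl hi))
    have h2 := hz i0 (Or.inr rfl)
    rw [hc, dotProduct_smul, smul_eq_mul] at h2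
    have hc0 : c = 0 := by
      rcases mul_eq_zero.1 h2 with h | h
      · exact h
      · exact absurd h hi0
    apply hf0
    ext x
    simp [hfv, hc, hc0]
  have hs : LinearIndepOn ℝ id ({r i0} : Set (Fin n → ℝ)) := by
    apply LinearIndepOn.singleton
    intro h
    simp only [id] at h
    exact hi0 (by rw [h, zero_dotProduct])
  have hst : ({r i0} : Set (Fin n → ℝ)) ⊆ t := by
    rintro _ rfl; exact ⟨i0, Or.inr rfl, rfl⟩
  let bb := Module.Basis.extendLe hs hst hspan
  have : Fintype (hs.extend hst) := FiniteDimensional.fintypeBasisIndex bb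
  have hcard : Fintype.card (hs.extend hst) = n := by
    rw [← Module.finrank_eq_card_basis bb]; simp
  let e := Fintype.equivFinOfCardEq hcard
  let b := bb.reindex e
  have hbt : ∀ k, b k ∈ t := fun k =>
    Module.Basis.extendLe_subset hs hst hspan ⟨e.symm k, by simp [b, bb]⟩
  choose i hi hib using hbt
  obtain ⟨k0, hk0⟩ : ∃ k, b k = r i0 := by
    obtain ⟨x, hx⟩ := Module.Basis.subset_extendLe hs hst hspan (Set.mem_singleton (r i0))
    exact ⟨e x, by simp only [b, Module.Basis.reindex_apply, Equiv.symm_apply_apply]; exact hx⟩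
  let B : Matrix (Fin n) (Fin n) ℤ := fun k => a (i k)
  let g : Fin n → ℤ := fun j => B.adjugate j k0
  have hBg : ∀ k, (a (i k)) ⬝ᵥ g = if k = k0 then B.det else 0 := by
    intro k
    have := congrFun (congrFun (Matrix.mul_adjugate B) k) k0
    rw [Matrix.mul_apply, Matrix.smul_apply, Matrix.one_apply] at this
    simp only [dotProduct, g]
    rw [show (∑ x, a (i k) x * B.adjugate x k0) = _ from this]
    split_ifs <;> simp
  have hbg : ∀ k, b k ⬝ᵥ (fun j => (g j : ℝ)) = if k = k0 then (B.det : ℝ) else 0 := by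
    intro k
    rw [← hib k]
    have := dot_cast (a (i k)) g
    rw [hBg] at this
    simp only [hrdef]
    rw [this]; split_ifs <;> simp
  have hdet : (B.det : ℝ) ≠ 0 := by
    have hu := (Matrix.linearIndependent_rows_iff_isUnit (A := (B.map (Int.cast : ℤ → ℝ)))).1 (by
      have : (B.map (Int.cast : ℤ → ℝ)).row = b := by
        ext k j
        rw [← hib k]; rfl
      rw [this]; exact b.linearIndependent)
    rw [Matrix.isUnit_iff_isUnit_det] at hu
    have h3 : (B.map (Int.cast : ℤ → ℝ)).det = (B.det : ℝ) := by
      have := (Int.castRingHom ℝ).map_det B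
      simpa using this.symm
    rw [h3] at hu
    exact hu.ne_zero
  have hb0 : ∀ v : Fin n → ℝ, (∀ k, b k ⬝ᵥ v = 0) → v = 0 := by
    intro v hv
    apply dotProduct_eq_zero
    intro x
    rw [dotProduct_comm]
    rw [← b.sum_repr x, sum_dotProduct]
    simp [hv]
  refine ⟨g, ?_, fun c hc => adj_bound B α (fun k j => ha _ _) k0 c hc, (B.det : ℝ) / (r i0 ⬝ᵥ w), ?_⟩
  · intro h
    have := hbg k0
    simp only [h] at this
    simp [dotProduct] at this
    exact hdet (by exact_mod_cast this.symm)
  · rw [← sub_eq_zero]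
    apply hb0
    intro k
    rw [dotProduct_sub, hbg, dotProduct_smul, smul_eq_mul]
    by_cases hk : k = k0
    · subst hk; simp [hk0]; field_simp; simp
    · rw [if_neg hk]
      have : b k ⬝ᵥ w = 0 := by
        rw [← hib k]
        rcases hi k with h | h
        · exact h
        · exfalso; apply hk; apply b.injective; rw [hk0, ← hib k, h]
      rw [this]; simp

lemma circ {ι : Type*} [Fintype ι] {n : ℕ} (a : ι → Fin n → ℤ) (α : ℕ)
    (ha : ∀ i j, |a i j| ≤ α)
    (hr : ∀ v : Fin n → ℝ, (∀ i, (fun j => (a i j : ℝ)) ⬝ᵥ v = 0) → v = 0) (N : ℕ) :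
    ∀ (w : Fin n → ℝ) (_ : w ≠ 0)
    (_ : Module.finrank ℝ (VV (fun i j => (a i j : ℝ)) w) ≤ N),
    ∃ g : Fin n → ℤ, g ≠ 0 ∧
      (∀ c : Fin n → ℤ, (∀ j, |c j| ≤ α) → |c ⬝ᵥ g| ≤ (n.factorial : ℤ) * (α : ℤ) ^ n) ∧
      (fun j => (g j : ℝ)) ∈ VV (fun i j => (a i j : ℝ)) w ∧
      ∀ i, 0 ≤ ((fun j => (a i j : ℝ)) ⬝ᵥ (fun j => (g j : ℝ))) * ((fun j => (a i j : ℝ)) ⬝ᵥ w) := by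
  induction N with
  | zero =>
    intro w hw hN
    exfalso
    have h0 : VV (fun i j => (a i j : ℝ)) w = ⊥ := Submodule.finrank_eq_zero.1 (Nat.le_zero.1 hN)
    have : w ∈ VV (fun i j => (a i j : ℝ)) w := fun l hl => hl
    rw [h0] at this
    exact hw this
  | succ N ih =>
    intro w hw hN
    by_cases hone : ∀ v ∈ VV (fun i j => (a i j : ℝ)) w, ∃ c : ℝ, v = c • w
    · obtain ⟨g, hg0, hgb, c, hc⟩ := circ_base a α ha hr w hw hone
      have hmem : (fun j => (g j : ℝ)) ∈ VV (fun i j => (a i j : ℝ)) w := by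
        rw [hc]; intro i hi; rw [dotProduct_smul, hi, smul_zero]
      by_cases hc0 : 0 ≤ c
      · refine ⟨g, hg0, hgb, hmem, fun i => ?_⟩
        rw [hc, dotProduct_smul, smul_eq_mul, mul_assoc]
        exact mul_nonneg hc0 (mul_self_nonneg _)
      · have hneg : (fun j => ((-g) j : ℝ)) = (-c) • w := by
          rw [neg_smul, ← hc]; ext j; simp
        refine ⟨-g, neg_ne_zero.2 hg0, fun c hc => ?_, ?_, fun i => ?_⟩
        · rw [dotProduct_neg, abs_neg]; exact hgb c hc
        · have := neg_mem hmem
          convert this using 1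
          ext j; simp
        · have h4 : (fun j => (((-g) j : ℤ) : ℝ)) = (-c) • w := by
            rw [neg_smul, ← hc]; ext j; simp
          rw [h4, dotProduct_smul, smul_eq_mul, mul_assoc]
          exact mul_nonneg (by linarith) (mul_self_nonneg _)
    · push Not at hone
      obtain ⟨v, hv, hvw⟩ := hone
      have hv0 : v ≠ 0 := fun h => hvw 0 (by simp [h])
      obtain ⟨t, i, hiw, hiv, ht, hz, hl⟩ := step hr hv hv0
      have hlt := VV_lt hv t i hiw hz
      have hfin := Submodule.finrank_lt_finrank_of_lt hlt
      have ht0 : t ≠ 0 := by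
        rw [ht]; exact div_ne_zero (neg_ne_zero.2 hiw) hiv
      have hw' : w + t • v ≠ 0 := by
        intro h
        apply hvw (-t⁻¹)
        have : t • v = -w := by rw [eq_neg_iff_add_eq_zero, add_comm]; exact h
        rw [neg_smul, ← smul_neg, ← this, smul_smul, inv_mul_cancel₀ ht0, one_smul]
      obtain ⟨g, hg0, hgb, hgm, hgs⟩ := ih (w + t • v) hw' (by omega)
      refine ⟨g, hg0, hgb, hlt.le hgm, fun l => ?_⟩
      have h1 := hgs l
      have h2 := hl l
      by_cases hzl : (fun j => (a l j : ℝ)) ⬝ᵥ (w + t • v) = 0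
      · have := hgm l hzl
        change (fun j => (a l j : ℝ)) ⬝ᵥ (fun j => (g j : ℝ)) = 0 at this
        rw [this]; simp
      · rw [dotProduct_add, dotProduct_smul, smul_eq_mul] at h1 hzl
        set p := (fun j => (a l j : ℝ)) ⬝ᵥ w
        set q := t * ((fun j => (a l j : ℝ)) ⬝ᵥ v)
        set s := (fun j => (a l j : ℝ)) ⬝ᵥ (fun j => (g j : ℝ))
        rcases le_total 0 p with hp | hp
        · rw [abs_of_nonneg hp] at h2
          have := (abs_le.1 h2).1
          have h5 : 0 < p + q := lt_of_le_of_ne (by linarith) (Ne.symm hzl)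
          have : 0 ≤ s := nonneg_of_mul_nonneg_left h1 h5
          positivity
        · rw [abs_of_nonpos hp] at h2
          have := (abs_le.1 h2).2
          have h5 : p + q < 0 := lt_of_le_of_ne (by linarith) hzl
          have : s ≤ 0 := by
            by_contra hs; push Not at hs
            nlinarith [mul_neg_of_pos_of_neg hs h5]
          exact mul_nonneg_of_nonpos_of_nonpos this hp

lemma decomp {ι : Type*} [Fintype ι] {n : ℕ} (a : ι → Fin n → ℤ) (α : ℕ)
    (ha : ∀ i j, |a i j| ≤ α)
    (hr : ∀ v : Fin n → ℝ, (∀ i, (fun j => (a i j : ℝ)) ⬝ᵥ v = 0) → v = 0) (N : ℕ) :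
    ∀ (w : Fin n → ℝ)
    (_ : Module.finrank ℝ (VV (fun i j => (a i j : ℝ)) w) ≤ N),
    (∃ g : Fin n → ℤ, g ≠ 0 ∧
      (∀ c : Fin n → ℤ, (∀ j, |c j| ≤ α) → |c ⬝ᵥ g| ≤ (n.factorial : ℤ) * (α : ℤ) ^ n) ∧
      ∀ i, |(fun j => (a i j : ℝ)) ⬝ᵥ (fun j => (g j : ℝ))| ≤ |(fun j => (a i j : ℝ)) ⬝ᵥ w|) ∨
    (∀ c : Fin n → ℤ, (∀ j, |c j| ≤ α) →
      |(fun j => (c j : ℝ)) ⬝ᵥ w| ≤ N * ((n.factorial : ℝ) * (α : ℝ) ^ n)) := by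
  induction N with
  | zero =>
    intro w hN
    right
    have h0 : VV (fun i j => (a i j : ℝ)) w = ⊥ := Submodule.finrank_eq_zero.1 (Nat.le_zero.1 hN)
    have : w ∈ VV (fun i j => (a i j : ℝ)) w := fun l hl => hl
    rw [h0] at this
    have hw : w = 0 := this
    intro c hc
    simp [hw]
  | succ N ih =>
    intro w hN
    by_cases hw : w = 0
    · right; intro c hc; rw [hw]; simp; positivity
    obtain ⟨g, hg0, hgb, hgm, hgs⟩ := circ a α ha hr _ w hw hN
    have hG0 : (fun j => (g j : ℝ)) ≠ 0 := by
      intro h; apply hg0; ext j; have := congrFun h j; simpa using this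
    obtain ⟨t, i, hiw, hiv, ht, hz, hl⟩ := step hr hgm hG0
    have hlt := VV_lt hgm t i hiw hz
    have hfin := Submodule.finrank_lt_finrank_of_lt hlt
    have ht0 : t ≤ 0 := by
      have := hgs i
      rw [ht, neg_div, neg_nonpos]
      have h6 : (fun j => (a i j : ℝ)) ⬝ᵥ w / (fun j => (a i j : ℝ)) ⬝ᵥ (fun j => (g j : ℝ)) =
        ((fun j => (a i j : ℝ)) ⬝ᵥ (fun j => (g j : ℝ)) * (fun j => (a i j : ℝ)) ⬝ᵥ w) /
         ((fun j => (a i j : ℝ)) ⬝ᵥ (fun j => (g j : ℝ)))^2 := by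
        field_simp
      rw [h6]; positivity
    by_cases ht1 : 1 ≤ |t|
    · left
      refine ⟨g, hg0, hgb, fun l => le_trans ?_ (hl l)⟩
      rw [abs_mul]
      exact le_mul_of_one_le_left (abs_nonneg _) ht1
    push Not at ht1
    rcases ih (w + t • fun j => (g j : ℝ)) (by omega) with ⟨g', h1, h2, h3⟩ | h
    · left
      refine ⟨g', h1, h2, fun l => (h3 l).trans ?_⟩
      have h4 := hl l
      have h5 := hgs l
      rw [dotProduct_add, dotProduct_smul, smul_eq_mul]
      set p := (fun j => (a l j : ℝ)) ⬝ᵥ w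
      set s := (fun j => (a l j : ℝ)) ⬝ᵥ (fun j => (g j : ℝ))
      have h7 : p * (t * s) ≤ 0 := by nlinarith
      rw [← sq_le_sq] at *
      nlinarith
    · right
      intro c hc
      have h8 := h c hc
      have h9 : |(fun j => (c j : ℝ)) ⬝ᵥ (fun j => (g j : ℝ))| ≤ (n.factorial : ℝ) * (α : ℝ) ^ n := by
        rw [dot_cast]; exact_mod_cast hgb c hc
      rw [dotProduct_add, dotProduct_smul, smul_eq_mul] at h8
      push_cast
      set p := (fun j => (c j : ℝ)) ⬝ᵥ w
      set s := (fun j => (c j : ℝ)) ⬝ᵥ (fun j => (g j : ℝ))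
      have h10 : |t * s| ≤ (n.factorial : ℝ) * (α : ℝ) ^ n := by
        rw [abs_mul]
        calc _ ≤ 1 * |s| := by gcongr
          _ ≤ _ := by linarith
      have : |p| ≤ |p + t * s| + |t * s| := by
        have := abs_sub (p + t * s) (t * s)
        simpa using this
      linarith

lemma vert_int {m n : ℕ} {A : Matrix (Fin m) (Fin n) ℤ} {b : Fin m → ℤ} {x : Fin n → ℝ}
    (hx : x ∈ vertN m n A b) : ∃ z : Fin n → ℤ, x = (fun j => (z j : ℝ)) ∧
      (∀ i, A i ⬝ᵥ z ≤ b i) ∧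
      ∀ d : Fin n → ℤ, d ≠ 0 → ∃ i, b i - A i ⬝ᵥ z < |A i ⬝ᵥ d| := by
  have hx1 : x ∈ intPoints m n A b := extremePoints_convexHull_subset hx
  obtain ⟨h1, h2⟩ := hx1
  choose z hz using h1
  have hxz : x = (fun j => (z j : ℝ)) := funext hz
  have key : ∀ y : Fin n → ℤ, (∀ i, A i ⬝ᵥ y ≤ b i) →
      (fun j => (y j : ℝ)) ∈ convexHull ℝ (intPoints m n A b) := by
    intro y hy
    apply subset_convexHull
    refine ⟨fun j => ⟨y j, rfl⟩, fun i => ?_⟩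
    have := hy i
    simp only [dotProduct] at this
    beta_reduce
    exact_mod_cast this
  refine ⟨z, hxz, fun i => ?_, ?_⟩
  · have := h2 i
    rw [hxz] at this
    beta_reduce at this
    simp only [dotProduct]
    exact_mod_cast this
  · intro d hd
    by_contra hcon
    push Not at hcon
    have e1 := key (z + d) (fun i => by
      rw [dotProduct_add]; have := (abs_le.1 (hcon i)).2; linarith)
    have e2 := key (z - d) (fun i => by
      rw [dotProduct_sub]; have := (abs_le.1 (hcon i)).1; linarith)
    have e3 := hx.2 e1 e2 ⟨1/2, 1/2, by norm_num, by norm_num, by norm_num, by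
      rw [hxz]; ext j; simp; ring⟩
    apply hd
    ext j
    have := congrFun e3 j
    rw [hxz] at this
    simpa using this

def bk (T ρ s : ℕ) : ℕ := min (T - 1) (if s = 0 then 0 else 1 + Nat.log ρ s)

lemma bk_lt {T : ℕ} (hT : 2 ≤ T) (ρ s : ℕ) : bk T ρ s < T := by
  unfold bk; omega

lemma bk_eq {T q s t : ℕ} (hT : 2 ≤ T) (hq : 1 ≤ q) (h : bk T (q + 1) s = bk T (q + 1) t)
    (hs : s < (q + 1) ^ (T - 2)) : |(s : ℤ) - t| ≤ q * s := by
  unfold bk at h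
  by_cases hs0 : s = 0
  · by_cases ht0 : t = 0
    · subst hs0 ht0; simp
    · rw [if_pos hs0, if_neg ht0] at h; omega
  · have hl := Nat.log_lt_of_lt_pow hs0 hs
    by_cases ht0 : t = 0
    · rw [if_pos ht0, if_neg hs0] at h; omega
    · rw [if_neg ht0, if_neg hs0] at h
      have he : Nat.log (q + 1) s = Nat.log (q + 1) t := by omega
      have h1 := Nat.pow_log_le_self (q + 1) hs0
      have h2 := Nat.lt_pow_succ_log_self (b := q + 1) (by omega) t
      rw [← he, pow_succ] at h2
      have h3 : t < s * (q + 1) := lt_of_lt_of_le h2 (Nat.mul_le_mul_right _ h1)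
      zify at h3 hq
      rw [abs_le]
      constructor <;> nlinarith

lemma inj_aux {m n : ℕ} (hn : 1 ≤ n) {A : Matrix (Fin m) (Fin n) ℤ} {b : Fin m → ℤ} {α : ℕ}
    (hα : 1 ≤ α) (hA : ∀ i j, |A i j| ≤ α) {T q : ℕ} (hT : 2 ≤ T) (hq : 1 ≤ q)
    (hK : n * (n.factorial * α ^ n) ≤ (q + 1) ^ (T - 2)) (z z' w : Fin n → ℤ)
    (hz : ∀ i, A i ⬝ᵥ z ≤ b i) (hz' : ∀ i, A i ⬝ᵥ z' ≤ b i)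
    (hext : ∀ d : Fin n → ℤ, d ≠ 0 → ∃ i, b i - A i ⬝ᵥ z < |A i ⬝ᵥ d|)
    (hw : z' - z = (q : ℤ) • w)
    (hb : ∀ i, bk T (q + 1) (b i - A i ⬝ᵥ z).toNat = bk T (q + 1) (b i - A i ⬝ᵥ z').toNat) :
    w = 0 := by
  by_contra hw0
  have hK' : (n : ℤ) * ((n.factorial : ℤ) * (α : ℤ) ^ n) ≤ (((q + 1) ^ (T - 2) : ℕ) : ℤ) := by
    exact_mod_cast hK
  have hJ : ∀ i, (b i - A i ⬝ᵥ z) < (((q + 1) ^ (T - 2) : ℕ) : ℤ) → |A i ⬝ᵥ w| ≤ b i - A i ⬝ᵥ z := by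
    intro i hi
    have hs0 : 0 ≤ b i - A i ⬝ᵥ z := by linarith [hz i]
    have ht0 : 0 ≤ b i - A i ⬝ᵥ z' := by linarith [hz' i]
    have h1 := bk_eq hT hq (hb i) (by omega)
    rw [Int.toNat_of_nonneg hs0, Int.toNat_of_nonneg ht0] at h1
    have h2 : A i ⬝ᵥ z' - A i ⬝ᵥ z = q * (A i ⬝ᵥ w) := by
      rw [← dotProduct_sub, hw, dotProduct_smul, smul_eq_mul]
    have h3 : b i - A i ⬝ᵥ z - (b i - A i ⬝ᵥ z') = q * (A i ⬝ᵥ w) := by rw [← h2]; ring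
    rw [h3, abs_mul, Nat.abs_cast] at h1
    exact le_of_mul_le_mul_left h1 (by exact_mod_cast hq)
  let a : ({i // (b i - A i ⬝ᵥ z) < (((q + 1) ^ (T - 2) : ℕ) : ℤ)} ⊕ Fin n) → Fin n → ℤ :=
    Sum.elim (fun i => A i.1) (fun j => Pi.single j 1)
  have ha : ∀ i j, |a i j| ≤ α := by
    rintro (i | k) j
    · exact hA _ _
    · simp only [a, Sum.elim_inr, Pi.single_apply]
      split_ifs
      · simpa using hα
      · simp
  have hr : ∀ v : Fin n → ℝ, (∀ i, (fun j => (a i j : ℝ)) ⬝ᵥ v = 0) → v = 0 := by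
    intro v hv
    ext k
    have := hv (Sum.inr k)
    simpa [a, dotProduct, Pi.single_apply] using this
  have hΔ : (n.factorial : ℤ) * (α : ℤ) ^ n ≤ (((q + 1) ^ (T - 2) : ℕ) : ℤ) := by
    refine le_trans ?_ hK'
    exact le_mul_of_one_le_left (by positivity) (by exact_mod_cast hn)
  rcases decomp a α ha hr n (fun j => (w j : ℝ)) (by
    have := Submodule.finrank_le (VV (fun i j => (a i j : ℝ)) (fun j => (w j : ℝ)))
    simpa using this) with ⟨g, hg0, hgb, hgl⟩ | h
  · obtain ⟨i, hi⟩ := hext g hg0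
    by_cases hiJ : (b i - A i ⬝ᵥ z) < (((q + 1) ^ (T - 2) : ℕ) : ℤ)
    · have h1 := hgl (Sum.inl ⟨i, hiJ⟩)
      simp only [a, Sum.elim_inl] at h1
      rw [dot_cast, dot_cast] at h1
      have h2 : |A i ⬝ᵥ g| ≤ |A i ⬝ᵥ w| := by exact_mod_cast h1
      linarith [hJ i hiJ]
    · linarith [hgb (A i) (hA i)]
  · obtain ⟨i, hi⟩ := hext w hw0
    by_cases hiJ : (b i - A i ⬝ᵥ z) < (((q + 1) ^ (T - 2) : ℕ) : ℤ)
    · linarith [hJ i hiJ]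
    · have h1 := h (A i) (hA i)
      rw [dot_cast] at h1
      have h2 : |A i ⬝ᵥ w| ≤ (n : ℤ) * ((n.factorial : ℤ) * (α : ℤ) ^ n) := by exact_mod_cast h1
      linarith

lemma count {m n : ℕ} (hn : 1 ≤ n) {A : Matrix (Fin m) (Fin n) ℤ} {b : Fin m → ℤ} {α : ℕ}
    (hα : 1 ≤ α) (hA : ∀ i j, |A i j| ≤ α) {T q : ℕ} (hT : 2 ≤ T) (hq : 1 ≤ q)
    (hK : n * (n.factorial * α ^ n) ≤ (q + 1) ^ (T - 2)) :
    (vertN m n A b).Finite ∧ (vertN m n A b).ncard ≤ q ^ n * T ^ m := by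
  have : NeZero q := ⟨by omega⟩
  choose Z hZ1 hZ2 hZ3 using fun x : vertN m n A b => vert_int x.2
  let f : vertN m n A b → (Fin n → ZMod q) × (Fin m → Fin T) := fun x =>
    (fun j => (Z x j : ZMod q), fun i => ⟨bk T (q + 1) (b i - A i ⬝ᵥ Z x).toNat, bk_lt hT _ _⟩)
  have hf : Function.Injective f := by
    intro x y hxy
    have h1 : ∀ j, (q : ℤ) ∣ Z y j - Z x j := by
      intro j
      have := congrFun (congrArg Prod.fst hxy) j
      exact (ZMod.intCast_eq_intCast_iff_dvd_sub _ _ _).1 this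
    choose w hw using h1
    have hw' : Z y - Z x = (q : ℤ) • w := by ext j; simpa using hw j
    have h0 := inj_aux hn hα hA hT hq hK (Z x) (Z y) w (hZ2 x) (hZ2 y) (hZ3 x) hw' (fun i => by
      have := congrFun (congrArg Prod.snd hxy) i
      exact congrArg Fin.val this)
    rw [h0, smul_zero, sub_eq_zero] at hw'
    apply Subtype.ext
    rw [hZ1 x, hZ1 y, hw']
  constructor
  · exact Set.finite_coe_iff.1 (Finite.of_injective f hf)
  · have := Nat.card_le_card_of_injective f hf
    rw [Nat.card_coe_set_eq] at this
    simpa [Nat.card_eq_fintype_card] using this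

lemma one_dim {m : ℕ} {A : Matrix (Fin m) (Fin 1) ℤ} {b : Fin m → ℤ} :
    (vertN m 1 A b).Finite ∧ (vertN m 1 A b).ncard ≤ 2 := by
  have key : ∀ x ∈ vertN m 1 A b, ∀ y ∈ vertN m 1 A b, ∀ z ∈ vertN m 1 A b,
      x 0 < y 0 → y 0 < z 0 → False := by
    intro x hx y hy z hz h1 h2
    have := hy.2 hx.1 hz.1 ⟨(z 0 - y 0) / (z 0 - x 0), (y 0 - x 0) / (z 0 - x 0),
      div_pos (by linarith) (by linarith), div_pos (by linarith) (by linarith), by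
        rw [← add_div]; apply (div_eq_one_iff_eq (by linarith)).2; ring, by
        ext j; fin_cases j
        have : z 0 - x 0 ≠ 0 := by linarith
        simp; field_simp; ring⟩
    rw [this] at h1
    exact lt_irrefl _ h1
  have h3 : ∀ t : Finset (Fin 1 → ℝ), (t : Set (Fin 1 → ℝ)) ⊆ vertN m 1 A b → t.card ≤ 2 := by
    intro t ht
    by_contra hc
    push Not at hc
    obtain ⟨x, y, z, hx, hy, hz, hxy, hxz, hyz⟩ := Finset.two_lt_card_iff.1 hc
    have ne : ∀ u v : Fin 1 → ℝ, u ≠ v → u 0 ≠ v 0 := by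
      intro u v huv h; apply huv; ext j; fin_cases j; exact h
    have hx := ht hx
    have hy := ht hy
    have hz := ht hz
    rcases lt_or_gt_of_ne (ne _ _ hxy) with h1 | h1 <;>
    rcases lt_or_gt_of_ne (ne _ _ hxz) with h2 | h2 <;>
    rcases lt_or_gt_of_ne (ne _ _ hyz) with h3 | h3
    all_goals first
      | exact key x hx y hy z hz (by assumption) (by assumption)
      | exact key x hx z hz y hy (by assumption) (by assumption)
      | exact key y hy x hx z hz (by assumption) (by assumption)
      | exact key y hy z hz x hx (by assumption) (by assumption)
      | exact key z hz x hx y hy (by assumption) (by assumption)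
      | exact key z hz y hy x hx (by assumption) (by assumption)
  have hfin : (vertN m 1 A b).Finite := by
    by_contra hinf
    obtain ⟨t, ht, htc⟩ := (show (vertN m 1 A b).Infinite from hinf).exists_subset_card_eq 3
    have := h3 t ht
    omega
  refine ⟨hfin, ?_⟩
  rw [Set.ncard_eq_toFinset_card _ hfin]
  exact h3 _ (by simp)

/-- If `α = max |a_{ij}|`, then `|N(A,b)| ≤ (1 + log₂(n+1) + n·log₂(α·√n))^{2n+m-1}`. -/
theorem card_vertN_le (m n : ℕ) (A : Matrix (Fin m) (Fin n) ℤ) (b : Fin m → ℤ)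
    (α : ℕ) (hα : α = Finset.univ.sup fun p : Fin m × Fin n => (A p.1 p.2).natAbs) :
    (vertN m n A b).Finite ∧
      ((vertN m n A b).ncard : ℝ) ≤
        (1 + Real.logb 2 (n + 1) + n * Real.logb 2 (α * Real.sqrt n)) ^ (2 * n + m - 1) := by
  have hA : ∀ i j, |A i j| ≤ α := by
    intro i j
    have h1 : (A i j).natAbs ≤ α := by
      rw [hα]
      exact Finset.le_sup (f := fun p : Fin m × Fin n => (A p.1 p.2).natAbs) (Finset.mem_univ (i, j))
    rw [Int.abs_eq_natAbs]; exact_mod_cast h1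
  have hL0 : 0 ≤ Real.logb 2 ((n : ℝ) + 1) :=
    Real.logb_nonneg (by norm_num) (by linarith [Nat.cast_nonneg (α := ℝ) n])
  rcases Nat.eq_zero_or_pos n with rfl | hn
  · have hs : (vertN m 0 A b).Subsingleton := Set.subsingleton_of_subsingleton
    refine ⟨hs.finite, ?_⟩
    simp only [Nat.cast_zero, zero_add, Real.logb_one, zero_mul, add_zero, one_pow]
    exact_mod_cast Set.ncard_le_one_iff_subsingleton.2 hs
  rcases Nat.eq_zero_or_pos α with h0 | hα1
  · have he : vertN m n A b = ∅ := by
      rw [Set.eq_empty_iff_forall_notMem]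
      intro x hx
      obtain ⟨z, -, hz, hext⟩ := vert_int hx
      obtain ⟨i, hi⟩ := hext (fun _ => 1) (fun h => by simpa using congrFun h ⟨0, hn⟩)
      have hA0 : A i = 0 := by
        ext j
        have := hA i j
        rw [h0] at this
        simpa using this
      have := hz i
      rw [hA0] at hi this
      simp at hi this
      omega
    rw [he]
    refine ⟨Set.finite_empty, ?_⟩
    rw [h0]
    simp
    positivity
  have hm : 1 ≤ m := by
    by_contra hm
    have : m = 0 := by omega
    subst this
    simp at hα
    omega
  have hαr : (1 : ℝ) ≤ α := by exact_mod_cast hα1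
  set B : ℝ := 1 + Real.logb 2 (n + 1) + n * Real.logb 2 (α * Real.sqrt n) with hB
  have hsn : (1 : ℝ) ≤ Real.sqrt n := Real.one_le_sqrt.2 (by exact_mod_cast hn)
  have hαs : (1 : ℝ) ≤ α * Real.sqrt n := one_le_mul_of_one_le_of_one_le hαr hsn
  have hBlog : B = 1 + Real.logb 2 ((n + 1) * (α * Real.sqrt n) ^ n) := by
    rw [hB, Real.logb_mul (x := (n : ℝ) + 1) (by positivity) (by positivity), Real.logb_pow]; ring
  have hXB : ∀ k : ℕ, (2 : ℝ) ^ k ≤ (n + 1) * (α * Real.sqrt n) ^ n → (k : ℝ) + 1 ≤ B := by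
    intro k hk
    have := Real.logb_le_logb_of_le (b := 2) (by norm_num) (by positivity) hk
    rw [Real.logb_pow, Real.logb_self_eq_one (by norm_num)] at this
    rw [hBlog]; linarith
  have h2T : ((n : ℝ) + 1) * (α * Real.sqrt n) ^ n < 2 ^ ⌊B⌋₊ := by
    have h1 : B < ⌊B⌋₊ + 1 := Nat.lt_floor_add_one B
    rw [hBlog] at h1
    have h2 : Real.logb 2 ((n + 1) * (α * Real.sqrt n) ^ n) < (⌊B⌋₊ : ℝ) := by
      rw [← hBlog] at h1; linarith
    rw [Real.logb_lt_iff_lt_rpow (by norm_num) (by positivity)] at h2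
    exact_mod_cast h2
  have hsq : Real.sqrt n ^ 2 = n := Real.sq_sqrt (by positivity)
  have hX4 : ((n : ℝ) + 1) ^ 2 * (α ^ n) ^ 2 * n ^ n < 4 ^ ⌊B⌋₊ := by
    have h3 := pow_lt_pow_left₀ h2T (by positivity) (n := 2) (by norm_num)
    have h4 : (((n : ℝ) + 1) * (α * Real.sqrt n) ^ n) ^ 2 = ((n : ℝ) + 1) ^ 2 * (α ^ n) ^ 2 * n ^ n := by
      have h5 : (Real.sqrt n ^ n) ^ 2 = (n : ℝ) ^ n := by
        rw [← pow_mul, mul_comm, pow_mul, hsq]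
      rw [← h5]; ring
    have h6 : ((2 : ℝ) ^ ⌊B⌋₊) ^ 2 = 4 ^ ⌊B⌋₊ := by
      rw [← pow_mul, mul_comm, pow_mul]; norm_num
    rwa [h4, h6] at h3
  set T := ⌊B⌋₊ with hTdef
  -- reduction
  have red : ∀ q : ℕ, 1 ≤ q → 2 ≤ T → n * (n.factorial * α ^ n) ≤ (q + 1) ^ (T - 2) →
      (q : ℝ) ^ n ≤ B ^ (2 * n - 1) → (vertN m n A b).Finite ∧
      ((vertN m n A b).ncard : ℝ) ≤ B ^ (2 * n + m - 1) := by
    intro q hq hT hK hqB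
    obtain ⟨hf, hc⟩ := count hn hα1 hA (b := b) hT hq hK
    refine ⟨hf, ?_⟩
    have hB0 : 0 ≤ B := by
      by_contra h
      have : T = 0 := Nat.floor_of_nonpos (by linarith)
      omega
    have hTB : (T : ℝ) ≤ B := Nat.floor_le hB0
    calc ((vertN m n A b).ncard : ℝ) ≤ (q : ℝ) ^ n * (T : ℝ) ^ m := by exact_mod_cast hc
      _ ≤ B ^ (2 * n - 1) * B ^ m := by gcongr
      _ = B ^ (2 * n + m - 1) := by rw [← pow_add]; congr 1; omega
  rcases (by omega : n = 1 ∨ n = 2 ∨ 3 ≤ n) with rfl | rfl | hn3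
  · obtain ⟨hf, hc⟩ := one_dim (A := A) (b := b)
    refine ⟨hf, ?_⟩
    have hB2 : 2 ≤ B := by
      have := hXB 1 (by norm_num; linarith)
      norm_num at this; exact this
    calc ((vertN m 1 A b).ncard : ℝ) ≤ 2 := by exact_mod_cast hc
      _ ≤ B := hB2
      _ = B ^ 1 := (pow_one _).symm
      _ ≤ B ^ (2 * 1 + m - 1) := pow_le_pow_right₀ (by linarith) (by omega)
  · have hα2 : (1 : ℝ) ≤ (α : ℝ) ^ 2 := one_le_pow₀ hαr
    have hX : ((2 : ℕ) + 1 : ℝ) * (α * Real.sqrt (2 : ℕ)) ^ 2 = 6 * α ^ 2 := by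
      rw [mul_pow, hsq]; push_cast; ring
    have hB35 : 7 / 2 ≤ B := by
      rw [hX] at hBlog
      have h1 : (5 / 2 : ℝ) ≤ Real.logb 2 (6 * α ^ 2) := by
        have : (5 : ℝ) ≤ Real.logb 2 ((6 * α ^ 2) ^ 2) := by
          rw [Real.le_logb_iff_rpow_le (by norm_num) (by positivity)]
          norm_num
          nlinarith
        rw [Real.logb_pow] at this
        push_cast at this; linarith
      rw [hBlog]; linarith
    have hT3 : 3 ≤ T := Nat.le_floor (by norm_num; linarith)
    apply red 6 (by norm_num) (by omega)
    · rw [hX] at h2T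
      have h2T' : 6 * α ^ 2 < 2 ^ T := by exact_mod_cast h2T
      obtain ⟨k, hk⟩ : ∃ k, T = k + 3 := ⟨T - 3, by omega⟩
      rw [hk] at h2T' ⊢
      have h7 : 2 ^ k ≤ 7 ^ k := Nat.pow_le_pow_left (by norm_num) k
      simp only [show k + 3 - 2 = k + 1 by omega]
      rw [pow_succ (6 + 1) k]
      rw [pow_add] at h2T'
      rw [show Nat.factorial 2 = 2 from rfl]
      norm_num at h2T' ⊢
      nlinarith
    · norm_num
      calc (36 : ℝ) ≤ (7 / 2) ^ 3 := by norm_num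
        _ ≤ B ^ 3 := by gcongr
  · have hn3r : (3 : ℝ) ≤ n := by exact_mod_cast hn3
    have hB5 : 5 ≤ B := by
      have := hXB 4 (by
        have h1 : (4 : ℝ) ≤ (α * Real.sqrt n) ^ n := by
          have h3 : (1.7 : ℝ) ≤ α * Real.sqrt n := by
            have : (1.7 : ℝ) ≤ Real.sqrt n := Real.le_sqrt_of_sq_le (by norm_num; linarith)
            nlinarith
          calc (4 : ℝ) ≤ 1.7 ^ 3 := by norm_num
            _ ≤ (α * Real.sqrt n) ^ 3 := by gcongr
            _ ≤ _ := pow_le_pow_right₀ hαs hn3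
        nlinarith)
      norm_num at this; exact this
    have hT5 : 5 ≤ T := Nat.le_floor (by norm_num; linarith)
    apply red 10 (by norm_num) (by omega)
    · have hX4' : (n + 1) ^ 2 * (α ^ n) ^ 2 * n ^ n < 4 ^ T := by exact_mod_cast hX4
      have h1 : n * (n.factorial * α ^ n) ≤ (n + 1) ^ 2 * (α ^ n) ^ 2 * n ^ n := by
        have e1 : n ≤ (n + 1) ^ 2 := by nlinarith
        have e2 := Nat.factorial_le_pow n
        have e3 : α ^ n ≤ (α ^ n) ^ 2 := Nat.le_self_pow (by norm_num) _
        calc n * (n.factorial * α ^ n) ≤ (n + 1) ^ 2 * (n ^ n * (α ^ n) ^ 2) := by gcongr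
          _ = _ := by ring
      obtain ⟨k, hk⟩ : ∃ k, T = k + 5 := ⟨T - 5, by omega⟩
      have h7 : 4 ^ k ≤ 11 ^ k := Nat.pow_le_pow_left (by norm_num) k
      rw [hk] at hX4' ⊢
      simp only [show k + 5 - 2 = k + 3 by omega]
      rw [pow_add] at hX4' ⊢
      norm_num at hX4' ⊢
      omega
    · have h25 : (10 : ℝ) ^ n * 5 ≤ 25 ^ n := by
        obtain ⟨k, rfl⟩ : ∃ k, n = k + 3 := ⟨n - 3, by omega⟩
        have : (10 : ℝ) ^ k ≤ 25 ^ k := by gcongr; norm_num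
        rw [pow_add, pow_add]
        norm_num; nlinarith [pow_pos (show (0 : ℝ) < 10 by norm_num) k]
      have h5 : (5 : ℝ) ^ (2 * n - 1) * 5 = 25 ^ n := by
        rw [← pow_succ, show 2 * n - 1 + 1 = 2 * n by omega, pow_mul]; norm_num
      have h6 : (5 : ℝ) ^ (2 * n - 1) ≤ B ^ (2 * n - 1) := by gcongr
      push_cast
      linarith
end

section
/- Let a₀, a₁, …, aₙ be natural numbers and a = (a₁,…,aₙ). Then |𝒩(a,a₀)| ≤ ∏_{j=1}^{n} (1 + log₂(1 + a₀/aⱼ)). -/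
/-- `ℳ(a, a₀)`: the set of nonnegative integer solutions of `∑ aⱼ xⱼ ≤ a₀`,
viewed inside `ℝⁿ`. -/
def knapPoints (n : ℕ) (a : Fin n → ℕ) (a₀ : ℕ) : Set (Fin n → ℝ) :=
  {x | (∀ j, ∃ z : ℤ, x j = (z : ℝ)) ∧ (∀ j, 0 ≤ x j) ∧
       ∑ j, (a j : ℝ) * x j ≤ (a₀ : ℝ)}

/-- `𝒩(a, a₀)`: the set of vertices (extreme points) of the knapsack polytope,
the convex hull of `ℳ(a, a₀)`. -/
def knapVert (n : ℕ) (a : Fin n → ℕ) (a₀ : ℕ) : Set (Fin n → ℝ) :=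
  Set.extremePoints ℝ (convexHull ℝ (knapPoints n a a₀))

theorem knap_nat_coord {n : ℕ} {a : Fin n → ℕ} {a₀ : ℕ} {x : Fin n → ℝ}
    (hx : x ∈ knapPoints n a a₀) (j : Fin n) : ((⌊x j⌋₊ : ℕ) : ℝ) = x j := by
  obtain ⟨h1, h2, -⟩ := hx
  obtain ⟨z, hz⟩ := h1 j
  have h0 := h2 j
  rw [hz] at h0 ⊢
  have hz0 : 0 ≤ z := by exact_mod_cast h0
  lift z to ℕ using hz0
  simp

theorem knap_log_aux {u v : ℕ} (h : Nat.log 2 (u + 1) = Nat.log 2 (v + 1)) : v ≤ 2 * u := by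
  have h1 : 2 ^ Nat.log 2 (u + 1) ≤ u + 1 := Nat.pow_log_le_self 2 (by omega)
  have h2 : v + 1 < 2 ^ (Nat.log 2 (v + 1) + 1) := Nat.lt_pow_succ_log_self (by norm_num) _
  rw [← h, pow_succ] at h2
  omega

theorem knap_reflect {n : ℕ} {a : Fin n → ℕ} {a₀ : ℕ} {x y : Fin n → ℝ}
    (hx : x ∈ knapVert n a a₀) (hy : y ∈ knapVert n a a₀)
    (hf : ∀ j, Nat.log 2 (⌊x j⌋₊ + 1) = Nat.log 2 (⌊y j⌋₊ + 1))
    (hle : ∑ j, (a j : ℝ) * x j ≤ ∑ j, (a j : ℝ) * y j) : x = y := by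
  have hxM : x ∈ knapPoints n a a₀ := extremePoints_convexHull_subset hx
  have hyM : y ∈ knapPoints n a a₀ := extremePoints_convexHull_subset hy
  have hw : (fun j => 2 * x j - y j) ∈ knapPoints n a a₀ := by
    refine ⟨fun j => ?_, fun j => ?_, ?_⟩
    · obtain ⟨z, hz⟩ := hxM.1 j
      obtain ⟨w, hw⟩ := hyM.1 j
      exact ⟨2 * z - w, by simp [hz, hw]⟩
    · have h := knap_log_aux (hf j)
      have h' : ((⌊y j⌋₊ : ℕ) : ℝ) ≤ 2 * ((⌊x j⌋₊ : ℕ) : ℝ) := by exact_mod_cast h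
      rw [knap_nat_coord hxM, knap_nat_coord hyM] at h'
      simpa using h'
    · have e : ∑ j, (a j : ℝ) * (2 * x j - y j)
          = 2 * ∑ j, (a j : ℝ) * x j - ∑ j, (a j : ℝ) * y j := by
        rw [Finset.mul_sum, ← Finset.sum_sub_distrib]
        exact Finset.sum_congr rfl fun j _ => by ring
      have := hxM.2.2
      simp only [e]
      linarith
  have hseg : x ∈ openSegment ℝ y (fun j => 2 * x j - y j) := by
    refine ⟨1 / 2, 1 / 2, by norm_num, by norm_num, by norm_num, ?_⟩
    ext j
    simp
    ring
  exact (hx.2 (subset_convexHull ℝ _ hyM) (subset_convexHull ℝ _ hw) hseg).symm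

/-- `|𝒩(a, a₀)| ≤ ∏_{j=1}^{n} (1 + log₂(1 + a₀/aⱼ))`. -/
theorem card_knapVert_le (n : ℕ) (a : Fin n → ℕ) (a₀ : ℕ)
    (ha : ∀ j, 0 < a j) (ha₀ : 0 < a₀) :
    (knapVert n a a₀).Finite ∧
      ((knapVert n a a₀).ncard : ℝ) ≤
        ∏ j, (1 + Real.logb 2 (1 + (a₀ : ℝ) / (a j : ℝ))) := by
  let f : (Fin n → ℝ) → (Fin n → ℕ) := fun x j => Nat.log 2 (⌊x j⌋₊ + 1)
  let T : Finset (Fin n → ℕ) :=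
    Fintype.piFinset fun j => Finset.range (Nat.log 2 (a₀ / a j + 1) + 1)
  have hinj : Set.InjOn f (knapVert n a a₀) := by
    intro x hx y hy hxy
    rcases le_total (∑ j, (a j : ℝ) * x j) (∑ j, (a j : ℝ) * y j) with h | h
    · exact knap_reflect hx hy (fun j => congrFun hxy j) h
    · exact (knap_reflect hy hx (fun j => (congrFun hxy j).symm) h).symm
  have hmaps : ∀ x ∈ knapVert n a a₀, f x ∈ (T : Set (Fin n → ℕ)) := by
    intro x hx
    have hxM : x ∈ knapPoints n a a₀ := extremePoints_convexHull_subset hx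
    simp only [T, Finset.mem_coe, Fintype.mem_piFinset, Finset.mem_range]
    intro j
    refine Nat.lt_succ_of_le (Nat.log_mono_right (Nat.succ_le_succ ?_))
    rw [Nat.le_div_iff_mul_le (ha j)]
    have h1 : (a j : ℝ) * x j ≤ ∑ j, (a j : ℝ) * x j :=
      Finset.single_le_sum (f := fun j => (a j : ℝ) * x j)
        (fun i _ => mul_nonneg (Nat.cast_nonneg _) (hxM.2.1 i)) (Finset.mem_univ j)
    have h2 := h1.trans hxM.2.2
    rw [← knap_nat_coord hxM j, mul_comm] at h2
    exact_mod_cast h2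
  refine ⟨Set.Finite.of_injOn hmaps hinj T.finite_toSet, ?_⟩
  have hc : (knapVert n a a₀).ncard ≤ T.card := by
    rw [← Set.ncard_coe_finset]
    exact Set.ncard_le_ncard_of_injOn f hmaps hinj T.finite_toSet
  calc ((knapVert n a a₀).ncard : ℝ) ≤ (T.card : ℝ) := by exact_mod_cast hc
    _ = ∏ j, ((Nat.log 2 (a₀ / a j + 1) : ℝ) + 1) := by simp [T, Fintype.card_piFinset]
    _ ≤ _ := by
      refine Finset.prod_le_prod (fun j _ => by positivity) fun j _ => ?_
      have h1 := Real.natLog_le_logb (a₀ / a j + 1) 2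
      have h2 : Real.logb 2 ((a₀ / a j + 1 : ℕ) : ℝ)
          ≤ Real.logb 2 (1 + (a₀ : ℝ) / (a j : ℝ)) := by
        refine Real.logb_le_logb_of_le (by norm_num) (by positivity) ?_
        have := @Nat.cast_div_le ℝ _ _ _ a₀ (a j)
        push_cast
        linarith
      push_cast at h1 h2 ⊢
      linarith
end

section
/- Let n ≥ 2, let a₀, a₁, …, aₙ be natural numbers, a = (a₁,…,aₙ), and γ = min{aⱼ : j = 1,…,n}. Then |𝒩(a,a₀)| ≤ n log₂(2n) · (1 + log₂(1 + a₀/γ))^{n−1}. -/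
/-- Integer points which are not midpoints of two other feasible points. -/
def kP (n : ℕ) (a : Fin n → ℕ) (a₀ : ℕ) (x : Fin n → ℕ) : Prop :=
  ∑ j, a j * x j ≤ a₀ ∧ ∀ y z : Fin n → ℕ, ∑ j, a j * y j ≤ a₀ → ∑ j, a j * z j ≤ a₀ →
    (∀ j, y j + z j = 2 * x j) → y = x

lemma knapVert_sub (n : ℕ) (a : Fin n → ℕ) (a₀ : ℕ) :
    knapVert n a a₀ ⊆ (fun (x : Fin n → ℕ) (j : Fin n) => (x j : ℝ)) '' {x | kP n a a₀ x} := by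
  intro x hx
  have hxA : x ∈ knapPoints n a a₀ := extremePoints_convexHull_subset hx
  have h1 : ∀ j, ∃ k : ℕ, x j = (k : ℝ) := by
    intro j
    obtain ⟨z, hz⟩ := hxA.1 j
    have h0 := hxA.2.1 j
    rw [hz] at h0
    have h0' : 0 ≤ z := by exact_mod_cast h0
    lift z to ℕ using h0'
    exact ⟨z, by simpa using hz⟩
  choose u hu using h1
  have hmem : ∀ y : Fin n → ℕ, ∑ j, a j * y j ≤ a₀ →
      (fun j => (y j : ℝ)) ∈ knapPoints n a a₀ := by
    intro y hy
    refine ⟨fun j => ⟨y j, by simp⟩, fun j => by positivity, ?_⟩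
    show ∑ j, (a j : ℝ) * (y j : ℝ) ≤ (a₀ : ℝ)
    exact_mod_cast hy
  refine ⟨u, ⟨?_, ?_⟩, ?_⟩
  · have := hxA.2.2
    simp only [hu] at this
    exact_mod_cast this
  · intro y z hy hz hyz
    have hext := (mem_extremePoints.1 hx).2 _ (subset_convexHull ℝ _ (hmem y hy)) _
      (subset_convexHull ℝ _ (hmem z hz)) ⟨1/2, 1/2, by norm_num, by norm_num, by norm_num, by
        funext j
        have : (y j : ℝ) + z j = 2 * u j := by exact_mod_cast hyz j
        simp only [Pi.add_apply, Pi.smul_apply, smul_eq_mul, hu]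
        linarith⟩
    funext j
    have := congrFun hext.1 j
    rw [hu] at this
    exact_mod_cast this
  · funext j
    exact (hu j).symm

lemma kP_slack {n : ℕ} {a : Fin n → ℕ} {a₀ : ℕ} {x : Fin n → ℕ} (h : kP n a a₀ x) (j : Fin n)
    (hj : 0 < x j) : a₀ < ∑ i, a i * x i + a j := by
  by_contra! hc
  have hp : ∑ i, a i * (x i + if i = j then 1 else 0) ≤ a₀ := by
    simpa [mul_add, Finset.sum_add_distrib] using hc
  have hm : ∑ i, a i * (x i - if i = j then 1 else 0) ≤ a₀ :=
    le_trans (Finset.sum_le_sum fun i _ => Nat.mul_le_mul_left _ (Nat.sub_le _ _)) h.1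
  have := h.2 _ _ hp hm (by intro i; split_ifs with hi <;> [subst hi; skip] <;> omega)
  have := congrFun this j
  simp at this

lemma kP_inj {n : ℕ} {a : Fin n → ℕ} {a₀ : ℕ} {x y : Fin n → ℕ} (hx : kP n a a₀ x)
    (hy : kP n a a₀ y) (h1 : ∀ i, x i ≤ 2 * y i) (h2 : ∀ i, y i ≤ 2 * x i) : x = y := by
  wlog hle : ∑ j, a j * x j ≤ ∑ j, a j * y j generalizing x y
  · exact (this hy hx h2 h1 (by omega)).symm
  have hz : ∑ j, a j * (2 * x j - y j) ≤ a₀ := by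
    have : ∑ j, a j * (2 * x j - y j) + ∑ j, a j * y j = 2 * ∑ j, a j * x j := by
      rw [← Finset.sum_add_distrib, Finset.mul_sum]
      refine Finset.sum_congr rfl fun i _ => ?_
      rw [← mul_add, Nat.sub_add_cancel (h2 i)]; ring
    have := hx.1
    omega
  exact (hx.2 y _ hy.1 hz (fun j => by have := h2 j; omega)).symm

lemma log_eq_le {u v : ℕ} (h : Nat.log 2 (1 + u) = Nat.log 2 (1 + v)) : u ≤ 2 * v := by
  have h1 : 2 ^ Nat.log 2 (1 + u) ≤ 1 + u := Nat.pow_log_le_self 2 (by omega)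
  have h2 : 1 + u < 2 ^ (Nat.log 2 (1 + u) + 1) := Nat.lt_pow_succ_log_self (by norm_num) _
  have h3 : 2 ^ Nat.log 2 (1 + v) ≤ 1 + v := Nat.pow_log_le_self 2 (by omega)
  rw [h, pow_succ] at h2
  omega

lemma log_div_eq_le {A c u v : ℕ} (hu : 0 < c * u) (huA : c * u ≤ A) (hv : 0 < c * v)
    (h : Nat.log 2 (A / (c * u)) = Nat.log 2 (A / (c * v))) : u ≤ 2 * v := by
  have h1 : 2 ^ Nat.log 2 (A / (c * u)) ≤ A / (c * u) :=
    Nat.pow_log_le_self 2 (Nat.div_pos huA hu).ne'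
  have h2 : A / (c * v) < 2 ^ (Nat.log 2 (A / (c * v)) + 1) :=
    Nat.lt_pow_succ_log_self (by norm_num) _
  rw [← h] at h2
  rw [Nat.le_div_iff_mul_le hu] at h1
  rw [Nat.div_lt_iff_lt_mul hv] at h2
  have hc : 0 < c := Nat.pos_of_mul_pos_right hu
  have h4 : (2 ^ Nat.log 2 (A / (c * u)) * c) * u < (2 ^ Nat.log 2 (A / (c * u)) * c) * (2 * v) := by
    calc _ = 2 ^ Nat.log 2 (A / (c * u)) * (c * u) := by ring
      _ < _ := lt_of_le_of_lt h1 h2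
      _ = _ := by ring
  exact (lt_of_mul_lt_mul_left h4 (by positivity)).le

lemma kP_card (m : ℕ) (hm : 1 ≤ m) (a : Fin (m + 1) → ℕ) (a₀ γ : ℕ) (hγ : 0 < γ)
    (ha : ∀ j, γ ≤ a j) :
    {x | kP (m + 1) a a₀ x}.Finite ∧ {x | kP (m + 1) a a₀ x}.ncard ≤
      (m + 1) * ((Nat.log 2 (m + 1) + 1) * (Nat.log 2 (1 + a₀ / γ) + 1) ^ m) := by
  classical
  have hmax : ∀ x : Fin (m + 1) → ℕ, ∃ j, ∀ i, a i * x i ≤ a j * x j :=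
    fun x => Finite.exists_max fun i => a i * x i
  choose J hJ using hmax
  have hap : ∀ j, 0 < a j := fun j => lt_of_lt_of_le hγ (ha j)
  have hJpos : ∀ x : Fin (m + 1) → ℕ, x ≠ 0 → 0 < x (J x) := by
    intro x hx
    obtain ⟨i, hi⟩ := Function.ne_iff.1 hx
    have h1 := hJ x i
    have h2 : 0 < a i * x i := Nat.mul_pos (hap i) (Nat.pos_of_ne_zero hi)
    exact Nat.pos_of_mul_pos_left (lt_of_lt_of_le h2 h1)
  have hterm : ∀ x, kP (m + 1) a a₀ x → ∀ i, a i * x i ≤ a₀ := fun x hx i =>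
    le_trans (Finset.single_le_sum (f := fun i => a i * x i) (fun _ _ => Nat.zero_le _)
      (Finset.mem_univ i)) hx.1
  let g : (Fin (m + 1) → ℕ) → Fin (m + 1) × ℕ × (Fin m → ℕ) := fun x =>
    (J x, if x = 0 then Nat.log 2 (m + 1) else Nat.log 2 (a₀ / (a (J x) * x (J x))),
      fun i => Nat.log 2 (1 + x ((J x).succAbove i)))
  let T : Finset (Fin (m + 1) × ℕ × (Fin m → ℕ)) := Finset.univ ×ˢ
    (Finset.range (Nat.log 2 (m + 1) + 1) ×ˢ
      Fintype.piFinset fun _ => Finset.range (Nat.log 2 (1 + a₀ / γ) + 1))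
  have hmaps : Set.MapsTo g {x | kP (m + 1) a a₀ x} (T : Set _) := by
    intro x hx
    have hx : kP (m + 1) a a₀ x := hx
    simp only [T, g, Finset.mem_coe, Finset.mem_product, Finset.mem_univ, true_and,
      Finset.mem_range, Fintype.mem_piFinset]
    refine ⟨?_, fun i => ?_⟩
    · split_ifs with h0
      · omega
      · have hp := hJpos x h0
        have hs := kP_slack hx _ hp
        have hsum : ∑ i, a i * x i ≤ (m + 1) * (a (J x) * x (J x)) := by
          have := Finset.sum_le_card_nsmul Finset.univ (fun i => a i * x i) _ (fun i _ => hJ x i)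
          simpa using this
        have hle : a (J x) ≤ a (J x) * x (J x) := Nat.le_mul_of_pos_right _ hp
        have hlt : a₀ / (a (J x) * x (J x)) < m + 1 + 1 := by
          rw [Nat.div_lt_iff_lt_mul (Nat.mul_pos (hap _) hp)]
          rw [add_mul, one_mul]
          omega
        have := Nat.log_mono_right (b := 2) (Nat.le_of_lt_succ hlt)
        omega
    · refine Nat.lt_succ_of_le (Nat.log_mono_right ?_)
      have h1 := hterm x hx ((J x).succAbove i)
      have : x ((J x).succAbove i) ≤ a₀ / γ := by
        rw [Nat.le_div_iff_mul_le hγ, mul_comm]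
        exact le_trans (Nat.mul_le_mul_right _ (ha _)) h1
      omega
  have hlog : 1 ≤ Nat.log 2 (m + 1) := Nat.log_pos (by norm_num) (by omega)
  have hzero : ∀ y, kP (m + 1) a a₀ y → y ≠ 0 → g 0 ≠ g y := by
    intro y hy hy0 he
    simp only [g, Prod.mk.injEq, if_true, if_neg hy0] at he
    obtain ⟨-, h2, h3⟩ := he
    have hp := hJpos y hy0
    have hs := kP_slack hy _ hp
    have hz : ∀ i, y ((J y).succAbove i) = 0 := by
      intro i
      have := log_eq_le (congrFun h3 i).symm
      simpa using this
    rw [Fin.sum_univ_succAbove _ (J y)] at hs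
    simp only [hz, mul_zero, Finset.sum_const_zero, add_zero] at hs
    have hle : a (J y) ≤ a (J y) * y (J y) := Nat.le_mul_of_pos_right _ hp
    have hlt : a₀ / (a (J y) * y (J y)) < 2 := by
      rw [Nat.div_lt_iff_lt_mul (Nat.mul_pos (hap _) hp)]
      omega
    rw [Nat.log_of_lt hlt] at h2
    omega
  have hinj : Set.InjOn g {x | kP (m + 1) a a₀ x} := by
    intro x hx y hy he
    have hx : kP (m + 1) a a₀ x := hx
    have hy : kP (m + 1) a a₀ y := hy
    by_cases hx0 : x = 0
    · by_cases hy0 : y = 0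
      · rw [hx0, hy0]
      · exact absurd (hx0 ▸ he) (hzero y hy hy0)
    by_cases hy0 : y = 0
    · exact absurd (hy0 ▸ he).symm (hzero x hx hx0)
    simp only [g, Prod.mk.injEq, if_neg hx0, if_neg hy0] at he
    obtain ⟨h1, h2, h3⟩ := he
    have hpx := Nat.mul_pos (hap (J x)) (hJpos x hx0)
    have hpy := Nat.mul_pos (hap (J y)) (hJpos y hy0)
    rw [← h1] at h2 h3 hpy
    refine kP_inj hx hy (fun i => ?_) (fun i => ?_)
    · rcases Fin.eq_self_or_eq_succAbove (J x) i with rfl | ⟨i, rfl⟩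
      · exact log_div_eq_le hpx (hterm x hx _) hpy h2
      · exact log_eq_le (congrFun h3 i)
    · rcases Fin.eq_self_or_eq_succAbove (J x) i with rfl | ⟨i, rfl⟩
      · exact log_div_eq_le hpy (hterm y hy _) hpx h2.symm
      · exact log_eq_le (congrFun h3 i).symm
  refine ⟨Set.Finite.of_injOn hmaps hinj T.finite_toSet, ?_⟩
  have := Set.ncard_le_ncard_of_injOn g hmaps hinj T.finite_toSet
  rw [Set.ncard_coe_finset] at this
  simpa [T, Finset.card_product, Fintype.card_piFinset] using this

/-- Morgan's bound: for `n ≥ 2` and `γ = min aⱼ`,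
`|𝒩(a, a₀)| ≤ n·log₂(2n)·(1 + log₂(1 + a₀/γ))^{n-1}`. -/
theorem card_knapVert_le_morgan (n : ℕ) (hn : 2 ≤ n) (a : Fin n → ℕ) (a₀ : ℕ)
    (ha : ∀ j, 0 < a j) (ha₀ : 0 < a₀)
    (γ : ℕ)
    (hγ : γ = Finset.univ.inf' (Finset.univ_nonempty_iff.mpr ⟨⟨0, by omega⟩⟩) a) :
    (knapVert n a a₀).Finite ∧
      ((knapVert n a a₀).ncard : ℝ) ≤
        n * Real.logb 2 (2 * n) * (1 + Real.logb 2 (1 + (a₀ : ℝ) / (γ : ℝ))) ^ (n - 1) := by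
  obtain ⟨m, rfl⟩ : ∃ m, n = m + 1 := ⟨n - 1, by omega⟩
  have hle : ∀ j, γ ≤ a j := fun j => by rw [hγ]; exact Finset.inf'_le _ (Finset.mem_univ j)
  have hpos : 0 < γ := by
    rw [hγ, Finset.lt_inf'_iff]
    exact fun j _ => ha j
  clear hγ
  obtain ⟨hf, hc⟩ := kP_card m (by omega) a a₀ γ hpos hle
  have hfi := hf.image (fun (x : Fin (m + 1) → ℕ) (j : Fin (m + 1)) => (x j : ℝ))
  refine ⟨hfi.subset (knapVert_sub _ _ _), ?_⟩
  have hN := ((Set.ncard_le_ncard (knapVert_sub _ _ _) hfi).trans (Set.ncard_image_le hf)).trans hc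
  have hN' : ((knapVert (m + 1) a a₀).ncard : ℝ) ≤ ((m : ℝ) + 1) *
      (((Nat.log 2 (m + 1) : ℝ) + 1) * ((Nat.log 2 (1 + a₀ / γ) : ℝ) + 1) ^ m) := by
    exact_mod_cast hN
  refine hN'.trans ?_
  have e1 : (Nat.log 2 (m + 1) : ℝ) + 1 ≤ Real.logb 2 (2 * ((m + 1 : ℕ) : ℝ)) := by
    rw [Real.logb_mul (by norm_num) (by positivity), Real.logb_self_eq_one (by norm_num)]
    have := Real.natLog_le_logb (m + 1) 2
    push_cast at this ⊢
    linarith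
  have e2 : (Nat.log 2 (1 + a₀ / γ) : ℝ) + 1 ≤ 1 + Real.logb 2 (1 + (a₀ : ℝ) / (γ : ℝ)) := by
    have h1 := Real.natLog_le_logb (1 + a₀ / γ) 2
    have h2 : Real.logb 2 ((1 + a₀ / γ : ℕ) : ℝ) ≤ Real.logb 2 (1 + (a₀ : ℝ) / (γ : ℝ)) := by
      apply Real.logb_le_logb_of_le (by norm_num) (by positivity)
      have := Nat.cast_div_le (α := ℝ) (m := a₀) (n := γ)
      push_cast
      linarith
    push_cast at h1 h2 ⊢
    linarith
  have e1' : (0 : ℝ) ≤ Real.logb 2 (2 * ((m + 1 : ℕ) : ℝ)) := le_trans (by positivity) e1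
  rw [Nat.add_sub_cancel, mul_assoc]
  have e3 : ((m : ℝ) + 1) = ((m + 1 : ℕ) : ℝ) := by push_cast; rfl
  rw [e3]
  gcongr
end

section
/- Let A ∈ ℤ^{m×n}, b ∈ ℤ^m, and let α = max{|a_{ij}| : i = 1,…,m; j = 1,…,n}. Then |N(A,b)| ≤ mⁿ · (6n⁴ log₂(1 + α))^{n−1}. -/
open Matrix in
/-- Integer solutions with no nonzero symmetric integer direction. -/
def CookV {m n : ℕ} (A : Matrix (Fin m) (Fin n) ℤ) (b : Fin m → ℤ) (x : Fin n → ℤ) : Prop :=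
  (∀ i, (A *ᵥ x) i ≤ b i) ∧
    ∀ z : Fin n → ℤ, (∀ i, |(A *ᵥ z) i| < b i - (A *ᵥ x) i + 1) → z = 0

open Matrix in
/-- `f` picks a basis maximizing `|det| / ∏ t`. -/
def CookMax {m n : ℕ} (A : Matrix (Fin m) (Fin n) ℤ) (t : Fin m → ℤ) (f : Fin n → Fin m) : Prop :=
  (A.submatrix f id).det ≠ 0 ∧
    ∀ i k, |((A.submatrix f id).updateRow k (A i)).det| * t (f k) ≤ |(A.submatrix f id).det| * t i

open Matrix in
lemma cook_exists_basis {m n : ℕ} (A : Matrix (Fin m) (Fin n) ℤ)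
    (h : ∀ z : Fin n → ℤ, A *ᵥ z = 0 → z = 0) :
    ∃ f : Fin n → Fin m, (A.submatrix f id).det ≠ 0 := by
  by_contra! hf
  have h1 : (Aᵀ * A).det = 0 := by
    have e : (Aᵀ * A) = fun j => ∑ i, A i j • A i := by
      ext j k
      simp [Matrix.mul_apply, Finset.sum_apply]
    rw [e]
    change Matrix.detRowAlternating (fun j => ∑ i, A i j • A i) = 0
    have := (Matrix.detRowAlternating (n := Fin n) (R := ℤ)).toMultilinearMap.map_sum
      (fun (j : Fin n) (i : Fin m) => A i j • A i)
    refine this.trans ?_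
    apply Finset.sum_eq_zero
    intro r _
    rw [MultilinearMap.map_smul_univ]
    have := hf r
    have h2 : (Matrix.detRowAlternating (n := Fin n) (R := ℤ)).toMultilinearMap
      (fun i => A (r i)) = 0 := this
    rw [h2, smul_zero]
  obtain ⟨z, hz, hz0⟩ := Matrix.exists_mulVec_eq_zero_iff.2 h1
  apply hz
  apply h
  have h3 : (A *ᵥ z) ⬝ᵥ (A *ᵥ z) = 0 := by
    have : z ⬝ᵥ ((Aᵀ * A) *ᵥ z) = 0 := by rw [hz0]; simp
    rw [← Matrix.mulVec_mulVec, Matrix.dotProduct_mulVec, Matrix.vecMul_transpose] at this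
    exact this
  exact dotProduct_self_eq_zero.1 h3

open Matrix in
lemma cook_exists_max {m n : ℕ} (A : Matrix (Fin m) (Fin n) ℤ)
    (h : ∀ z : Fin n → ℤ, A *ᵥ z = 0 → z = 0) (t : Fin m → ℤ) (ht : ∀ i, 0 < t i) :
    ∃ f, CookMax A t f := by
  obtain ⟨f₀, hf₀⟩ := cook_exists_basis A h
  have : Nonempty (Fin n → Fin m) := ⟨f₀⟩
  obtain ⟨f, hf⟩ := Finite.exists_max
    (fun f : Fin n → Fin m => (|(A.submatrix f id).det| : ℝ) / ∏ k, (t (f k) : ℝ))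
  have htr : ∀ i, (0 : ℝ) < t i := fun i => by exact_mod_cast ht i
  have hpos : ∀ f : Fin n → Fin m, 0 < ∏ k, (t (f k) : ℝ) :=
    fun f => Finset.prod_pos fun k _ => htr _
  refine ⟨f, ?_, ?_⟩
  · intro h0
    have := hf f₀
    rw [h0] at this
    simp only [Int.cast_zero, abs_zero, zero_div] at this
    have h2 : (0 : ℝ) < |((A.submatrix f₀ id).det : ℝ)| := by
      rw [abs_pos]; exact_mod_cast hf₀
    exact absurd this (not_le.2 (div_pos h2 (hpos f₀)))
  · intro i k
    have := hf (Function.update f k i)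
    have e : A.submatrix (Function.update f k i) id = (A.submatrix f id).updateRow k (A i) := by
      ext a c
      by_cases hak : a = k
      · subst hak; simp
      · simp [hak]
    rw [e, div_le_div_iff₀ (hpos _) (hpos _)] at this
    rw [← Finset.mul_prod_erase Finset.univ (fun k => (t (f k) : ℝ)) (Finset.mem_univ k),
      ← Finset.mul_prod_erase Finset.univ (fun j => (t (Function.update f k i j) : ℝ))
        (Finset.mem_univ k)] at this
    have e2 : ∏ j ∈ Finset.univ.erase k, (t (Function.update f k i j) : ℝ)
        = ∏ j ∈ Finset.univ.erase k, (t (f j) : ℝ) := by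
      apply Finset.prod_congr rfl
      intro j hj
      rw [Function.update_of_ne (Finset.ne_of_mem_erase hj)]
    rw [e2, Function.update_self, ← mul_assoc, ← mul_assoc] at this
    have := le_of_mul_le_mul_right this (Finset.prod_pos fun k _ => htr _)
    exact_mod_cast this

open Matrix in
lemma cook_key {m n : ℕ} (A : Matrix (Fin m) (Fin n) ℤ) (t : Fin m → ℤ) (ht : ∀ i, 0 < t i)
    (f : Fin n → Fin m) (hf : CookMax A t f) (z : Fin n → ℤ) (w : Fin n → ℝ)
    (hw : ∀ k, (|(A *ᵥ z) (f k)| : ℝ) ≤ w k * t (f k)) (hs : ∑ k, w k < 1) (i : Fin m) :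
    |(A *ᵥ z) i| < t i := by
  obtain ⟨h0, hm⟩ := hf
  set B := A.submatrix f id with hB
  have hc : B.det * (A *ᵥ z) i = ∑ k, (B.updateRow k (A i)).det * (A *ᵥ z) (f k) := by
    have h1 := Matrix.mulVec_cramer Bᵀ (A i)
    have h2 := congrArg (fun v => v ⬝ᵥ z) h1
    simp only [Matrix.det_transpose, smul_dotProduct, smul_eq_mul] at h2
    have h3 : (A *ᵥ z) i = A i ⬝ᵥ z := rfl
    rw [h3, ← h2, Matrix.mulVec_transpose, ← Matrix.dotProduct_mulVec]
    simp only [dotProduct, Matrix.cramer_transpose_apply]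
    rfl
  have hdet : (0 : ℝ) < |(B.det : ℝ)| := by rw [abs_pos]; exact_mod_cast h0
  have hti : (0 : ℝ) < t i := by exact_mod_cast ht i
  have hcr : (B.det : ℝ) * ((A *ᵥ z) i : ℝ)
      = ∑ k, ((B.updateRow k (A i)).det : ℝ) * ((A *ᵥ z) (f k) : ℝ) := by exact_mod_cast hc
  have h4 : |(B.det : ℝ)| * |((A *ᵥ z) i : ℝ)| < |(B.det : ℝ)| * t i := by
    rw [← abs_mul, hcr]
    calc |∑ k, ((B.updateRow k (A i)).det : ℝ) * ((A *ᵥ z) (f k) : ℝ)|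
        ≤ ∑ k, |((B.updateRow k (A i)).det : ℝ) * ((A *ᵥ z) (f k) : ℝ)| :=
          Finset.abs_sum_le_sum_abs _ _
      _ ≤ ∑ k, w k * (|(B.det : ℝ)| * t i) := by
          apply Finset.sum_le_sum
          intro k _
          have htk : (0 : ℝ) < t (f k) := by exact_mod_cast ht (f k)
          have hwk : 0 ≤ w k := by
            by_contra! hneg
            have := (abs_nonneg _).trans (hw k)
            nlinarith
          have hmk : |((B.updateRow k (A i)).det : ℝ)| * t (f k) ≤ |(B.det : ℝ)| * t i := by
            exact_mod_cast hm i k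
          rw [abs_mul]
          calc _ ≤ |((B.updateRow k (A i)).det : ℝ)| * (w k * t (f k)) := by
                gcongr; exact hw k
            _ = w k * (|((B.updateRow k (A i)).det : ℝ)| * t (f k)) := by ring
            _ ≤ _ := by gcongr
      _ = (∑ k, w k) * (|(B.det : ℝ)| * t i) := by rw [Finset.sum_mul]
      _ < 1 * (|(B.det : ℝ)| * t i) := by
          apply mul_lt_mul_of_pos_right hs (by positivity)
      _ = _ := one_mul _
  have := lt_of_mul_lt_mul_left h4 hdet.le
  exact_mod_cast this

open Matrix in
lemma cook_bound {m n : ℕ} (A : Matrix (Fin m) (Fin n) ℤ) (t : Fin m → ℤ) (ht : ∀ i, 0 < t i)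
    (f : Fin n → Fin m) (hf : CookMax A t f)
    (hV : ∀ z : Fin n → ℤ, (∀ i, |(A *ᵥ z) i| < t i) → z = 0) (k : Fin n) :
    t (f k) ≤ |(A.submatrix f id).det| := by
  by_contra! hlt
  have h0 := hf.1
  set B := A.submatrix f id with hB
  set z : Fin n → ℤ := B.adjugate *ᵥ (Pi.single k 1) with hz
  have hBz : B *ᵥ z = B.det • Pi.single k 1 := by
    rw [hz, Matrix.mulVec_mulVec, Matrix.mul_adjugate, Matrix.smul_mulVec, Matrix.one_mulVec]
  have hz0 : z = 0 := by
    apply hV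
    have htk : (0 : ℝ) < t (f k) := by exact_mod_cast ht (f k)
    apply cook_key A t ht f hf z (Pi.single k (|(B.det : ℝ)| / t (f k)))
    · intro j
      have : (A *ᵥ z) (f j) = (B *ᵥ z) j := rfl
      rw [this, hBz]
      by_cases hj : j = k
      · subst hj
        simp [htk.ne']
      · simp [hj]
    · rw [Finset.sum_pi_single']
      simp only [Finset.mem_univ, if_true]
      rw [div_lt_one htk]
      exact_mod_cast hlt
  rw [hz0, Matrix.mulVec_zero] at hBz
  have := congrFun hBz k
  simp at this
  exact h0 this.symm

/-- The class of a positive slack. -/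
def cookCls (N : ℕ) (t : ℤ) : ℕ := Nat.log 2 (t.toNat ^ N)

lemma cook_cls_lt (N : ℕ) (hN : 0 < N) (t s : ℤ) (ht : 0 < t) (hs : 0 < s)
    (h : cookCls N t = cookCls N s) : (t - s) * N ≤ s := by
  unfold cookCls at h
  lift t to ℕ using ht.le
  lift s to ℕ using hs.le
  simp only [Int.toNat_natCast] at h
  have ht' : 0 < t := by exact_mod_cast ht
  have hs' : 0 < s := by exact_mod_cast hs
  have h1 : t ^ N < 2 ^ (Nat.log 2 (t ^ N) + 1) := Nat.lt_pow_succ_log_self (by norm_num) _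
  have h2 : 2 ^ (Nat.log 2 (s ^ N)) ≤ s ^ N := Nat.pow_log_le_self 2 (pow_pos hs' N).ne'
  rw [h, pow_succ] at h1
  have h3 : t ^ N < 2 * s ^ N := by omega
  have hNr : (0 : ℝ) < N := by exact_mod_cast hN
  have hb : (2 : ℝ) ≤ (1 + 1 / N) ^ N := by
    have := one_add_mul_le_pow (a := (1 / N : ℝ))
      (by have : (0:ℝ) ≤ 1 / N := by positivity
          linarith) N
    have e : (N : ℝ) * (1 / N) = 1 := by field_simp
    rw [e] at this
    linarith
  have h4 : (t : ℝ) ^ N < ((1 + 1 / N) * s) ^ N := by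
    rw [mul_pow]
    calc (t : ℝ) ^ N < 2 * s ^ N := by exact_mod_cast h3
      _ ≤ _ := by gcongr
  have h5 := lt_of_pow_lt_pow_left₀ N (by positivity) h4
  have h6 : ((t : ℝ) - s) * N ≤ s := by
    have : (1 + 1 / (N : ℝ)) * s * N = s * N + s := by field_simp
    nlinarith
  exact_mod_cast h6

lemma cook_cls3 (N : ℕ) (hN : 0 < N) (t s u : ℤ) (ht : 0 < t) (hs : 0 < s) (hu : 0 < u)
    (h : cookCls N t = cookCls N u) (h' : cookCls N s = cookCls N u) : |t - s| * N ≤ u := by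
  have hNr : (0 : ℤ) < N := by exact_mod_cast hN
  have a1 := cook_cls_lt N hN t s ht hs (h.trans h'.symm)
  have a2 := cook_cls_lt N hN s t hs ht (h'.trans h.symm)
  have a3 := cook_cls_lt N hN t u ht hu h
  have a4 := cook_cls_lt N hN s u hs hu h'
  rcases abs_cases (t - s) with ⟨e, _⟩ | ⟨e, _⟩ <;> rw [e]
  · rcases le_total s u with g | g <;> nlinarith
  · rcases le_total t u with g | g <;> nlinarith

open Matrix in
/-- Shifted slack. -/
def cookT {m n : ℕ} (A : Matrix (Fin m) (Fin n) ℤ) (b : Fin m → ℤ) (x : Fin n → ℤ)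
    (i : Fin m) : ℤ := b i - (A *ᵥ x) i + 1

open Matrix in
lemma cookT_pos {m n : ℕ} {A : Matrix (Fin m) (Fin n) ℤ} {b : Fin m → ℤ} {x : Fin n → ℤ}
    (hx : CookV A b x) (i : Fin m) : 0 < cookT A b x i := by
  have := hx.1 i
  unfold cookT
  omega

open Matrix in
lemma cookT_sub {m n : ℕ} (A : Matrix (Fin m) (Fin n) ℤ) (b : Fin m → ℤ) (x y : Fin n → ℤ)
    (i : Fin m) : (A *ᵥ (x - y)) i = cookT A b y i - cookT A b x i := by
  rw [Matrix.mulVec_sub, Pi.sub_apply]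
  unfold cookT
  ring

open Matrix in
lemma CookV.exists_max {m n : ℕ} {A : Matrix (Fin m) (Fin n) ℤ} {b : Fin m → ℤ} {x : Fin n → ℤ}
    (hx : CookV A b x) : ∃ f, CookMax A (cookT A b x) f := by
  apply cook_exists_max A _ _ (cookT_pos hx)
  intro z hz
  apply hx.2
  intro i
  rw [hz]
  simpa [cookT] using cookT_pos hx i

lemma cook_fiber_one {m : ℕ} {A : Matrix (Fin m) (Fin 1) ℤ} {b : Fin m → ℤ} {x y : Fin 1 → ℤ}
    (hx : CookV A b x) (hy : CookV A b y) (f : Fin 1 → Fin m)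
    (fy : CookMax A (cookT A b y) f) (hle : cookT A b x (f 0) ≤ cookT A b y (f 0)) : y = x := by
  have hyp := cookT_pos hy
  have hxp := cookT_pos hx (f 0)
  rw [← sub_eq_zero]
  apply hy.2
  have hp : (0 : ℝ) < cookT A b y (f 0) := by exact_mod_cast hyp (f 0)
  apply cook_key A _ hyp f fy _
    (fun _ => ((cookT A b y (f 0) - cookT A b x (f 0) : ℤ) : ℝ) / cookT A b y (f 0))
  · intro k
    have hk : k = 0 := Subsingleton.elim _ _
    subst hk
    rw [div_mul_cancel₀ _ hp.ne', cookT_sub A b]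
    have : |cookT A b x (f 0) - cookT A b y (f 0)| ≤ cookT A b y (f 0) - cookT A b x (f 0) := by
      rw [abs_of_nonpos] <;> omega
    exact_mod_cast this
  · simp only [Finset.univ_unique, Finset.sum_const, Finset.card_singleton, one_smul]
    rw [div_lt_one hp]
    exact_mod_cast (by omega : cookT A b y (f 0) - cookT A b x (f 0) < cookT A b y (f 0))

lemma cook_two {m n : ℕ} {A : Matrix (Fin m) (Fin (n + 1)) ℤ} {b : Fin m → ℤ}
    {x y w : Fin (n + 1) → ℤ}
    (hx : CookV A b x) (hy : CookV A b y) (hw : CookV A b w) (f : Fin (n + 1) → Fin m)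
    (fw : CookMax A (cookT A b w) f)
    (cx : ∀ k : Fin n, cookCls (2 * (n + 1)) (cookT A b x (f k.succ)) =
      cookCls (2 * (n + 1)) (cookT A b w (f k.succ)))
    (cy : ∀ k : Fin n, cookCls (2 * (n + 1)) (cookT A b y (f k.succ)) =
      cookCls (2 * (n + 1)) (cookT A b w (f k.succ)))
    (h0 : 2 * |cookT A b x (f 0) - cookT A b y (f 0)| ≤ cookT A b w (f 0)) : y = x := by
  have hwp := cookT_pos hw
  rw [← sub_eq_zero]
  apply hw.2
  apply cook_key A _ hwp f fw _ (Fin.cons (1 / 2 : ℝ) (fun _ => 1 / (2 * (n + 1))))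
  · intro k
    rw [cookT_sub A b]
    refine Fin.cases ?_ (fun j => ?_) k
    · simp only [Fin.cons_zero]
      have : (2 : ℝ) * |((cookT A b x (f 0) - cookT A b y (f 0) : ℤ) : ℝ)| ≤ cookT A b w (f 0) := by
        exact_mod_cast h0
      linarith
    · simp only [Fin.cons_succ]
      have := cook_cls3 (2 * (n + 1)) (by omega) _ _ _ (cookT_pos hx _) (cookT_pos hy _)
        (hwp _) (cx j) (cy j)
      have h2 : |((cookT A b x (f j.succ) - cookT A b y (f j.succ) : ℤ) : ℝ)| * (2 * (n + 1))
          ≤ cookT A b w (f j.succ) := by exact_mod_cast this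
      have hp : (0 : ℝ) < 2 * (n + 1) := by positivity
      rw [div_mul_eq_mul_div, one_mul, le_div_iff₀ hp]
      exact h2
  · rw [Fin.sum_univ_succ]
    simp only [Fin.cons_zero, Fin.cons_succ, Finset.sum_const, Finset.card_univ, Fintype.card_fin,
      nsmul_eq_mul]
    have hp : (0 : ℝ) < 2 * (n + 1) := by positivity
    have : (n : ℝ) * (1 / (2 * (n + 1))) < 1 / 2 := by
      rw [mul_one_div, div_lt_div_iff₀ hp (by norm_num)]
      linarith
    linarith

lemma cook_three {m n : ℕ} {A : Matrix (Fin m) (Fin (n + 1)) ℤ} {b : Fin m → ℤ}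
    {x y w : Fin (n + 1) → ℤ}
    (hx : CookV A b x) (hy : CookV A b y) (hw : CookV A b w) (f : Fin (n + 1) → Fin m)
    (fw : CookMax A (cookT A b w) f)
    (cx : ∀ k : Fin n, cookCls (2 * (n + 1)) (cookT A b x (f k.succ)) =
      cookCls (2 * (n + 1)) (cookT A b w (f k.succ)))
    (cy : ∀ k : Fin n, cookCls (2 * (n + 1)) (cookT A b y (f k.succ)) =
      cookCls (2 * (n + 1)) (cookT A b w (f k.succ)))
    (h1 : cookT A b x (f 0) ≤ cookT A b y (f 0)) (h2 : cookT A b y (f 0) ≤ cookT A b w (f 0)) :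
    y = x ∨ w = y := by
  have hxp := cookT_pos hx (f 0)
  rcases le_total (cookT A b w (f 0)) (2 * cookT A b y (f 0)) with h | h
  · right
    apply cook_two hy hw hw f fw cy (fun _ => rfl)
    rw [abs_of_nonpos] <;> omega
  · left
    apply cook_two hx hy hw f fw cx cy
    rw [abs_of_nonpos] <;> omega

/-- chosen basis -/
noncomputable def cookF {m n : ℕ} (A : Matrix (Fin m) (Fin n) ℤ) (b : Fin m → ℤ)
    (x : {x : Fin n → ℤ // CookV A b x}) : Fin n → Fin m := x.2.exists_max.choose

lemma cookF_spec {m n : ℕ} (A : Matrix (Fin m) (Fin n) ℤ) (b : Fin m → ℤ)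
    (x : {x : Fin n → ℤ // CookV A b x}) : CookMax A (cookT A b x.1) (cookF A b x) :=
  x.2.exists_max.choose_spec

/-- the key of a point -/
noncomputable def cookKey {m n : ℕ} (A : Matrix (Fin m) (Fin (n + 1)) ℤ) (b : Fin m → ℤ)
    (x : {x : Fin (n + 1) → ℤ // CookV A b x}) : (Fin (n + 1) → Fin m) × (Fin n → ℕ) :=
  (cookF A b x, fun k => cookCls (2 * (n + 1)) (cookT A b x.1 (cookF A b x k.succ)))

lemma cook_fib_le {m n : ℕ} (A : Matrix (Fin m) (Fin (n + 1)) ℤ) (b : Fin m → ℤ)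
    (F : Finset {x : Fin (n + 1) → ℤ // CookV A b x}) (c : (Fin (n + 1) → Fin m) × (Fin n → ℕ))
    (hF : ∀ x ∈ F, cookKey A b x = c) : F.card ≤ 2 := by
  by_contra! hlt
  obtain ⟨x, y, z, hx, hy, hz, hxy, hxz, hyz⟩ := Finset.two_lt_card_iff.1 hlt
  have main : ∀ x ∈ F, ∀ y ∈ F, ∀ w ∈ F, x ≠ y → y ≠ w →
      cookT A b x.1 (c.1 0) ≤ cookT A b y.1 (c.1 0) →
      cookT A b y.1 (c.1 0) ≤ cookT A b w.1 (c.1 0) → False := by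
    intro x hx y hy w hw hxy hyw h1 h2
    have ex := hF x hx
    have ey := hF y hy
    have ew := hF w hw
    have fx : cookF A b x = c.1 := congrArg Prod.fst ex
    have fy : cookF A b y = c.1 := congrArg Prod.fst ey
    have fw : cookF A b w = c.1 := congrArg Prod.fst ew
    have gx : ∀ k : Fin n, cookCls (2 * (n + 1)) (cookT A b x.1 (c.1 k.succ)) = c.2 k := by
      intro k; rw [← fx]; exact congrFun (congrArg Prod.snd ex) k
    have gy : ∀ k : Fin n, cookCls (2 * (n + 1)) (cookT A b y.1 (c.1 k.succ)) = c.2 k := by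
      intro k; rw [← fy]; exact congrFun (congrArg Prod.snd ey) k
    have gw : ∀ k : Fin n, cookCls (2 * (n + 1)) (cookT A b w.1 (c.1 k.succ)) = c.2 k := by
      intro k; rw [← fw]; exact congrFun (congrArg Prod.snd ew) k
    rcases cook_three x.2 y.2 w.2 c.1 (fw ▸ cookF_spec A b w)
      (fun k => (gx k).trans (gw k).symm) (fun k => (gy k).trans (gw k).symm) h1 h2 with h | h
    · exact hxy (Subtype.ext h.symm)
    · exact hyw (Subtype.ext h.symm)
  rcases le_total (cookT A b x.1 (c.1 0)) (cookT A b y.1 (c.1 0)) with a | a <;>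
  rcases le_total (cookT A b y.1 (c.1 0)) (cookT A b z.1 (c.1 0)) with d | d <;>
  rcases le_total (cookT A b x.1 (c.1 0)) (cookT A b z.1 (c.1 0)) with e | e
  · exact main x hx y hy z hz hxy hyz a d
  · exact main x hx y hy z hz hxy hyz a d
  · exact main x hx z hz y hy hxz hyz.symm e d
  · exact main z hz x hx y hy hxz.symm hxy e a
  · exact main y hy x hx z hz hxy.symm hxz a e
  · exact main y hy z hz x hx hyz hxz.symm d e
  · exact main z hz y hy x hx hyz.symm hxy.symm d a
  · exact main z hz y hy x hx hyz.symm hxy.symm d a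

lemma cook_fib_le_one {m : ℕ} (A : Matrix (Fin m) (Fin 1) ℤ) (b : Fin m → ℤ)
    (F : Finset {x : Fin 1 → ℤ // CookV A b x}) (c : Fin 1 → Fin m)
    (hF : ∀ x ∈ F, cookF A b x = c) : F.card ≤ 1 := by
  rw [Finset.card_le_one]
  intro x hx y hy
  have fx := cookF_spec A b x
  have fy := cookF_spec A b y
  rw [hF x hx] at fx
  rw [hF y hy] at fy
  rcases le_total (cookT A b x.1 (c 0)) (cookT A b y.1 (c 0)) with h | h
  · exact (Subtype.ext (cook_fiber_one x.2 y.2 c fy h)).symm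
  · exact (Subtype.ext (cook_fiber_one y.2 x.2 c fx h))

lemma cook_cls_bound {m n : ℕ} (A : Matrix (Fin m) (Fin (n + 1)) ℤ) (b : Fin m → ℤ) (α : ℕ)
    (hA : ∀ i j, |A i j| ≤ α)
    (x : {x : Fin (n + 1) → ℤ // CookV A b x}) (k : Fin (n + 1)) :
    cookCls (2 * (n + 1)) (cookT A b x.1 (cookF A b x k)) ≤
      Nat.log 2 (((n + 1) * α) ^ (2 * (n + 1) ^ 2)) := by
  unfold cookCls
  apply Nat.log_mono_right
  have h1 := cook_bound A _ (cookT_pos x.2) _ (cookF_spec A b x) x.2.2 k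
  have h2 := Matrix.det_le (A := A.submatrix (cookF A b x) id) (abv := AbsoluteValue.abs)
    (x := (α : ℤ)) (fun i j => hA _ _)
  have h3 : cookT A b x.1 (cookF A b x k) ≤ (((n + 1) * α) ^ (n + 1) : ℕ) := by
    refine h1.trans (h2.trans ?_)
    rw [Fintype.card_fin, nsmul_eq_mul]
    have : (n + 1).factorial * α ^ (n + 1) ≤ ((n + 1) * α) ^ (n + 1) := by
      rw [mul_pow]
      gcongr
      exact Nat.factorial_le_pow _
    exact_mod_cast this
  calc _ ≤ (((n + 1) * α) ^ (n + 1)) ^ (2 * (n + 1)) := by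
        gcongr
        exact Int.toNat_le.2 h3
    _ = _ := by rw [← pow_mul]; congr 1; ring

lemma cook_card {m n : ℕ} (A : Matrix (Fin m) (Fin (n + 1)) ℤ) (b : Fin m → ℤ) (α : ℕ)
    (hA : ∀ i j, |A i j| ≤ α) (F : Finset {x : Fin (n + 1) → ℤ // CookV A b x}) :
    F.card ≤ 2 * (m ^ (n + 1) * (Nat.log 2 (((n + 1) * α) ^ (2 * (n + 1) ^ 2)) + 1) ^ n) := by
  classical
  set C := Nat.log 2 (((n + 1) * α) ^ (2 * (n + 1) ^ 2)) with hC
  have := Finset.card_le_mul_card_image_of_maps_to (s := F)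
    (t := (Finset.univ : Finset (Fin (n + 1) → Fin m)) ×ˢ
      Fintype.piFinset (fun _ : Fin n => Finset.range (C + 1))) (f := cookKey A b)
    (by
      intro x _
      simp only [Finset.mem_product, Finset.mem_univ, true_and, Fintype.mem_piFinset,
        Finset.mem_range]
      intro k
      exact Nat.lt_succ_of_le (cook_cls_bound A b α hA x k.succ)) 2
    (by
      intro c _
      apply cook_fib_le A b _ c
      intro x hx
      exact (Finset.mem_filter.1 hx).2)
  simpa using this

lemma cook_card_one {m : ℕ} (A : Matrix (Fin m) (Fin 1) ℤ) (b : Fin m → ℤ) 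
    (F : Finset {x : Fin 1 → ℤ // CookV A b x}) : F.card ≤ m := by
  classical
  have := Finset.card_le_mul_card_image_of_maps_to (s := F)
    (t := (Finset.univ : Finset (Fin 1 → Fin m))) (f := cookF A b)
    (fun _ _ => Finset.mem_univ _) 1
    (by
      intro c _
      apply cook_fib_le_one A b _ c
      intro x hx
      exact (Finset.mem_filter.1 hx).2)
  simpa using this

lemma cook_num (n α : ℕ) (hn : 1 ≤ n) (hα : 1 ≤ α) :
    2 * ((Nat.log 2 (((n + 1) * α) ^ (2 * (n + 1) ^ 2)) + 1 : ℕ) : ℝ) ^ n ≤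
      (6 * ((n + 1 : ℕ) : ℝ) ^ 4 * Real.logb 2 (1 + (α : ℝ))) ^ n := by
  set L := Real.logb 2 (1 + (α : ℝ)) with hL
  have hαr : (1 : ℝ) ≤ α := by exact_mod_cast hα
  have hL1 : 1 ≤ L := by
    rw [hL, Real.le_logb_iff_rpow_le (by norm_num) (by linarith)]
    norm_num; linarith
  set N : ℝ := ((n + 1 : ℕ) : ℝ) with hN
  have hN2 : 2 ≤ N := by rw [hN]; exact_mod_cast (by omega : 2 ≤ n + 1)
  have hlog : (Nat.log 2 (((n + 1) * α) ^ (2 * (n + 1) ^ 2)) : ℝ) ≤ 2 * N ^ 2 * (N + L) := by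
    have h0 : 0 < ((n + 1) * α) ^ (2 * (n + 1) ^ 2) := by positivity
    refine (Real.natLog_le_logb _ _).trans ?_
    have e : (((((n + 1) * α) ^ (2 * (n + 1) ^ 2) : ℕ)) : ℝ) = (N * α) ^ (2 * (n + 1) ^ 2) := by
      rw [hN]; push_cast; ring
    rw [e]
    push_cast
    rw [Real.logb_pow, Real.logb_mul (by linarith) (by linarith)]
    have e2 : ((2 * (n + 1) ^ 2 : ℕ) : ℝ) = 2 * N ^ 2 := by rw [hN]; push_cast; ring
    rw [e2]
    have h1 : Real.logb 2 N ≤ N := by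
      rw [Real.logb_le_iff_le_rpow (by norm_num) (by linarith), hN, Real.rpow_natCast]
      exact_mod_cast Nat.lt_two_pow_self.le
    have h2 : Real.logb 2 α ≤ L := Real.logb_le_logb_of_le (by norm_num) (by linarith) (by linarith)
    gcongr
  have hfin : 2 * ((Nat.log 2 (((n + 1) * α) ^ (2 * (n + 1) ^ 2)) + 1 : ℕ) : ℝ) ≤ 6 * N ^ 4 * L := by
    push_cast
    have a1 : N ^ 2 * 4 ≤ N ^ 4 := by nlinarith [sq_nonneg N, mul_le_mul hN2 hN2 (by norm_num) (by linarith), mul_nonneg (sq_nonneg N) (by nlinarith : (0:ℝ) ≤ N * N - 4)]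
    have a2 : 2 * N ^ 3 ≤ N ^ 4 := by nlinarith [pow_pos (by linarith : 0 < N) 3]
    have a3 : N ^ 4 * 1 ≤ N ^ 4 * L := by gcongr
    have a4 : N ^ 2 * L * 4 ≤ N ^ 4 * L := by nlinarith
    have a5 : 16 ≤ N ^ 4 := by nlinarith
    nlinarith
  calc _ ≤ 2 ^ n * ((Nat.log 2 (((n + 1) * α) ^ (2 * (n + 1) ^ 2)) + 1 : ℕ) : ℝ) ^ n := by
        gcongr
        exact le_self_pow₀ (by norm_num) (by omega)
    _ = (2 * ((Nat.log 2 (((n + 1) * α) ^ (2 * (n + 1) ^ 2)) + 1 : ℕ) : ℝ)) ^ n := (mul_pow _ _ _).symm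
    _ ≤ _ := by gcongr

lemma cook_card_real {m n : ℕ} (A : Matrix (Fin m) (Fin (n + 1)) ℤ) (b : Fin m → ℤ) (α : ℕ)
    (hA : ∀ i j, |A i j| ≤ α) (F : Finset {x : Fin (n + 1) → ℤ // CookV A b x}) :
    (F.card : ℝ) ≤ (m : ℝ) ^ (n + 1) *
      (6 * ((n + 1 : ℕ) : ℝ) ^ 4 * Real.logb 2 (1 + (α : ℝ))) ^ n := by
  have hL : 0 ≤ Real.logb 2 (1 + (α : ℝ)) := by
    apply Real.logb_nonneg (by norm_num)
    have : (0 : ℝ) ≤ α := by positivity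
    linarith
  rcases F.eq_empty_or_nonempty with rfl | ⟨x, -⟩
  · simp only [Finset.card_empty, Nat.cast_zero]
    positivity
  rcases Nat.eq_zero_or_pos n with rfl | hn
  · simpa using cook_card_one A b F
  have hα : 1 ≤ α := by
    by_contra! h0
    have h0 : α = 0 := by omega
    subst h0
    apply (cookF_spec A b x).1
    apply Matrix.det_eq_zero_of_row_eq_zero 0
    intro j
    simpa using hA (cookF A b x 0) j
  have h1 := cook_card A b α hA F
  have h2 := cook_num n α hn hα
  calc (F.card : ℝ) ≤ ((2 * (m ^ (n + 1) *
        (Nat.log 2 (((n + 1) * α) ^ (2 * (n + 1) ^ 2)) + 1) ^ n) : ℕ) : ℝ) := by exact_mod_cast h1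
    _ = (m : ℝ) ^ (n + 1) *
        (2 * ((Nat.log 2 (((n + 1) * α) ^ (2 * (n + 1) ^ 2)) + 1 : ℕ) : ℝ) ^ n) := by
        push_cast; ring
    _ ≤ _ := by gcongr

lemma vertN_cookV {m n : ℕ} (A : Matrix (Fin m) (Fin n) ℤ) (b : Fin m → ℤ) (x : Fin n → ℝ)
    (hx : x ∈ vertN m n A b) : ∃ z : Fin n → ℤ, CookV A b z ∧ x = fun j => (z j : ℝ) := by
  have hmem : x ∈ intPoints m n A b := extremePoints_convexHull_subset hx
  obtain ⟨hint, hle⟩ := hmem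
  choose z hz using hint
  have hxz : x = fun j => (z j : ℝ) := funext hz
  have hcast : ∀ (v : Fin n → ℤ) i, ∑ j, (A i j : ℝ) * ((v j : ℤ) : ℝ) = ((A.mulVec v i : ℤ) : ℝ) := by
    intro v i
    simp [Matrix.mulVec, dotProduct]
  have hin : ∀ v : Fin n → ℤ, (∀ i, A.mulVec v i ≤ b i) →
      (fun j => (v j : ℝ)) ∈ convexHull ℝ (intPoints m n A b) := by
    intro v hv
    apply subset_convexHull
    refine ⟨fun j => ⟨v j, rfl⟩, fun i => ?_⟩
    rw [hcast]
    exact_mod_cast hv i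
  refine ⟨z, ⟨?_, ?_⟩, hxz⟩
  · intro i
    have := hle i
    rw [hxz, hcast] at this
    exact_mod_cast this
  · intro w hw
    have hp := hin (z + w) (by
      intro i
      have := abs_lt.1 (hw i)
      rw [Matrix.mulVec_add, Pi.add_apply]
      omega)
    have hm := hin (z - w) (by
      intro i
      have := abs_lt.1 (hw i)
      rw [Matrix.mulVec_sub, Pi.sub_apply]
      omega)
    have hseg : x ∈ openSegment ℝ (fun j => (((z + w) j : ℤ) : ℝ)) (fun j => (((z - w) j : ℤ) : ℝ)) := by
      refine ⟨1 / 2, 1 / 2, by norm_num, by norm_num, by norm_num, ?_⟩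
      rw [hxz]
      ext j
      simp
      ring
    have := (mem_extremePoints.1 hx).2 _ hp _ hm hseg
    have h1 := this.1
    ext j
    have h2 := congrFun h1 j
    rw [hxz] at h2
    simp at h2
    simpa using h2

/-- Cook et al.'s bound: if `α = max |a_{ij}|`, then
`|N(A,b)| ≤ mⁿ·(6n⁴·log₂(1+α))^{n-1}`. -/
theorem card_vertN_le_cook (m n : ℕ) (A : Matrix (Fin m) (Fin n) ℤ) (b : Fin m → ℤ)
    (α : ℕ) (hα : α = Finset.univ.sup fun p : Fin m × Fin n => (A p.1 p.2).natAbs) :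
    (vertN m n A b).Finite ∧
      ((vertN m n A b).ncard : ℝ) ≤
        (m : ℝ) ^ n * (6 * (n : ℝ) ^ 4 * Real.logb 2 (1 + (α : ℝ))) ^ (n - 1) := by
  classical
  rcases n with _ | n
  · refine ⟨Set.toFinite _, ?_⟩
    have : (vertN m 0 A b).ncard ≤ 1 := Set.ncard_le_one_of_subsingleton _
    simpa using this
  have hA : ∀ i j, |A i j| ≤ α := by
    intro i j
    have h1 : (A i j).natAbs ≤ α := by
      rw [hα]
      exact Finset.le_sup (f := fun p : Fin m × Fin (n + 1) => (A p.1 p.2).natAbs)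
        (Finset.mem_univ (i, j))
    rw [Int.abs_eq_natAbs]
    exact_mod_cast h1
  have hF := cook_card_real A b α hA
  have hfin : Finite {x : Fin (n + 1) → ℤ // CookV A b x} := by
    by_contra hinf
    rw [not_finite_iff_infinite] at hinf
    obtain ⟨k, hk⟩ := exists_nat_gt ((m : ℝ) ^ (n + 1) *
      (6 * ((n + 1 : ℕ) : ℝ) ^ 4 * Real.logb 2 (1 + (α : ℝ))) ^ n)
    obtain ⟨s, hs⟩ := Infinite.exists_subset_card_eq {x : Fin (n + 1) → ℤ // CookV A b x} k
    have := hF s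
    rw [hs] at this
    linarith
  have := Fintype.ofFinite {x : Fin (n + 1) → ℤ // CookV A b x}
  have hsub : vertN m (n + 1) A b ⊆
      Set.range (fun (x : {x : Fin (n + 1) → ℤ // CookV A b x}) j => ((x.1 j : ℤ) : ℝ)) := by
    intro x hx
    obtain ⟨z, hz, e⟩ := vertN_cookV A b x hx
    exact ⟨⟨z, hz⟩, e.symm⟩
  refine ⟨(Set.finite_range _).subset hsub, ?_⟩
  have h1 : (vertN m (n + 1) A b).ncard ≤
      (Finset.univ : Finset {x : Fin (n + 1) → ℤ // CookV A b x}).card := by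
    refine (Set.ncard_le_ncard hsub (Set.finite_range _)).trans ?_
    rw [← Set.image_univ]
    refine (Set.ncard_image_le (Set.toFinite _)).trans ?_
    rw [Set.ncard_univ, Nat.card_eq_fintype_card, Finset.card_univ]
  have h2 := hF Finset.univ
  rw [Nat.add_sub_cancel]
  exact le_trans (by exact_mod_cast h1) h2
end

section
/- Let A ∈ ℤ^{m×n}, b ∈ ℤ^m, and let α = max{|a_{ij}| : i = 1,…,m; j = 1,…,n}. Then |N(A,b)| ≤ n^{7n} · ξₙ(m) · (6 log₂(1 + α) + 3 log₂ n)^{n−1}. -/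
/-- `ξₙ(m) = C(m − ⌊(n−1)/2⌋ − 1, ⌊n/2⌋) + C(m − ⌊n/2⌋ − 1, ⌊(n−1)/2⌋)`. -/
def xi (n m : ℕ) : ℕ :=
  Nat.choose (m - (n - 1) / 2 - 1) (n / 2) + Nat.choose (m - n / 2 - 1) ((n - 1) / 2)

def IsG {m : ℕ} (ρ s : Fin m → ℝ) (g : ℝ) : Prop :=
  0 ≤ g ∧ (∀ k, - ρ k ≤ g * s k) ∧ (g = 0 ∨ ∃ k, - ρ k = g * s k)

lemma exists_isG {m : ℕ} (ρ s : Fin m → ℝ) (hs : ∀ k, 0 < s k) : ∃ g, IsG ρ s g := by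
  by_cases h : ∀ k, - ρ k ≤ 0
  · exact ⟨0, le_refl _, fun k => by simpa using h k, Or.inl rfl⟩
  · push Not at h
    obtain ⟨k0, hk0⟩ := h
    obtain ⟨k, -, hk⟩ := Finset.exists_max_image Finset.univ (fun k => - ρ k / s k) ⟨k0, Finset.mem_univ _⟩
    refine ⟨- ρ k / s k, ?_, fun j => ?_, Or.inr ⟨k, ?_⟩⟩
    · exact (div_pos hk0 (hs k0)).le.trans (hk k0 (Finset.mem_univ _))
    · exact (div_le_iff₀ (hs j)).1 (hk j (Finset.mem_univ _))
    · field_simp [(hs k).ne']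

lemma isG_le {m : ℕ} {ρ s z : Fin m → ℝ} {g g' C : ℝ} (hC : 0 ≤ C) (hs : ∀ k, 0 < s k)
    (h : ∀ k, z k ≤ C * s k) (hg : IsG ρ s g) (hg' : IsG ρ z g') : g ≤ C * g' := by
  obtain ⟨h0, h1, h2⟩ := hg
  obtain ⟨h0', h1', -⟩ := hg'
  rcases h2 with h2 | ⟨k, hk⟩
  · rw [h2]; positivity
  · have a1 := h1' k
    have a2 := mul_le_mul_of_nonneg_left (h k) h0'
    have a3 := hs k
    have : g * s k ≤ (C * g') * s k := by nlinarith
    exact le_of_mul_le_mul_right this a3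

lemma fiber_aux {m : ℕ} (ρ zx zy : Fin m → ℝ) (t : ℝ) (ht : 0 ≤ t)
    (hx : ∀ k, 0 < zx k) (hy : ∀ k, 0 < zy k)
    (hzy : ∀ k, zy k = zx k - t * ρ k) (gx hx' gy hy' γ γ' : ℝ)
    (hgx : IsG ρ zx gx) (hhx : IsG (-ρ) zx hx') (hgy : IsG ρ zy gy) (hhy : IsG (-ρ) zy hy')
    (hγ : 0 ≤ γ) (hγγ : γ ≤ γ') (h1 : gx ≤ γ' * hx') (h2 : γ * hy' ≤ gy) (k : Fin m) :
    zy k * (1 + γ) ≤ (1 + γ') * zx k := by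
  by_cases hρ : 0 ≤ ρ k
  · have := hzy k
    have : zy k ≤ zx k := by nlinarith [mul_nonneg ht hρ]
    nlinarith [hx k, hy k]
  push Not at hρ
  have a1 := hgx.2.1 k
  have gpos : 0 < gx := by
    by_contra hh
    have : gx = 0 := le_antisymm (not_lt.1 hh) hgx.1
    rw [this] at a1; linarith
  have hpos : 0 < hx' := by
    rcases hhx.1.lt_or_eq with h | h
    · exact h
    · rw [← h] at h1; linarith
  have key : t * gx * (1 + γ) ≤ γ' - γ := by
    obtain ⟨j, hj⟩ := hhx.2.2.resolve_left hpos.ne'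
    simp only [Pi.neg_apply, neg_neg] at hj
    have b1 : zy j = zx j * (1 - t * hx') := by rw [hzy, hj]; ring
    have b2 : 0 < 1 - t * hx' := by
      have := hy j
      rw [b1] at this
      exact (mul_pos_iff_of_pos_left (hx j)).1 this
    have b3 := hhy.2.1 j
    simp only [Pi.neg_apply, neg_neg] at b3
    have b4 : hx' ≤ hy' * (1 - t * hx') := by
      rw [b1, hj] at b3
      have : hx' * zx j ≤ hy' * (1 - t * hx') * zx j := by linarith
      exact le_of_mul_le_mul_right this (hx j)
    have b5 : gy * (1 + t * gx) ≤ gx := by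
      rcases hgy.2.2 with h | ⟨i, hi⟩
      · rw [h]; linarith
      · have c1 := hgx.2.1 i
        have c2 := hzy i
        have c3 := hy i
        have c4 : gy * (1 + t * gx) * zy i ≤ gx * zy i := by
          have : gy * (1 + t * gx) * zy i = (1 + t * gx) * (-ρ i) := by rw [hi]; ring
          rw [this, c2]
          nlinarith
        exact le_of_mul_le_mul_right c4 c3
    have b6 : γ * hx' * (1 + t * gx) ≤ gx * (1 - t * hx') := by
      have p1 : 0 < 1 + t * gx := by nlinarith [mul_nonneg ht gpos.le]
      calc γ * hx' * (1 + t * gx) ≤ γ * (hy' * (1 - t * hx')) * (1 + t * gx) := by gcongr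
        _ = (γ * hy') * (1 - t * hx') * (1 + t * gx) := by ring
        _ ≤ gy * (1 - t * hx') * (1 + t * gx) := by gcongr
        _ = gy * (1 + t * gx) * (1 - t * hx') := by ring
        _ ≤ gx * (1 - t * hx') := by gcongr
    have : (t * gx * (1 + γ)) * hx' ≤ (γ' - γ) * hx' := by nlinarith
    exact le_of_mul_le_mul_right this hpos
  have c1 : zy k ≤ zx k * (1 + t * gx) := by
    rw [hzy k]; nlinarith
  have c2 : zy k * (1 + γ) ≤ zx k * (1 + t * gx) * (1 + γ) := by gcongr
  have := mul_le_mul_of_nonneg_left key (hx k).le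
  nlinarith

lemma fiber_one {m : ℕ} (ρ sx sy zx zy : Fin m → ℝ) (t : ℝ) (ht : 0 ≤ t)
    (hx : ∀ k, 0 < sx k) (hy : ∀ k, 0 < sy k)
    (hx1 : ∀ k, 20 / 21 * sx k ≤ zx k) (hx2 : ∀ k, zx k ≤ 22 / 21 * sx k)
    (hy1 : ∀ k, 20 / 21 * sy k ≤ zy k) (hy2 : ∀ k, zy k ≤ 22 / 21 * sy k)
    (hzy : ∀ k, zy k = zx k - t * ρ k) (gx hx' gy hy' γ γ' : ℝ)
    (hgx : IsG ρ sx gx) (hhx : IsG (-ρ) sx hx') (hgy : IsG ρ sy gy) (hhy : IsG (-ρ) sy hy')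
    (hγ : 0 ≤ γ) (hγγ : γ ≤ γ') (h1 : gx ≤ γ' * hx') (h2 : γ * hy' ≤ gy)
    (hc : 11 / 10 * (1 + 11 / 10 * γ') ≤ 2 * (1 + 10 / 11 * γ)) (k : Fin m) :
    sy k ≤ 2 * sx k := by
  have zx0 : ∀ k, 0 < zx k := fun k => by linarith [hx k, hx1 k]
  have zy0 : ∀ k, 0 < zy k := fun k => by linarith [hy k, hy1 k]
  obtain ⟨g1, hg1⟩ := exists_isG ρ zx zx0
  obtain ⟨g2, hg2⟩ := exists_isG (-ρ) zx zx0
  obtain ⟨g3, hg3⟩ := exists_isG ρ zy zy0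
  obtain ⟨g4, hg4⟩ := exists_isG (-ρ) zy zy0
  have e1 := isG_le (C := 21 / 20) (by norm_num) zx0 (fun k => by linarith [hx1 k]) hg1 hgx
  have e2 := isG_le (C := 22 / 21) (by norm_num) hx hx2 hhx hg2
  have e3 := isG_le (C := 22 / 21) (by norm_num) hy hy2 hgy hg3
  have e4 := isG_le (C := 21 / 20) (by norm_num) zy0 (fun k => by linarith [hy1 k]) hg4 hhy
  have := fiber_aux ρ zx zy t ht zx0 zy0 hzy g1 g2 g3 g4 (10 / 11 * γ) (11 / 10 * γ')
    hg1 hg2 hg3 hg4 (by positivity) (by linarith) (by nlinarith) (by nlinarith) k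
  have a := hx2 k
  have b := hy1 k
  have hp : (0:ℝ) < 1 + 10 / 11 * γ := by positivity
  have : sy k * (1 + 10 / 11 * γ) ≤ 2 * sx k * (1 + 10 / 11 * γ) := by
    have q1 : sy k * (1 + 10 / 11 * γ) ≤ 21 / 20 * (zy k * (1 + 10 / 11 * γ)) := by nlinarith
    have q2 : (1 + 11 / 10 * γ') * zx k ≤ (1 + 11 / 10 * γ') * (22 / 21 * sx k) := by
      apply mul_le_mul_of_nonneg_left a; linarith
    have q3 := mul_le_mul_of_nonneg_right hc (hx k).le
    nlinarith
  exact le_of_mul_le_mul_right this hp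

noncomputable def gval {m : ℕ} (ρ s : Fin m → ℝ) : ℝ :=
  open Classical in if h : ∃ g, IsG ρ s g then h.choose else 0

lemma gval_spec {m : ℕ} (ρ s : Fin m → ℝ) (hs : ∀ k, 0 < s k) : IsG ρ s (gval ρ s) := by
  have h := exists_isG ρ s hs
  unfold gval
  rw [dif_pos h]
  exact h.choose_spec

noncomputable def cls {m : ℕ} (ρ s : Fin m → ℝ) : Fin 3 :=
  open Classical in
  if gval ρ s ≤ 7 / 10 * gval (-ρ) s then 0 else if gval (-ρ) s ≤ 7 / 10 * gval ρ s then 1 else 2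

lemma fiber_main {m : ℕ} (ρ sx sy zx zy : Fin m → ℝ) (t : ℝ)
    (hx : ∀ k, 0 < sx k) (hy : ∀ k, 0 < sy k)
    (hx1 : ∀ k, 20 / 21 * sx k ≤ zx k) (hx2 : ∀ k, zx k ≤ 22 / 21 * sx k)
    (hy1 : ∀ k, 20 / 21 * sy k ≤ zy k) (hy2 : ∀ k, zy k ≤ 22 / 21 * sy k)
    (hzy : ∀ k, zy k = zx k - t * ρ k) (hc : cls ρ sx = cls ρ sy) :
    (∀ k, sy k ≤ 2 * sx k) ∨ (∀ k, sx k ≤ 2 * sy k) := by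
  have G1 := gval_spec ρ sx hx
  have G2 := gval_spec (-ρ) sx hx
  have G3 := gval_spec ρ sy hy
  have G4 := gval_spec (-ρ) sy hy
  have G1' := G1
  have G3' := G3
  rw [← neg_neg ρ] at G1' G3'
  simp only [neg_neg] at G1' G3'
  have n1 := G1.1
  have n2 := G2.1
  have n3 := G3.1
  have n4 := G4.1
  have H : ∀ γ γ' : ℝ, 0 ≤ γ → γ ≤ γ' → 11 / 10 * (1 + 11 / 10 * γ') ≤ 2 * (1 + 10 / 11 * γ) →
      gval ρ sx ≤ γ' * gval (-ρ) sx → gval ρ sy ≤ γ' * gval (-ρ) sy →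
      γ * gval (-ρ) sx ≤ gval ρ sx → γ * gval (-ρ) sy ≤ gval ρ sy →
      (∀ k, sy k ≤ 2 * sx k) ∨ (∀ k, sx k ≤ 2 * sy k) := by
    intro γ γ' a1 a2 a3 a4 a5 a6 a7
    rcases le_total 0 t with ht | ht
    · exact Or.inl (fiber_one ρ sx sy zx zy t ht hx hy hx1 hx2 hy1 hy2 hzy _ _ _ _ γ γ' G1 G2 G3 G4 a1 a2 a4 a7 a3)
    · exact Or.inr (fiber_one ρ sy sx zy zx (-t) (by linarith) hy hx hy1 hy2 hx1 hx2
        (fun k => by rw [hzy]; ring) _ _ _ _ γ γ' G3 G4 G1 G2 a1 a2 a5 a6 a3)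
  unfold cls at hc
  split_ifs at hc with c1 c2 c3 c4 c5 c6 c7 c8 c9
  · exact H 0 (7/10) le_rfl (by norm_num) (by norm_num) c1 c2 (by simpa using n1) (by simpa using n3)
  all_goals first | (exfalso; revert hc; decide) | skip
  · -- high
    have c1' : gval (-ρ) sx ≤ 7 / 10 * gval ρ sx := by assumption
    have c2' : gval (-ρ) sy ≤ 7 / 10 * gval ρ sy := by assumption
    rcases le_total 0 t with ht | ht
    · refine Or.inr (fiber_one (-ρ) sy sx zy zx t ht hy hx hy1 hy2 hx1 hx2
        (fun k => by rw [hzy]; simp) _ _ _ _ 0 (7/10) G4 (by simpa using G3) G2 (by simpa using G1) le_rfl (by norm_num) c2' (by simpa using n2) (by norm_num))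
    · refine Or.inl (fiber_one (-ρ) sx sy zx zy (-t) (by linarith) hx hy hx1 hx2 hy1 hy2
        (fun k => by rw [hzy]; simp) _ _ _ _ 0 (7/10) G2 (by simpa using G1) G4 (by simpa using G3) le_rfl (by norm_num) c1' (by simpa using n4) (by norm_num))
  · apply H (7/10) (3/2) (by norm_num) (by norm_num) (by norm_num) <;> linarith

section
open scoped Matrix
open MeasureTheory

def sbm {m n : ℕ} (a : Fin m → Fin n → ℝ) (e : Fin n → Fin m) : Matrix (Fin n) (Fin n) ℝ :=
  Matrix.of fun i j => a (e i) j

lemma sbm_apply {m n : ℕ} (a : Fin m → Fin n → ℝ) (e : Fin n → Fin m) (i j) :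
    sbm a e i j = a (e i) j := rfl

lemma sbm_update {m n : ℕ} (a : Fin m → Fin n → ℝ) (e : Fin n → Fin m) (i : Fin n) (k : Fin m) :
    sbm a (Function.update e i k) = (sbm a e).updateRow i (a k) := by
  ext x y
  by_cases hab : x = i
  · subst hab; simp [sbm_apply]
  · simp [sbm_apply, hab]

lemma sbm_mulVec {m n : ℕ} (a : Fin m → Fin n → ℝ) (e : Fin n → Fin m) (d : Fin n → ℝ) (i : Fin n) :
    (sbm a e *ᵥ d) i = a (e i) ⬝ᵥ d := rfl

lemma det_scaled {m n : ℕ} (a : Fin m → Fin n → ℝ) (s : Fin m → ℝ) (e : Fin n → Fin m) :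
    (sbm (fun k j => a k j / s k) e).det = (sbm a e).det / ∏ i, s (e i) := by
  have : (sbm (fun k j => a k j / s k) e) =
      Matrix.diagonal (fun i => (s (e i))⁻¹) * (sbm a e) := by
    ext i j
    simp [Matrix.diagonal_mul, div_eq_inv_mul, sbm_apply]
  rw [this, Matrix.det_mul, Matrix.det_diagonal, Finset.prod_inv_distrib, div_eq_inv_mul]

lemma dot_scaled {n : ℕ} (v d : Fin n → ℝ) (s : ℝ) (hs : 0 < s) :
    |v ⬝ᵥ d| / s = |(fun j => v j / s) ⬝ᵥ d| := by
  have h : (fun j => v j / s) ⬝ᵥ d = (v ⬝ᵥ d) / s := by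
    simp [dotProduct, Finset.sum_div, div_mul_eq_mul_div]
  rw [h, abs_div, abs_of_pos hs]

lemma maxbasis {m n : ℕ} (a : Fin m → Fin n → ℝ) (s : Fin m → ℝ) (hs : ∀ k, 0 < s k)
    (e1 : Fin n → Fin m) (he1 : (sbm a e1).det ≠ 0) :
    ∃ e0 : Fin n → Fin m, (sbm a e0).det ≠ 0 ∧
      ∀ k d, |a k ⬝ᵥ d| / s k ≤ ∑ i, |a (e0 i) ⬝ᵥ d| / s (e0 i) := by
  set U : Fin m → Fin n → ℝ := fun k j => a k j / s k with hU
  obtain ⟨e0, -, h0⟩ := Finset.exists_max_image Finset.univ (fun e => |(sbm U e).det|) ⟨e1, Finset.mem_univ _⟩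
  have hdet : ∀ e, (sbm U e).det = (sbm a e).det / ∏ i, s (e i) := fun e => det_scaled a s e
  have hp : ∀ e : Fin n → Fin m, 0 < ∏ i, s (e i) := fun e => Finset.prod_pos fun i _ => hs _
  have hd0 : (sbm U e0).det ≠ 0 := by
    have := h0 e1 (Finset.mem_univ _)
    have h2 : 0 < |(sbm U e1).det| := by
      rw [abs_pos, hdet]
      exact div_ne_zero he1 (hp e1).ne'
    exact abs_pos.1 (h2.trans_le this)
  refine ⟨e0, ?_, ?_⟩
  · intro h
    apply hd0
    rw [hdet, h, zero_div]
  intro k d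
  have hUd : ∀ k, |a k ⬝ᵥ d| / s k = |U k ⬝ᵥ d| := fun k => dot_scaled _ _ _ (hs k)
  rw [hUd]
  simp_rw [hUd]
  have key := Matrix.mulVec_cramer (sbm U e0)ᵀ (U k)
  have key2 : (sbm U e0).det * (U k ⬝ᵥ d) = ∑ i, (sbm U e0)ᵀ.cramer (U k) i * (U (e0 i) ⬝ᵥ d) := by
    have := congrArg (fun v => v ⬝ᵥ d) key
    simp only [smul_dotProduct, Matrix.det_transpose, smul_eq_mul] at this
    rw [← this]
    rw [Matrix.mulVec_transpose, ← Matrix.dotProduct_mulVec]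
    rfl
  have hcr : ∀ i, |(sbm U e0)ᵀ.cramer (U k) i| ≤ |(sbm U e0).det| := by
    intro i
    rw [Matrix.cramer_transpose_apply, ← sbm_update]
    exact h0 _ (Finset.mem_univ _)
  have hd0' : 0 < |(sbm U e0).det| := abs_pos.2 hd0
  refine le_of_mul_le_mul_left ?_ hd0'
  rw [← abs_mul, key2, Finset.mul_sum]
  refine (Finset.abs_sum_le_sum_abs _ _).trans (Finset.sum_le_sum fun i _ => ?_)
  rw [abs_mul]
  exact mul_le_mul_of_nonneg_right (hcr i) (abs_nonneg _)

lemma det_updateRow_adj {n : ℕ} (M : Matrix (Fin n) (Fin n) ℝ) (p : Fin n) (u : Fin n → ℝ) :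
    (M.updateRow p u).det = u ⬝ᵥ fun j => M.adjugate j p := by
  rw [Matrix.det_eq_sum_mul_adjugate_row _ p, dotProduct]
  apply Finset.sum_congr rfl
  intro j _
  simp [Matrix.adjugate_apply]

lemma block {m n : ℕ} (hn : 2 ≤ n) (a : Fin m → Fin n → ℝ) (s : Fin m → ℝ)
    (hs : ∀ k, 0 < s k) (e e0 : Fin n → Fin m) (p : Fin n)
    (he : (sbm a e).det ≠ 0) (he0 : (sbm a e0).det ≠ 0)
    (hdom : ∀ k d, |a k ⬝ᵥ d| / s k ≤ ∑ i, |a (e0 i) ⬝ᵥ d| / s (e0 i))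
    (hr : ∃ k, s k < |a k ⬝ᵥ fun j => (sbm a e).adjugate j p|) :
    ∃ W : Set (Fin n → ℝ), MeasurableSet W ∧ volume W ≠ ⊤ ∧
      (∀ w ∈ W, ∃ d, (∀ k, |a k ⬝ᵥ d| ≤ 1 / 21 * s k) ∧
        (∀ i, i ≠ p → w i = s (e i) + a (e i) ⬝ᵥ d) ∧ |w p| ≤ 1 / (21 * n)) ∧
      (|(sbm a e).det| / ∏ i, s (e i)) / (|(sbm a e0).det| / ∏ i, s (e0 i)) ≤
        n * (21 * n / 2) ^ n * (volume W).toReal * (∏ i ∈ Finset.univ.erase p, (s (e i))⁻¹) *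
          min 1 (|(sbm a e).det| / s (e p)) := by
  have hn0 : (0:ℝ) < n := by positivity
  set r : Fin n → ℝ := fun j => (sbm a e).adjugate j p with hrdef
  set D := |(sbm a e).det| with hD
  have hDpos : 0 < D := abs_pos.2 he
  -- lower bounds
  have hrp : |a (e p) ⬝ᵥ r| = D := by
    have := Matrix.det_eq_sum_mul_adjugate_row (sbm a e) p
    rw [hD, this]; rfl
  have sum1 : max 1 (D / s (e p)) ≤ ∑ i, |a (e0 i) ⬝ᵥ r| / s (e0 i) := by
    apply max_le
    · obtain ⟨k, hk⟩ := hr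
      refine le_trans ?_ (hdom k r)
      rw [le_div_iff₀ (hs k)]; linarith
    · rw [← hrp]; exact hdom _ _
  obtain ⟨q, hq⟩ : ∃ q, max 1 (D / s (e p)) ≤ n * (|a (e0 q) ⬝ᵥ r| / s (e0 q)) := by
    by_contra! hcon
    have h2 : ∑ q : Fin n, (n * (|a (e0 q) ⬝ᵥ r| / s (e0 q))) < ∑ q : Fin n, max 1 (D / s (e p)) :=
      Finset.sum_lt_sum_of_nonempty ⟨p, Finset.mem_univ _⟩ (fun i _ => hcon i)
    rw [← Finset.mul_sum] at h2
    simp only [Finset.sum_const, Finset.card_univ, Fintype.card_fin, nsmul_eq_mul] at h2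
    have := lt_of_mul_lt_mul_left h2 hn0.le
    linarith
  set U : Fin m → Fin n → ℝ := fun k j => a k j / s k with hU
  have hUd : ∀ k d, |a k ⬝ᵥ d| / s k = |U k ⬝ᵥ d| := fun k d => dot_scaled _ _ _ (hs k)
  set U0 : Matrix (Fin n) (Fin n) ℝ := sbm U e0 with hU0
  have hU0det : U0.det = (sbm a e0).det / ∏ i, s (e0 i) := det_scaled a s e0
  have hps : ∀ e : Fin n → Fin m, 0 < ∏ i, s (e i) := fun e => Finset.prod_pos fun i _ => hs _
  have hU0ne : U0.det ≠ 0 := by rw [hU0det]; exact div_ne_zero he0 (hps e0).ne'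
  have hU0u : IsUnit U0.det := isUnit_iff_ne_zero.2 hU0ne
  set T := (sbm a e).updateRow p (U (e0 q)) with hT
  have hTabs : max 1 (D / s (e p)) ≤ n * |T.det| := by
    rw [hT, det_updateRow_adj, ← hrdef, ← hUd]; exact hq
  set δ : ℝ := 1 / (21 * n) with hδ
  have hδ0 : 0 < δ := by positivity
  set Q : Set (Fin n → ℝ) := Set.Icc (fun _ => -δ) (fun _ => δ) with hQ
  have hQvol : (volume Q).toReal = (2 * δ) ^ n := by
    rw [hQ, Real.volume_Icc_pi_toReal]
    · simp [two_mul]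
    · intro i; simp; linarith
  set L := Matrix.toLin' (T * U0⁻¹) with hL
  set base : Fin n → ℝ := fun i => if i = p then 0 else s (e i) with hbase
  have hLdet : LinearMap.det L = T.det / U0.det := by
    rw [hL, LinearMap.det_toLin', Matrix.det_mul, Matrix.det_nonsing_inv, Ring.inverse_eq_inv', div_eq_mul_inv]
  have hvol : volume ((fun w => base + w) '' (L '' Q)) = ENNReal.ofReal |T.det / U0.det| * volume Q := by
    rw [Set.image_add_left, measure_preimage_add, Measure.addHaar_image_linearMap, hLdet]
  refine ⟨(fun w => base + w) '' (L '' Q), ?_, ?_, ?_, ?_⟩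
  · apply IsCompact.measurableSet
    apply IsCompact.image _ (by fun_prop)
    apply IsCompact.image isCompact_Icc
    exact LinearMap.continuous_of_finiteDimensional _
  · rw [hvol]
    exact ENNReal.mul_ne_top ENNReal.ofReal_ne_top isCompact_Icc.measure_lt_top.ne
  · rintro _ ⟨_, ⟨y, hy, rfl⟩, rfl⟩
    have hLy : L y = T *ᵥ (U0⁻¹ *ᵥ y) := by
      rw [hL, Matrix.toLin'_apply, Matrix.mulVec_mulVec]
    set d := U0⁻¹ *ᵥ y with hd
    have hUy : ∀ i, U (e0 i) ⬝ᵥ d = y i := by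
      intro i
      have : U0 *ᵥ d = y := by rw [hd, Matrix.mulVec_mulVec, Matrix.mul_nonsing_inv _ hU0u, Matrix.one_mulVec]
      rw [← this]; rfl
    have hyb : ∀ i, |y i| ≤ δ := fun i => abs_le.2 ⟨hy.1 i, hy.2 i⟩
    refine ⟨d, fun k => ?_, fun i hi => ?_, ?_⟩
    · have h1 := hdom k d
      have h2 : ∑ i, |a (e0 i) ⬝ᵥ d| / s (e0 i) ≤ 1 / 21 := by
        calc ∑ i, |a (e0 i) ⬝ᵥ d| / s (e0 i) ≤ ∑ i : Fin n, δ := by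
              apply Finset.sum_le_sum
              intro i _
              rw [hUd, hUy]; exact hyb i
          _ = 1 / 21 := by simp [hδ]; field_simp
      have := h1.trans h2
      rwa [div_le_iff₀ (hs k)] at this
    · simp only [Pi.add_apply, hLy, hbase, if_neg hi]
      congr 1
      rw [Matrix.mulVec, hT, Matrix.updateRow_ne hi]
      rfl
    · simp only [Pi.add_apply, hLy, hbase, if_true, zero_add]
      have : (T *ᵥ d) p = y q := by
        rw [← hUy q, Matrix.mulVec, hT, Matrix.updateRow_self]
      rw [this]; exact hyb q
  · rw [hvol, ENNReal.toReal_mul, hQvol, ENNReal.toReal_ofReal (abs_nonneg _)]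
    have h1 : |(sbm a e0).det| / ∏ i, s (e0 i) = |U0.det| := by
      rw [hU0det, abs_div, abs_of_pos (hps e0)]
    rw [h1, abs_div, Finset.prod_inv_distrib]
    have h2 : ∏ i, s (e i) = s (e p) * ∏ i ∈ Finset.univ.erase p, s (e i) :=
      (Finset.mul_prod_erase _ _ (Finset.mem_univ p)).symm
    rw [h2]
    set PP := ∏ i ∈ Finset.univ.erase p, s (e i) with hPP
    have hPP0 : 0 < PP := Finset.prod_pos fun i _ => hs _
    have hUpos : 0 < |U0.det| := abs_pos.2 hU0ne
    have h3 : (21 * (n:ℝ) / 2) ^ n * (2 * δ) ^ n = 1 := by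
      rw [← mul_pow, hδ]
      have : 21 * (n:ℝ) / 2 * (2 * (1 / (21 * n))) = 1 := by field_simp
      rw [this, one_pow]
    have hsp := hs (e p)
    have h4 : D / s (e p) ≤ (n * |T.det|) * min 1 (D / s (e p)) := by
      have hq0 : 0 < D / s (e p) := by positivity
      rcases le_total 1 (D / s (e p)) with h | h
      · rw [min_eq_left h, mul_one]; exact (le_max_right _ _).trans hTabs
      · rw [min_eq_right h]
        have := (le_max_left _ _).trans hTabs
        nlinarith
    calc D / (s (e p) * PP) / |U0.det| = (D / s (e p)) * (PP⁻¹ / |U0.det|) := by field_simp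
      _ ≤ ((n * |T.det|) * min 1 (D / s (e p))) * (PP⁻¹ / |U0.det|) := by gcongr
      _ = n * ((21 * (n:ℝ) / 2) ^ n * (2 * δ) ^ n) * (|T.det| / |U0.det|) * PP⁻¹ * min 1 (D / s (e p)) := by
          rw [h3]; field_simp
      _ = _ := by ring

end

section
open scoped Matrix
open MeasureTheory

def FeasS {m n : ℕ} (a : Fin m → Fin n → ℝ) (s : Fin m → ℝ) (e : Fin n → Fin m) : Prop :=
  (sbm a e).det ≠ 0 ∧ ∃ y : Fin n → ℝ, (∀ k, a k ⬝ᵥ y ≤ s k) ∧ ∀ i, a (e i) ⬝ᵥ y = s (e i)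

lemma det_updateRow_vecMul {n : ℕ} (M : Matrix (Fin n) (Fin n) ℝ) (j : Fin n) (g : Fin n → ℝ) :
    (M.updateRow j (g ᵥ* M)).det = g j * M.det := by
  have := Matrix.det_updateRow_sum M j g
  rw [← smul_eq_mul, ← this]
  congr 2
  ext k
  simp [Matrix.vecMul, dotProduct, Finset.sum_apply]

lemma vecMul_sbm {m n : ℕ} (a : Fin m → Fin n → ℝ) (e : Fin n → Fin m) (t : Fin n → ℝ) :
    t ᵥ* sbm a e = ∑ i, t i • a (e i) := by
  ext k
  simp [Matrix.vecMul, dotProduct, sbm_apply]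

lemma pivot_lemma {m n : ℕ} (a : Fin m → Fin n → ℝ) (s : Fin m → ℝ) (hs : ∀ k, 0 < s k)
    (c : Fin n → ℝ)
    (hgen : ∀ e, (sbm a e).det ≠ 0 → ∀ i, (c ᵥ* (sbm a e)⁻¹) i ≠ 0)
    (e0 : Fin n → Fin m) (he0 : (sbm a e0).det ≠ 0) (h0 : ∀ i, 0 ≤ (c ᵥ* (sbm a e0)⁻¹) i) :
    ∃ e, FeasS a s e ∧ (∀ i, 0 ≤ (c ᵥ* (sbm a e)⁻¹) i) ∧
      ∑ i, (c ᵥ* (sbm a e)⁻¹) i * s (e i) ≤ ∑ i, (c ᵥ* (sbm a e0)⁻¹) i * s (e0 i) := by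
  classical
  set E : Finset (Fin n → Fin m) :=
    Finset.univ.filter (fun e => (sbm a e).det ≠ 0 ∧ ∀ i, 0 ≤ (c ᵥ* (sbm a e)⁻¹) i) with hE
  obtain ⟨e, heE, hmin⟩ := Finset.exists_min_image E
    (fun e => ∑ i, (c ᵥ* (sbm a e)⁻¹) i * s (e i)) ⟨e0, by simp [hE, he0, h0]⟩
  simp only [hE, Finset.mem_filter, Finset.mem_univ, true_and] at heE hmin
  obtain ⟨hdet, hpos⟩ := heE
  refine ⟨e, ⟨hdet, (sbm a e)⁻¹ *ᵥ (fun i => s (e i)), ?_, ?_⟩, hpos, hmin e0 ⟨he0, h0⟩⟩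
  swap
  · intro i
    rw [← sbm_mulVec, Matrix.mulVec_mulVec, Matrix.mul_nonsing_inv _ (isUnit_iff_ne_zero.2 hdet), Matrix.one_mulVec]
  intro k
  by_contra! hk
  set t := c ᵥ* (sbm a e)⁻¹ with ht
  have hu : IsUnit (sbm a e).det := isUnit_iff_ne_zero.2 hdet
  set g := (a k) ᵥ* (sbm a e)⁻¹ with hg
  have hgk : g ᵥ* sbm a e = a k := by
    rw [hg, Matrix.vecMul_vecMul, Matrix.nonsing_inv_mul _ hu, Matrix.vecMul_one]
  have htc : t ᵥ* sbm a e = c := by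
    rw [ht, Matrix.vecMul_vecMul, Matrix.nonsing_inv_mul _ hu, Matrix.vecMul_one]
  have hgs : s k < ∑ i, g i * s (e i) := by
    rw [Matrix.dotProduct_mulVec] at hk
    exact hk
  obtain ⟨i0, hi0⟩ : ∃ i, 0 < g i := by
    by_contra! hcon
    have : ∑ i, g i * s (e i) ≤ 0 :=
      Finset.sum_nonpos fun i _ => mul_nonpos_of_nonpos_of_nonneg (hcon i) (hs _).le
    linarith [hs k]
  obtain ⟨j, hj, hjmin⟩ := Finset.exists_min_image (Finset.univ.filter fun i => 0 < g i)
    (fun i => t i / g i) ⟨i0, by simp [hi0]⟩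
  simp only [Finset.mem_filter, Finset.mem_univ, true_and] at hj hjmin
  have htpos : ∀ i, 0 < t i := fun i => lt_of_le_of_ne (hpos i) (Ne.symm (hgen e hdet i))
  set θ := t j / g j with hθ
  have hθ0 : 0 < θ := div_pos (htpos j) hj
  have hθj : t j - θ * g j = 0 := by rw [hθ]; field_simp; simp
  have hge : ∀ i, 0 ≤ t i - θ * g i := by
    intro i
    by_cases hi : 0 < g i
    · have := hjmin i hi
      rw [le_div_iff₀ hi] at this
      linarith
    · have := htpos i
      nlinarith
  set e' := Function.update e j k with he'
  set t' : Fin n → ℝ := Function.update (fun i => t i - θ * g i) j θ with ht'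
  have hdet' : (sbm a e').det ≠ 0 := by
    rw [he', sbm_update, ← hgk, det_updateRow_vecMul]
    exact mul_ne_zero hj.ne' hdet
  have hsum : ∀ f : Fin m → ℝ, ∑ i, t' i * f (e' i) = ∑ i, (t i - θ * g i) * f (e i) + θ * f k := by
    intro f
    rw [← Finset.add_sum_erase _ _ (Finset.mem_univ j),
      ← Finset.add_sum_erase (a := j) _ (fun i => (t i - θ * g i) * f (e i)) (Finset.mem_univ j)]
    have : ∑ x ∈ Finset.univ.erase j, t' x * f (e' x) =
        ∑ x ∈ Finset.univ.erase j, (t x - θ * g x) * f (e x) := by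
      apply Finset.sum_congr rfl
      intro x hx
      have hx' : x ≠ j := Finset.ne_of_mem_erase hx
      simp [ht', he', hx']
    rw [this, hθj]
    simp [ht', he']
    ring
  have htc' : t' ᵥ* sbm a e' = c := by
    ext l
    have h1 := hsum (fun k => a k l)
    have h2 := congrFun htc l
    have h3 := congrFun hgk l
    simp only [Matrix.vecMul, dotProduct, sbm_apply] at h2 h3 ⊢
    rw [h1, ← h2, ← h3, Finset.mul_sum, ← Finset.sum_add_distrib]
    apply Finset.sum_congr rfl
    intro i _
    ring
  have hu' : IsUnit (sbm a e').det := isUnit_iff_ne_zero.2 hdet'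
  have htt : c ᵥ* (sbm a e')⁻¹ = t' := by
    rw [← htc', Matrix.vecMul_vecMul, Matrix.mul_nonsing_inv _ hu', Matrix.vecMul_one]
  have hm := hmin e' ⟨hdet', by
    rw [htt]; intro i
    by_cases hi : i = j
    · subst hi; simp [ht', hθ0.le]
    · simpa [ht', hi] using hge i⟩
  rw [htt, hsum s] at hm
  have : ∑ i, (t i - θ * g i) * s (e i) = ∑ i, t i * s (e i) - θ * ∑ i, g i * s (e i) := by
    rw [Finset.mul_sum, ← Finset.sum_sub_distrib]
    apply Finset.sum_congr rfl
    intro i _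
    ring
  rw [this] at hm
  nlinarith

def sdelta (n : ℕ) : Set (Fin n → ℝ) := {t | (∀ i, 0 ≤ t i) ∧ ∑ i, t i ≤ 1}

lemma sdelta_fin (n : ℕ) : volume (sdelta n) ≠ ⊤ := by
  have : sdelta n ⊆ Set.Icc (fun _ => 0) (fun _ => 1) := by
    intro t ht
    refine ⟨ht.1, fun i => ?_⟩
    exact (Finset.single_le_sum (fun i _ => ht.1 i) (Finset.mem_univ i)).trans ht.2
  exact ((measure_mono this).trans_lt isCompact_Icc.measure_lt_top).ne

lemma sdelta_pos (n : ℕ) (hn : 0 < n) : 0 < (volume (sdelta n)).toReal := by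
  refine ENNReal.toReal_pos ?_ (sdelta_fin n)
  have hn' : (0:ℝ) < n := by positivity
  have hsub : Set.Icc (fun _ => 0) (fun _ => 1 / (n:ℝ)) ⊆ sdelta n := by
    intro t ht
    refine ⟨ht.1, ?_⟩
    calc ∑ i, t i ≤ ∑ i : Fin n, 1 / (n:ℝ) := Finset.sum_le_sum fun i _ => ht.2 i
      _ = 1 := by simp; field_simp
  have h2 : 0 < (volume (Set.Icc (fun _ : Fin n => (0:ℝ)) (fun _ => 1 / (n:ℝ)))).toReal := by
    rw [Real.volume_Icc_pi_toReal]
    · simp; positivity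
    · intro i; simp
  intro h
  have := measure_mono (μ := volume) hsub
  rw [h] at this
  rw [le_antisymm this bot_le] at h2
  simp at h2

lemma vol_image_vecMul {n : ℕ} (M : Matrix (Fin n) (Fin n) ℝ) (S : Set (Fin n → ℝ)) :
    volume ((fun t => t ᵥ* M) '' S) = ENNReal.ofReal |M.det| * volume S := by
  have : (fun t => t ᵥ* M) = Matrix.toLin' Mᵀ := by
    ext t; simp [Matrix.mulVec_transpose]
  rw [this, Measure.addHaar_image_linearMap, LinearMap.det_toLin', Matrix.det_transpose]

open Classical in
lemma L_cover {m n : ℕ} (hn : 0 < n) (a : Fin m → Fin n → ℝ) (s : Fin m → ℝ) (hs : ∀ k, 0 < s k)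
    (e0 : Fin n → Fin m) (he0 : (sbm a e0).det ≠ 0) :
    |(sbm a e0).det| / ∏ i, s (e0 i) ≤
      ∑ e ∈ Finset.univ.filter (FeasS a s), |(sbm a e).det| / ∏ i, s (e i) := by
  set U : Fin m → Fin n → ℝ := fun k j => a k j / s k with hU
  set S : (Fin n → Fin m) → Set (Fin n → ℝ) := fun e => (fun t => t ᵥ* sbm U e) '' sdelta n with hS
  have hps : ∀ e : Fin n → Fin m, 0 < ∏ i, s (e i) := fun e => Finset.prod_pos fun i _ => hs _
  have hdU : ∀ e, |(sbm a e).det| / ∏ i, s (e i) = |(sbm U e).det| := by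
    intro e; rw [det_scaled a s e, abs_div, abs_of_pos (hps e)]
  set N : Set (Fin n → ℝ) := ⋃ e : {e : Fin n → Fin m // (sbm a e).det ≠ 0}, ⋃ i : Fin n,
    {c | (c ᵥ* (sbm a e.1)⁻¹) i = 0} with hN
  have hN0 : volume N = 0 := by
    rw [hN]
    refine measure_iUnion_null fun e => measure_iUnion_null fun i => ?_
    have hu : IsUnit (sbm a e.1).det := isUnit_iff_ne_zero.2 e.2
    set f : (Fin n → ℝ) →ₗ[ℝ] ℝ := (LinearMap.proj i).comp (Matrix.toLin' ((sbm a e.1)⁻¹)ᵀ) with hf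
    have hfc : ∀ c, f c = (c ᵥ* (sbm a e.1)⁻¹) i := by
      intro c; simp [hf, Matrix.mulVec_transpose]
    have : {c | (c ᵥ* (sbm a e.1)⁻¹) i = 0} = (LinearMap.ker f : Set (Fin n → ℝ)) := by
      ext c; simp [hfc]
    rw [this]
    apply Measure.addHaar_submodule
    intro htop
    have : f ((Pi.single i 1) ᵥ* sbm a e.1) = 0 := by
      rw [← LinearMap.mem_ker, htop]; trivial
    rw [hfc, Matrix.vecMul_vecMul, Matrix.mul_nonsing_inv _ hu, Matrix.vecMul_one] at this
    simp at this
  have hconv : ∀ e t, t ᵥ* sbm U e = (fun i => t i / s (e i)) ᵥ* sbm a e := by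
    intro e t
    ext l
    simp only [Matrix.vecMul, dotProduct, sbm_apply, hU]
    apply Finset.sum_congr rfl
    intro i _
    ring
  have hsub : S e0 ⊆ (⋃ e ∈ Finset.univ.filter (FeasS a s), S e) ∪ N := by
    rintro c ⟨t, ht, rfl⟩
    by_cases hc : (fun t => t ᵥ* sbm U e0) t ∈ N
    · exact Or.inr hc
    left
    set c := (fun t => t ᵥ* sbm U e0) t with hcdef
    have hu0 : IsUnit (sbm a e0).det := isUnit_iff_ne_zero.2 he0
    have hc0 : c ᵥ* (sbm a e0)⁻¹ = fun i => t i / s (e0 i) := by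
      rw [hcdef]
      simp only
      rw [hconv, Matrix.vecMul_vecMul, Matrix.mul_nonsing_inv _ hu0, Matrix.vecMul_one]
    obtain ⟨e, hfe, hpos, hle⟩ := pivot_lemma a s hs c (by
      intro e he i h
      apply hc
      rw [hN]
      simp only [Set.mem_iUnion, Set.mem_ofPred_eq]
      exact ⟨⟨e, he⟩, i, h⟩) e0 he0 (by
      rw [hc0]; intro i; exact div_nonneg (ht.1 i) (hs _).le)
    simp only [Set.mem_iUnion]
    refine ⟨e, by simp [hfe], fun i => (c ᵥ* (sbm a e)⁻¹) i * s (e i), ⟨?_, ?_⟩, ?_⟩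
    · intro i; exact mul_nonneg (hpos i) (hs _).le
    · refine hle.trans ?_
      rw [hc0]
      refine le_of_eq_of_le (Finset.sum_congr rfl fun i _ => ?_) ht.2
      exact div_mul_cancel₀ _ (hs _).ne'
    · simp only
      rw [hconv]
      have : (fun i => (c ᵥ* (sbm a e)⁻¹) i * s (e i) / s (e i)) = c ᵥ* (sbm a e)⁻¹ := by
        ext i; exact mul_div_cancel_right₀ _ (hs _).ne'
      rw [this, Matrix.vecMul_vecMul, Matrix.nonsing_inv_mul _ (isUnit_iff_ne_zero.2 hfe.1), Matrix.vecMul_one]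
  have hm : volume (S e0) ≤ ∑ e ∈ Finset.univ.filter (FeasS a s), volume (S e) := by
    calc volume (S e0) ≤ volume ((⋃ e ∈ Finset.univ.filter (FeasS a s), S e) ∪ N) := measure_mono hsub
      _ ≤ volume (⋃ e ∈ Finset.univ.filter (FeasS a s), S e) + volume N := measure_union_le _ _
      _ ≤ _ := by rw [hN0, add_zero]; exact measure_biUnion_finset_le _ _
  have hSv : ∀ e, volume (S e) = ENNReal.ofReal |(sbm U e).det| * volume (sdelta n) :=
    fun e => vol_image_vecMul _ _
  have hSf : ∀ e, volume (S e) ≠ ⊤ := fun e => by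
    rw [hSv]; exact ENNReal.mul_ne_top ENNReal.ofReal_ne_top (sdelta_fin n)
  have hm2 := ENNReal.toReal_mono (by
    exact (ENNReal.sum_lt_top.2 fun e _ => (hSf e).lt_top).ne) hm
  rw [ENNReal.toReal_sum (fun e _ => hSf e)] at hm2
  simp only [hSv, ENNReal.toReal_mul, ENNReal.toReal_ofReal (abs_nonneg _)] at hm2
  rw [← Finset.sum_mul] at hm2
  have := le_of_mul_le_mul_right hm2 (sdelta_pos n hn)
  simpa only [hdU] using this

end

section
open scoped Matrix
open MeasureTheory

lemma exists_generic_c {m n : ℕ} (a : Fin m → Fin n → ℝ) :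
    ∃ c : Fin n → ℝ, ∀ e, (sbm a e).det ≠ 0 → ∀ i, (c ᵥ* (sbm a e)⁻¹) i ≠ 0 := by
  set N : Set (Fin n → ℝ) := ⋃ e : {e : Fin n → Fin m // (sbm a e).det ≠ 0}, ⋃ i : Fin n,
    {c | (c ᵥ* (sbm a e.1)⁻¹) i = 0} with hN
  have hN0 : volume N = 0 := by
    rw [hN]
    refine measure_iUnion_null fun e => measure_iUnion_null fun i => ?_
    have hu : IsUnit (sbm a e.1).det := isUnit_iff_ne_zero.2 e.2
    set f : (Fin n → ℝ) →ₗ[ℝ] ℝ := (LinearMap.proj i).comp (Matrix.toLin' ((sbm a e.1)⁻¹)ᵀ) with hf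
    have hfc : ∀ c, f c = (c ᵥ* (sbm a e.1)⁻¹) i := by
      intro c; simp [hf, Matrix.mulVec_transpose]
    have : {c | (c ᵥ* (sbm a e.1)⁻¹) i = 0} = (LinearMap.ker f : Set (Fin n → ℝ)) := by
      ext c; simp [hfc]
    rw [this]
    apply Measure.addHaar_submodule
    intro htop
    have : f ((Pi.single i 1) ᵥ* sbm a e.1) = 0 := by
      rw [← LinearMap.mem_ker, htop]; trivial
    rw [hfc, Matrix.vecMul_vecMul, Matrix.mul_nonsing_inv _ hu, Matrix.vecMul_one] at this
    simp at this
  by_contra! hcon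
  have huniv : N = Set.univ := by
    rw [Set.eq_univ_iff_forall]
    intro c
    obtain ⟨e, he, i, hi⟩ := hcon c
    rw [hN]
    simp only [Set.mem_iUnion, Set.mem_ofPred_eq]
    exact ⟨⟨e, he⟩, i, hi⟩
  rw [huniv] at hN0
  exact (NeZero.ne (volume : Measure (Fin n → ℝ))) (Measure.measure_univ_eq_zero.1 hN0)

def Nondeg {m n : ℕ} (a : Fin m → Fin n → ℝ) (β : Fin m → ℝ) : Prop :=
  ∀ e, (sbm a e).det ≠ 0 → ∀ k, (∀ i, e i ≠ k) → ∀ v, (∀ i, a (e i) ⬝ᵥ v = β (e i)) →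
    a k ⬝ᵥ v ≠ β k

lemma exists_nondeg {m n : ℕ} (a : Fin m → Fin n → ℝ) (b : Fin m → ℝ) :
    ∃ β : Fin m → ℝ, (∀ k, b k + 1 / 2 ≤ β k ∧ β k < b k + 1) ∧ Nondeg a β := by
  set N : Set (Fin m → ℝ) := ⋃ e : {e : Fin n → Fin m // (sbm a e).det ≠ 0},
    ⋃ k : {k : Fin m // ∀ i, e.1 i ≠ k},
    {β | a k.1 ⬝ᵥ ((sbm a e.1)⁻¹ *ᵥ fun i => β (e.1 i)) - β k.1 = 0} with hN
  have hN0 : volume N = 0 := by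
    rw [hN]
    refine measure_iUnion_null fun e => measure_iUnion_null fun k => ?_
    set f : (Fin m → ℝ) →ₗ[ℝ] ℝ :=
      { toFun := fun β => a k.1 ⬝ᵥ ((sbm a e.1)⁻¹ *ᵥ fun i => β (e.1 i)) - β k.1
        map_add' := by
          intro x y
          have : (fun i => (x + y) (e.1 i)) = (fun i => x (e.1 i)) + fun i => y (e.1 i) := rfl
          rw [this, Matrix.mulVec_add, dotProduct_add, Pi.add_apply]; ring
        map_smul' := by
          intro c x
          have : (fun i => (c • x) (e.1 i)) = c • (fun i => x (e.1 i)) := rfl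
          rw [this, Matrix.mulVec_smul, dotProduct_smul, Pi.smul_apply]; simp; ring } with hf
    have : {β | a k.1 ⬝ᵥ ((sbm a e.1)⁻¹ *ᵥ fun i => β (e.1 i)) - β k.1 = 0} =
        (LinearMap.ker f : Set (Fin m → ℝ)) := by
      ext c; simp [hf]
    rw [this]
    apply Measure.addHaar_submodule
    intro htop
    have : f (Pi.single k.1 1) = 0 := by
      rw [← LinearMap.mem_ker, htop]; trivial
    have h2 : (fun i => (Pi.single k.1 1 : Fin m → ℝ) (e.1 i)) = 0 := by
      ext i; simp [k.2 i]
    simp [hf, h2] at this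
  by_contra! hcon
  have hsub : Set.Icc (fun k => b k + 1 / 2) (fun k => b k + 3 / 4) ⊆ N := by
    intro β hβ
    have := hcon β (fun k => ⟨hβ.1 k, (hβ.2 k).trans_lt (by linarith)⟩)
    unfold Nondeg at this
    push Not at this
    obtain ⟨e, he, k, hk, v, hv, hkv⟩ := this
    rw [hN]
    simp only [Set.mem_iUnion, Set.mem_ofPred_eq]
    refine ⟨⟨e, he⟩, ⟨k, hk⟩, ?_⟩
    have : (fun i => β (e i)) = sbm a e *ᵥ v := by
      ext i; rw [sbm_mulVec, hv]
    simp only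
    rw [this, Matrix.mulVec_mulVec, Matrix.nonsing_inv_mul _ (isUnit_iff_ne_zero.2 he), Matrix.one_mulVec,
      hkv, sub_self]
  have h2 : 0 < (volume (Set.Icc (fun k => b k + 1 / 2) (fun k => b k + 3 / 4))).toReal := by
    rw [Real.volume_Icc_pi_toReal]
    · apply Finset.prod_pos; intro i _; linarith
    · intro i; simp only; linarith
  rw [measure_mono_null hsub hN0] at h2
  simp at h2

lemma sbm_inj {m n : ℕ} (a : Fin m → Fin n → ℝ) (e : Fin n → Fin m) (he : (sbm a e).det ≠ 0) :
    Function.Injective e := by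
  intro i j hij
  by_contra hne
  apply he
  apply Matrix.det_zero_of_row_eq hne
  ext k
  simp [sbm, hij]

def cond2 {m n : ℕ} (a : Fin m → Fin n → ℝ) (c : Fin n → ℝ) (e : Fin n → Fin m)
    (sg : Bool) (F : Finset (Fin m)) : Prop :=
  (∀ i, e i ∈ F ∨ 0 < (if sg then (1:ℝ) else -1) * (c ᵥ* (sbm a e)⁻¹) i) ∧ ∀ k ∈ F, ∃ i, e i = k

lemma exists_cond2 {m n : ℕ} (a : Fin m → Fin n → ℝ) (c : Fin n → ℝ)
    (e : Fin n → Fin m) (he : (sbm a e).det ≠ 0) (hc : ∀ i, (c ᵥ* (sbm a e)⁻¹) i ≠ 0) :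
    ∃ (sg : Bool) (F : Finset (Fin m)), F.card = n / 2 ∧ cond2 a c e sg F := by
  classical
  set t := c ᵥ* (sbm a e)⁻¹ with ht
  have main : ∀ sg : Bool, n - n / 2 ≤ (Finset.univ.filter
      (fun i => 0 < (if sg then (1:ℝ) else -1) * t i)).card →
      ∃ (F : Finset (Fin m)), F.card = n / 2 ∧ cond2 a c e sg F := by
    intro sg hcard
    obtain ⟨T, hT, hTc⟩ := Finset.exists_subset_card_eq hcard
    refine ⟨(Finset.univ \ T).image e, ?_, ?_, ?_⟩
    · rw [Finset.card_image_of_injective _ (sbm_inj a e he), Finset.card_sdiff_of_subset (Finset.subset_univ _), hTc]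
      simp; omega
    · intro i
      by_cases hi : i ∈ T
      · right
        have := hT hi
        simpa using this
      · left
        exact Finset.mem_image_of_mem _ (by simp [hi])
    · intro k hk
      obtain ⟨i, -, hi⟩ := Finset.mem_image.1 hk
      exact ⟨i, hi⟩
  have hsum : n ≤ (Finset.univ.filter (fun i => 0 < (if true then (1:ℝ) else -1) * t i)).card +
      (Finset.univ.filter (fun i => 0 < (if false then (1:ℝ) else -1) * t i)).card := by
    rw [← Finset.card_union_of_disjoint]
    · have : Finset.univ.filter (fun i => 0 < (if true then (1:ℝ) else -1) * t i) ∪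
        Finset.univ.filter (fun i => 0 < (if false then (1:ℝ) else -1) * t i) = Finset.univ := by
        ext i
        simp
        exact (hc i).symm
      rw [this]; simp
    · rw [Finset.disjoint_filter]
      intro i _ h1 h2
      simp at h1 h2
      linarith
  by_cases h : n - n / 2 ≤ (Finset.univ.filter (fun i => 0 < (if true then (1:ℝ) else -1) * t i)).card
  · exact ⟨true, main true h⟩
  · exact ⟨false, main false (by simp at h hsum ⊢; omega)⟩

lemma cond2_aux {m n : ℕ} (a : Fin m → Fin n → ℝ) (β : Fin m → ℝ)
    (c : Fin n → ℝ) (e : Fin n → Fin m) (he : (sbm a e).det ≠ 0)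
    (sg : Bool) (F : Finset (Fin m)) (h : cond2 a c e sg F) (v v' : Fin n → ℝ)
    (hv : ∀ i, a (e i) ⬝ᵥ v = β (e i)) (hv' : ∀ k, a k ⬝ᵥ v' ≤ β k) (hF : ∀ k ∈ F, a k ⬝ᵥ v' = β k) :
    0 ≤ (if sg then (1:ℝ) else -1) * (c ⬝ᵥ (v - v')) ∧
    ((if sg then (1:ℝ) else -1) * (c ⬝ᵥ (v - v')) ≤ 0 → ∀ i, a (e i) ⬝ᵥ v' = β (e i)) := by
  set t := c ᵥ* (sbm a e)⁻¹ with ht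
  set σ : ℝ := if sg then (1:ℝ) else -1 with hσ
  have hu : IsUnit (sbm a e).det := isUnit_iff_ne_zero.2 he
  have htc : t ᵥ* sbm a e = c := by
    rw [ht, Matrix.vecMul_vecMul, Matrix.nonsing_inv_mul _ hu, Matrix.vecMul_one]
  have key : σ * (c ⬝ᵥ (v - v')) = ∑ i, (σ * t i) * (β (e i) - a (e i) ⬝ᵥ v') := by
    rw [← htc, ← Matrix.dotProduct_mulVec, dotProduct, Finset.mul_sum]
    apply Finset.sum_congr rfl
    intro i _
    rw [sbm_mulVec, dotProduct_sub, hv]; ring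
  have hnn : ∀ i, 0 ≤ (σ * t i) * (β (e i) - a (e i) ⬝ᵥ v') := by
    intro i
    rcases h.1 i with h1 | h1
    · rw [hF _ h1, sub_self, mul_zero]
    · exact mul_nonneg h1.le (sub_nonneg.2 (hv' _))
  rw [key]
  refine ⟨Finset.sum_nonneg fun i _ => hnn i, fun hle i => ?_⟩
  have h0 := (Finset.sum_eq_zero_iff_of_nonneg (fun i _ => hnn i)).1
    (le_antisymm hle (Finset.sum_nonneg fun i _ => hnn i)) i (Finset.mem_univ i)
  rcases h.1 i with h1 | h1
  · exact hF _ h1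
  · rcases mul_eq_zero.1 h0 with h2 | h2
    · exact absurd h2 h1.ne'
    · linarith

lemma cond2_same {m n : ℕ} (a : Fin m → Fin n → ℝ) (β : Fin m → ℝ) (hnd : Nondeg a β)
    (c : Fin n → ℝ) (e e' : Fin n → Fin m) (he : FeasS a β e) (he' : FeasS a β e')
    (sg : Bool) (F : Finset (Fin m)) (h : cond2 a c e sg F) (h' : cond2 a c e' sg F) :
    ∀ i, ∃ j, e j = e' i := by
  obtain ⟨hd, v, hv1, hv2⟩ := he
  obtain ⟨hd', v', hv1', hv2'⟩ := he'
  have hF : ∀ k ∈ F, a k ⬝ᵥ v = β k := by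
    intro k hk
    obtain ⟨i, rfl⟩ := h.2 k hk
    exact hv2 i
  have hF' : ∀ k ∈ F, a k ⬝ᵥ v' = β k := by
    intro k hk
    obtain ⟨i, rfl⟩ := h'.2 k hk
    exact hv2' i
  obtain ⟨x1, x2⟩ := cond2_aux a β c e hd sg F h v v' hv2 hv1' hF'
  obtain ⟨y1, -⟩ := cond2_aux a β c e' hd' sg F h' v' v hv2' hv1 hF
  have hv3 := x2 (by
    have : v' - v = -(v - v') := by abel
    rw [this, dotProduct_neg] at y1
    linarith)
  intro i
  by_contra! hcon
  exact hnd e hd (e' i) hcon v' hv3 (hv2' i)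

open Classical in
lemma L_seidel {m n : ℕ} (a : Fin m → Fin n → ℝ) (β : Fin m → ℝ) (hnd : Nondeg a β) :
    (Finset.univ.filter (FeasS a β)).card ≤ n ^ n * (2 * m.choose (n / 2)) := by
  obtain ⟨c, hc⟩ := exists_generic_c a
  have hex : ∀ e : Fin n → Fin m, ∃ q : Bool × Finset (Fin m), FeasS a β e →
      q.2.card = n / 2 ∧ cond2 a c e q.1 q.2 := by
    intro e
    by_cases h : FeasS a β e
    · obtain ⟨sg, F, h1, h2⟩ := exists_cond2 a c e h.1 (hc e h.1)
      exact ⟨(sg, F), fun _ => ⟨h1, h2⟩⟩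
    · exact ⟨(true, ∅), fun h' => absurd h' h⟩
  choose q hq using hex
  have hcard : ((Finset.univ : Finset Bool) ×ˢ (Finset.powersetCard (n / 2) (Finset.univ : Finset (Fin m)))).card
      = 2 * m.choose (n / 2) := by
    rw [Finset.card_product, Finset.card_powersetCard]; simp
  rw [← hcard]
  apply Finset.card_le_mul_card_image_of_maps_to (f := q)
  · intro e he
    simp only [Finset.mem_filter, Finset.mem_univ, true_and] at he
    simp [Finset.mem_product, Finset.mem_powersetCard, (hq e he).1]
  · intro p _
    rcases Finset.eq_empty_or_nonempty {e ∈ Finset.univ.filter (FeasS a β) | q e = p} with h | ⟨e1, h1⟩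
    · rw [h]; simp
    · simp only [Finset.mem_filter, Finset.mem_univ, true_and] at h1
      calc _ ≤ (Fintype.piFinset (fun _ : Fin n => Finset.univ.image e1)).card := by
            apply Finset.card_le_card
            intro e he
            simp only [Finset.mem_filter, Finset.mem_univ, true_and] at he
            rw [Fintype.mem_piFinset]
            intro i
            have h2 := (hq e he.1).2
            have h3 := (hq e1 h1.1).2
            rw [he.2] at h2
            rw [h1.2] at h3
            obtain ⟨j, hj⟩ := cond2_same a β hnd c e1 e h1.1 he.1 _ _ h3 h2 i
            simp only [Finset.mem_image, Finset.mem_univ, true_and]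
            exact ⟨j, hj⟩
        _ ≤ n ^ n := by
            rw [Fintype.card_piFinset_const]
            apply Nat.pow_le_pow_left
            exact Finset.card_image_le.trans (by simp)

end

section
open MeasureTheory

noncomputable def phi (D : ℝ) (N : ℕ) (s : ℝ) : ℝ := s⁻¹ * (min 1 (D / s)) ^ (1 / (N : ℝ))

lemma phi_nonneg {D : ℝ} (hD : 0 ≤ D) (N : ℕ) {s : ℝ} (hs : 0 ≤ s) : 0 ≤ phi D N s := by
  unfold phi
  have : 0 ≤ min 1 (D / s) := le_min zero_le_one (by positivity)
  positivity

lemma phi_scale {D : ℝ} (hD : 0 < D) {N : ℕ} (hN : 1 ≤ N) {s w : ℝ} (hs : 0 < s) (hw : 0 < w)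
    (h : w ≤ 22 / 21 * s) : phi D N s ≤ (22 / 21) ^ 2 * phi D N w := by
  unfold phi
  have hN' : (1:ℝ) ≤ N := by exact_mod_cast hN
  have h1 : s⁻¹ ≤ 22 / 21 * w⁻¹ := by
    rw [inv_le_iff_one_le_mul₀ hs]
    have : 22 / 21 * w⁻¹ * s = (22 / 21 * s) / w := by field_simp
    rw [this, le_div_iff₀ hw]; linarith
  have h2 : min 1 (D / s) ≤ 22 / 21 * min 1 (D / w) := by
    rw [mul_min_of_nonneg _ _ (by norm_num)]
    apply min_le_min
    · norm_num
    · have := mul_le_mul_of_nonneg_left h1 hD.le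
      rw [div_eq_mul_inv D s, div_eq_mul_inv D w]
      linarith
  have h0 : 0 ≤ min 1 (D / s) := le_min zero_le_one (by positivity)
  have h0w : 0 ≤ min 1 (D / w) := le_min zero_le_one (by positivity)
  have h3 : (min 1 (D / s)) ^ (1 / (N:ℝ)) ≤ 22 / 21 * (min 1 (D / w)) ^ (1 / (N:ℝ)) := by
    calc (min 1 (D / s)) ^ (1 / (N:ℝ)) ≤ (22 / 21 * min 1 (D / w)) ^ (1 / (N:ℝ)) :=
          Real.rpow_le_rpow h0 h2 (by positivity)
      _ = (22 / 21) ^ (1 / (N:ℝ)) * (min 1 (D / w)) ^ (1 / (N:ℝ)) := Real.mul_rpow (by norm_num) h0w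
      _ ≤ _ := by
          apply mul_le_mul_of_nonneg_right _ (by positivity)
          calc ((22:ℝ) / 21) ^ (1 / (N:ℝ)) ≤ (22 / 21) ^ (1:ℝ) := by
                apply Real.rpow_le_rpow_of_exponent_le (by norm_num)
                rw [div_le_one (by linarith)]; exact hN'
            _ = 22 / 21 := Real.rpow_one _
  calc s⁻¹ * (min 1 (D / s)) ^ (1 / (N:ℝ)) ≤ (22 / 21 * w⁻¹) * (22 / 21 * (min 1 (D / w)) ^ (1 / (N:ℝ))) := by
        apply mul_le_mul h1 h3 (by positivity) (by positivity)
    _ = _ := by ring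

lemma phi_integral {D : ℝ} (hD : 1 ≤ D) {N : ℕ} (hN : 1 ≤ N) :
    IntegrableOn (phi D N) (Set.Ioi (2 / 5)) ∧
      ∫ s in Set.Ioi (2 / 5), phi D N s = Real.log (5 / 2 * D) + N := by
  have hN' : (1:ℝ) ≤ N := by exact_mod_cast hN
  have hD0 : 0 < D := by linarith
  have hle : (2:ℝ) / 5 ≤ D := by linarith
  have hN0 : (N:ℝ) ≠ 0 := by positivity
  set q : ℝ := -1 - 1 / (N:ℝ) with hq
  have hq1 : q < -1 := by
    have : 0 < 1 / (N:ℝ) := by positivity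
    rw [hq]; linarith
  have e1 : Set.EqOn (fun s : ℝ => s⁻¹) (phi D N) (Set.Ioc (2 / 5) D) := by
    intro s hs
    have hs0 : 0 < s := by have := hs.1; linarith
    have : min 1 (D / s) = 1 := min_eq_left (by rw [le_div_iff₀ hs0, one_mul]; exact hs.2)
    simp [phi, this]
  have e2 : Set.EqOn (fun s : ℝ => D ^ (1 / (N:ℝ)) * s ^ q) (phi D N) (Set.Ioi D) := by
    intro s hs
    have hs' : D < s := hs
    have hs0 : 0 < s := by linarith
    have : min 1 (D / s) = D / s := min_eq_right (by rw [div_le_one hs0]; exact hs'.le)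
    simp only [phi, this]
    rw [Real.div_rpow hD0.le hs0.le, hq, sub_eq_add_neg, Real.rpow_add hs0, Real.rpow_neg_one,
      Real.rpow_neg hs0.le]
    ring
  have i1 : IntegrableOn (fun s : ℝ => s⁻¹) (Set.Ioc (2 / 5) D) := by
    apply IntegrableOn.mono_set _ Set.Ioc_subset_Icc_self
    apply ContinuousOn.integrableOn_Icc
    apply ContinuousOn.inv₀ continuousOn_id
    intro x hx
    have := hx.1
    simp only [id]
    intro h; rw [h] at this; norm_num at this
  have i2 : IntegrableOn (fun s : ℝ => D ^ (1 / (N:ℝ)) * s ^ q) (Set.Ioi D) :=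
    (integrableOn_Ioi_rpow_of_lt hq1 hD0).const_mul _
  have j1 : IntegrableOn (phi D N) (Set.Ioc (2 / 5) D) := i1.congr_fun e1 measurableSet_Ioc
  have j2 : IntegrableOn (phi D N) (Set.Ioi D) := i2.congr_fun e2 measurableSet_Ioi
  have hun : Set.Ioc (2 / 5) D ∪ Set.Ioi D = Set.Ioi (2 / 5) := Set.Ioc_union_Ioi_eq_Ioi hle
  refine ⟨by rw [← hun]; exact j1.union j2, ?_⟩
  rw [← hun, setIntegral_union (Set.Ioc_disjoint_Ioi le_rfl) measurableSet_Ioi j1 j2,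
    ← setIntegral_congr_fun measurableSet_Ioc e1, ← setIntegral_congr_fun measurableSet_Ioi e2]
  congr 1
  · rw [← intervalIntegral.integral_of_le hle, integral_inv_of_pos (by norm_num) hD0]
    congr 1; field_simp
  · rw [integral_const_mul, integral_Ioi_rpow_of_lt hq1 hD0]
    have h1 : q + 1 = -(1 / (N:ℝ)) := by rw [hq]; ring
    rw [h1, Real.rpow_neg hD0.le]
    have : D ^ (1 / (N:ℝ)) ≠ 0 := by positivity
    field_simp

lemma phi_prod {n : ℕ} (hn : 2 ≤ n) (p : Fin n) {D : ℝ} (hD : 0 < D) (s : Fin n → ℝ) (hs : ∀ i, 0 < s i)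
    (hp : ∀ i, s i ≤ s p) :
    (∏ i ∈ Finset.univ.erase p, (s i)⁻¹) * min 1 (D / s p) ≤
      ∏ i ∈ Finset.univ.erase p, phi D (n - 1) (s i) := by
  unfold phi
  rw [Finset.prod_mul_distrib]
  have hN : ((n - 1 : ℕ):ℝ) ≠ 0 := by
    have : n - 1 ≠ 0 := by omega
    exact_mod_cast this
  have h0 : 0 ≤ min 1 (D / s p) := le_min zero_le_one (div_nonneg hD.le (hs p).le)
  apply mul_le_mul_of_nonneg_left
  · have hc : (Finset.univ.erase p).card = n - 1 := by simp
    calc min 1 (D / s p) = ((min 1 (D / s p)) ^ (1 / ((n - 1 : ℕ):ℝ))) ^ (n - 1) := by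
          rw [← Real.rpow_natCast, ← Real.rpow_mul h0, one_div_mul_cancel hN, Real.rpow_one]
      _ = ∏ i ∈ Finset.univ.erase p, (min 1 (D / s p)) ^ (1 / ((n - 1 : ℕ):ℝ)) := by
          rw [Finset.prod_const, hc]
      _ ≤ _ := by
          apply Finset.prod_le_prod
          · intro i _; positivity
          · intro i _
            apply Real.rpow_le_rpow h0 _ (by positivity)
            apply min_le_min le_rfl
            exact div_le_div_of_nonneg_left hD.le (hs i) (hp i)
  · exact Finset.prod_nonneg fun i _ => (inv_pos.2 (hs i)).le

noncomputable def psi (D : ℝ) (n : ℕ) (p i : Fin n) : ℝ → ℝ :=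
  if i = p then Set.indicator (Set.Icc (-(1 / (21 * n))) (1 / (21 * n))) (fun _ => (1:ℝ))
  else Set.indicator (Set.Ioi (2 / 5)) (phi D (n - 1))

lemma psi_nonneg {D : ℝ} (hD : 0 ≤ D) (n : ℕ) (p i : Fin n) (w : ℝ) : 0 ≤ psi D n p i w := by
  unfold psi
  split_ifs
  · apply Set.indicator_nonneg; intros; norm_num
  · apply Set.indicator_nonneg
    intro x hx
    have : (2:ℝ) / 5 < x := hx
    exact phi_nonneg hD _ (by linarith)

lemma Psi_int {n : ℕ} (hn : 2 ≤ n) (p : Fin n) {D : ℝ} (hD : 1 ≤ D) :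
    Integrable (fun w : Fin n → ℝ => ∏ i, psi D n p i (w i)) ∧
    ∫ w : Fin n → ℝ, ∏ i, psi D n p i (w i) =
      2 / (21 * n) * (Real.log (5 / 2 * D) + (n - 1 : ℕ)) ^ (n - 1) := by
  have hN : 1 ≤ n - 1 := by omega
  obtain ⟨hi, he⟩ := phi_integral hD hN
  have hint : ∀ i, Integrable (psi D n p i) := by
    intro i
    unfold psi
    split_ifs
    · rw [integrable_indicator_iff measurableSet_Icc]
      exact integrableOn_const isCompact_Icc.measure_lt_top.ne
    · rw [integrable_indicator_iff measurableSet_Ioi]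
      exact hi
  refine ⟨Integrable.fintype_prod (f := psi D n p) hint, ?_⟩
  rw [integral_fintype_prod_volume_eq_prod (psi D n p), ← Finset.mul_prod_erase _ _ (Finset.mem_univ p)]
  have hn0 : (0:ℝ) < n := by positivity
  congr 1
  · simp only [psi, if_true]
    rw [integral_indicator measurableSet_Icc, setIntegral_const]
    simp only [Measure.real, Real.volume_Icc, smul_eq_mul, mul_one]
    rw [ENNReal.toReal_ofReal (by
      have : 0 < 1 / (21 * (n:ℝ)) := by positivity
      linarith)]
    ring
  · have : ∀ i ∈ Finset.univ.erase p, ∫ w, psi D n p i w = Real.log (5 / 2 * D) + (n - 1 : ℕ) := by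
      intro i hi
      have hip : i ≠ p := Finset.ne_of_mem_erase hi
      simp only [psi, if_neg hip]
      rw [integral_indicator measurableSet_Ioi, he]
    rw [Finset.prod_congr rfl this, Finset.prod_const]
    simp

end

section
open scoped Matrix
open MeasureTheory

noncomputable def wt {m n : ℕ} (a : Fin m → Fin n → ℝ) (s : Fin m → ℝ) (e e0 : Fin n → Fin m) : ℝ :=
  (|(sbm a e).det| / ∏ i, s (e i)) / (|(sbm a e0).det| / ∏ i, s (e0 i))

lemma kernel_line {m n : ℕ} (a : Fin m → Fin n → ℝ) (e : Fin n → Fin m) (p : Fin n)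
    (he : (sbm a e).det ≠ 0) (u : Fin n → ℝ) (hu : ∀ i, i ≠ p → a (e i) ⬝ᵥ u = 0) :
    ∃ t : ℝ, u = t • fun j => (sbm a e).adjugate j p := by
  refine ⟨(a (e p) ⬝ᵥ u) / (sbm a e).det, ?_⟩
  have h1 : sbm a e *ᵥ u = Pi.single p (a (e p) ⬝ᵥ u) := by
    ext i
    rw [sbm_mulVec]
    by_cases hi : i = p
    · subst hi; simp
    · simp [hi, hu i hi]
  have h2 : (sbm a e).det • u = (sbm a e).adjugate *ᵥ (Pi.single p (a (e p) ⬝ᵥ u)) := by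
    rw [← h1, Matrix.mulVec_mulVec, Matrix.adjugate_mul, Matrix.smul_mulVec, Matrix.one_mulVec]
  ext j
  have h3 := congrFun h2 j
  simp only [Pi.smul_apply, smul_eq_mul, Matrix.mulVec_single] at h3 ⊢
  simp [Matrix.col_apply] at h3
  field_simp
  linarith

lemma per_block {m n : ℕ} (hn : 2 ≤ n) (a : Fin m → Fin n → ℝ) (β : Fin m → ℝ)
    (e : Fin n → Fin m) (he : (sbm a e).det ≠ 0) (hD : 1 ≤ |(sbm a e).det|) (p : Fin n)
    (X : Finset (Fin n → ℝ)) (s : (Fin n → ℝ) → Fin m → ℝ)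
    (hsx : ∀ x ∈ X, ∀ k, s x k = β k - a k ⬝ᵥ x)
    (H0 : ∀ x ∈ X, ∀ k, 1 / 2 ≤ s x k)
    (H1 : ∀ x ∈ X, ∀ y ∈ X, x ≠ y → ∃ k, 2 * s x k < s y k)
    (H2 : ∀ x ∈ X, ∃ k, s x k < |a k ⬝ᵥ fun j => (sbm a e).adjugate j p|)
    (e0 : (Fin n → ℝ) → Fin n → Fin m) (he0 : ∀ x ∈ X, (sbm a (e0 x)).det ≠ 0)
    (hdom : ∀ x ∈ X, ∀ k d, |a k ⬝ᵥ d| / s x k ≤ ∑ i, |a (e0 x i) ⬝ᵥ d| / s x (e0 x i))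
    (hp : ∀ x ∈ X, ∀ i, s x (e i) ≤ s x (e p))
    (c : Fin 3)
    (hc : ∀ x ∈ X, cls (fun k => a k ⬝ᵥ fun j => (sbm a e).adjugate j p) (s x) = c) :
    ∑ x ∈ X, wt a (s x) e (e0 x) ≤
      n * (21 * n / 2) ^ n * (((22 / 21) ^ 2) ^ (n - 1) *
        (2 / (21 * n) * (Real.log (5 / 2 * |(sbm a e).det|) + (n - 1 : ℕ)) ^ (n - 1))) := by
  set D := |(sbm a e).det| with hDdef
  have hD0 : 0 < D := by linarith
  set r : Fin n → ℝ := fun j => (sbm a e).adjugate j p with hr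
  have hex : ∀ x : Fin n → ℝ, ∃ W : Set (Fin n → ℝ), x ∈ X → (MeasurableSet W ∧ volume W ≠ ⊤ ∧
      (∀ w ∈ W, ∃ d, (∀ k, |a k ⬝ᵥ d| ≤ 1 / 21 * s x k) ∧
        (∀ i, i ≠ p → w i = s x (e i) + a (e i) ⬝ᵥ d) ∧ |w p| ≤ 1 / (21 * n)) ∧
      wt a (s x) e (e0 x) ≤
        n * (21 * n / 2) ^ n * (volume W).toReal * (∏ i ∈ Finset.univ.erase p, (s x (e i))⁻¹) *
          min 1 (D / s x (e p))) := by
    intro x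
    by_cases hx : x ∈ X
    · have hspos : ∀ k, 0 < s x k := fun k => by linarith [H0 x hx k]
      obtain ⟨W, hW⟩ := block hn a (s x) hspos e (e0 x) p he (he0 x hx) (hdom x hx) (H2 x hx)
      exact ⟨W, fun _ => hW⟩
    · exact ⟨∅, fun h => absurd h hx⟩
  choose W hW using hex
  have hdisj : (X : Set (Fin n → ℝ)).PairwiseDisjoint W := by
    intro x hx y hy hxy
    have hx : x ∈ X := hx
    have hy : y ∈ X := hy
    rw [Function.onFun, Set.disjoint_left]
    intro w hwx hwy
    obtain ⟨d, hd1, hd2, -⟩ := (hW x hx).2.2.1 w hwx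
    obtain ⟨d', hd1', hd2', -⟩ := (hW y hy).2.2.1 w hwy
    obtain ⟨t, ht⟩ := kernel_line a e p he ((x - d) - (y - d')) (by
      intro i hi
      have h1 := hd2 i hi
      have h2 := hd2' i hi
      rw [hsx x hx] at h1
      rw [hsx y hy] at h2
      simp only [dotProduct_sub]
      linarith)
    rw [← hr] at ht
    have hk : ∀ k, (s y k + a k ⬝ᵥ d') = (s x k + a k ⬝ᵥ d) - (-t) * (a k ⬝ᵥ r) := by
      intro k
      have h3 : a k ⬝ᵥ ((x - d) - (y - d')) = t * (a k ⬝ᵥ r) := by rw [ht, dotProduct_smul, smul_eq_mul]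
      simp only [dotProduct_sub] at h3
      rw [hsx x hx, hsx y hy]
      linarith
    have hfm := fiber_main (fun k => a k ⬝ᵥ r) (s x) (s y) (fun k => s x k + a k ⬝ᵥ d)
      (fun k => s y k + a k ⬝ᵥ d') (-t)
      (fun k => by linarith [H0 x hx k]) (fun k => by linarith [H0 y hy k])
      (fun k => by have := abs_le.1 (hd1 k); linarith)
      (fun k => by have := abs_le.1 (hd1 k); linarith)
      (fun k => by have := abs_le.1 (hd1' k); linarith)
      (fun k => by have := abs_le.1 (hd1' k); linarith) hk ((hc x hx).trans (hc y hy).symm)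
    rcases hfm with h | h
    · obtain ⟨k, hk⟩ := H1 x hx y hy hxy
      linarith [h k]
    · obtain ⟨k, hk⟩ := H1 y hy x hx (Ne.symm hxy)
      linarith [h k]
  obtain ⟨hPi, hPe⟩ := Psi_int hn p hD
  set Φ : (Fin n → ℝ) → ℝ := fun w => ∏ i, psi D n p i (w i) with hΦ
  have hΦ0 : ∀ w, 0 ≤ Φ w := fun w => Finset.prod_nonneg fun i _ => psi_nonneg hD0.le n p i _
  rw [← hPe]
  set C : ℝ := ((22 / 21) ^ 2) ^ (n - 1) with hC
  have hCpos : 0 < C := by positivity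
  have hK : 0 ≤ (n:ℝ) * (21 * n / 2) ^ n := by positivity
  have hone : ∀ x ∈ X, wt a (s x) e (e0 x) ≤ n * (21 * n / 2) ^ n * (C * ∫ w in W x, Φ w) := by
    intro x hx
    obtain ⟨w1, w2, w3, w4⟩ := hW x hx
    have hspos : ∀ k, 0 < s x k := fun k => by linarith [H0 x hx k]
    have hle := phi_prod hn p hD0 (fun i => s x (e i)) (fun i => hspos _) (hp x hx)
    set B := ∏ i ∈ Finset.univ.erase p, phi D (n - 1) (s x (e i)) with hB
    have hpt : ∀ w ∈ W x, B / C ≤ Φ w := by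
      intro w hw
      obtain ⟨d, hd1, hd2, hd3⟩ := w3 w hw
      rw [div_le_iff₀ hCpos, hΦ]
      simp only
      rw [← Finset.mul_prod_erase _ _ (Finset.mem_univ p)]
      have hp1 : psi D n p p (w p) = 1 := by
        simp only [psi, if_true]
        rw [Set.indicator_of_mem]
        exact abs_le.1 hd3
      rw [hp1, one_mul]
      have hcard : (Finset.univ.erase p).card = n - 1 := by simp
      rw [hC, ← hcard, ← Finset.prod_const, ← Finset.prod_mul_distrib]
      apply Finset.prod_le_prod
      · intro i _; exact phi_nonneg hD0.le _ (hspos _).le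
      · intro i hi
        have hip : i ≠ p := Finset.ne_of_mem_erase hi
        have hwi := hd2 i hip
        have hab := abs_le.1 (hd1 (e i))
        have hh := H0 x hx (e i)
        have hwl : 2 / 5 < w i := by rw [hwi]; linarith
        simp only [psi, if_neg hip]
        rw [Set.indicator_of_mem (show w i ∈ Set.Ioi (2/5) from hwl), mul_comm]
        apply phi_scale hD0 (by omega) (hspos _) (by linarith)
        rw [hwi]; linarith
    have hI := setIntegral_ge_of_const_le_real w1 w2 hpt hPi.integrableOn
    refine w4.trans ?_
    rw [mul_assoc, mul_assoc]
    apply mul_le_mul_of_nonneg_left _ hK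
    calc _ ≤ (volume (W x)).toReal * B := mul_le_mul_of_nonneg_left hle ENNReal.toReal_nonneg
      _ = C * (B / C * (volume (W x)).toReal) := by field_simp
      _ ≤ _ := mul_le_mul_of_nonneg_left hI hCpos.le
  calc ∑ x ∈ X, wt a (s x) e (e0 x) ≤ ∑ x ∈ X, n * (21 * n / 2) ^ n * (C * ∫ w in W x, Φ w) :=
        Finset.sum_le_sum hone
    _ = n * (21 * n / 2) ^ n * (C * ∑ x ∈ X, ∫ w in W x, Φ w) := by
        rw [← Finset.mul_sum, ← Finset.mul_sum]
    _ ≤ _ := by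
        apply mul_le_mul_of_nonneg_left _ hK
        apply mul_le_mul_of_nonneg_left _ hCpos.le
        rw [← integral_biUnion_finset X (fun x hx => (hW x hx).1) hdisj (fun x _ => hPi.integrableOn)]
        exact setIntegral_le_integral hPi (Filter.Eventually.of_forall hΦ0)

lemma per_e {m n : ℕ} (hn : 2 ≤ n) (a : Fin m → Fin n → ℝ) (β : Fin m → ℝ)
    (e : Fin n → Fin m) (he : (sbm a e).det ≠ 0) (hD : 1 ≤ |(sbm a e).det|)
    (X : Finset (Fin n → ℝ)) (s : (Fin n → ℝ) → Fin m → ℝ)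
    (hsx : ∀ x ∈ X, ∀ k, s x k = β k - a k ⬝ᵥ x)
    (H0 : ∀ x ∈ X, ∀ k, 1 / 2 ≤ s x k)
    (H1 : ∀ x ∈ X, ∀ y ∈ X, x ≠ y → ∃ k, 2 * s x k < s y k)
    (H2 : ∀ p, ∀ x ∈ X, ∃ k, s x k < |a k ⬝ᵥ fun j => (sbm a e).adjugate j p|)
    (e0 : (Fin n → ℝ) → Fin n → Fin m) (he0 : ∀ x ∈ X, (sbm a (e0 x)).det ≠ 0)
    (hdom : ∀ x ∈ X, ∀ k d, |a k ⬝ᵥ d| / s x k ≤ ∑ i, |a (e0 x i) ⬝ᵥ d| / s x (e0 x i)) :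
    ∑ x ∈ X, wt a (s x) e (e0 x) ≤
      (n * 3) * (n * (21 * n / 2) ^ n * (((22 / 21) ^ 2) ^ (n - 1) *
        (2 / (21 * n) * (Real.log (5 / 2 * |(sbm a e).det|) + (n - 1 : ℕ)) ^ (n - 1)))) := by
  classical
  have hpex : ∀ x : Fin n → ℝ, ∃ p : Fin n, ∀ i, s x (e i) ≤ s x (e p) := by
    intro x
    obtain ⟨p, -, hp⟩ := Finset.exists_max_image (Finset.univ : Finset (Fin n)) (fun i => s x (e i))
      ⟨⟨0, by omega⟩, Finset.mem_univ _⟩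
    exact ⟨p, fun i => hp i (Finset.mem_univ _)⟩
  choose P hP using hpex
  set key : (Fin n → ℝ) → Fin n × Fin 3 := fun x =>
    (P x, cls (fun k => a k ⬝ᵥ fun j => (sbm a e).adjugate j (P x)) (s x)) with hkey
  rw [← Finset.sum_fiberwise X key]
  set K := (n * (21 * n / 2) ^ n * (((22 / 21) ^ 2) ^ (n - 1) *
        (2 / (21 * n) * (Real.log (5 / 2 * |(sbm a e).det|) + (n - 1 : ℕ)) ^ (n - 1)))) with hK
  calc _ ≤ ∑ q : Fin n × Fin 3, K := by
        apply Finset.sum_le_sum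
        rintro ⟨p, c⟩ _
        apply per_block hn a β e he hD p _ s (c := c)
        · intro x hx; exact hsx x (Finset.mem_filter.1 hx).1
        · intro x hx; exact H0 x (Finset.mem_filter.1 hx).1
        · intro x hx y hy; exact H1 x (Finset.mem_filter.1 hx).1 y (Finset.mem_filter.1 hy).1
        · intro x hx; exact H2 p x (Finset.mem_filter.1 hx).1
        · intro x hx; exact he0 x (Finset.mem_filter.1 hx).1
        · intro x hx; exact hdom x (Finset.mem_filter.1 hx).1
        · intro x hx
          have h := (Finset.mem_filter.1 hx).2
          simp only [hkey, Prod.mk.injEq] at h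
          rw [← h.1]; exact hP x
        · intro x hx
          have h := (Finset.mem_filter.1 hx).2
          simp only [hkey, Prod.mk.injEq] at h
          rw [← h.2, h.1]
    _ = _ := by
        rw [Finset.sum_const, Finset.card_univ, Fintype.card_prod, Fintype.card_fin, Fintype.card_fin, nsmul_eq_mul]
        push_cast
        ring

end

open scoped Matrix

def ar {m n : ℕ} (A : Matrix (Fin m) (Fin n) ℤ) : Fin m → Fin n → ℝ := fun k j => (A k j : ℝ)

def zsb {m n : ℕ} (A : Matrix (Fin m) (Fin n) ℤ) (e : Fin n → Fin m) : Matrix (Fin n) (Fin n) ℤ :=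
  Matrix.of fun i j => A (e i) j

lemma sbm_zsb {m n : ℕ} (A : Matrix (Fin m) (Fin n) ℤ) (e : Fin n → Fin m) :
    sbm (ar A) e = (Int.castRingHom ℝ).mapMatrix (zsb A e) := by
  ext i j
  simp [sbm, ar, zsb]

lemma det_zsb {m n : ℕ} (A : Matrix (Fin m) (Fin n) ℤ) (e : Fin n → Fin m) :
    (sbm (ar A) e).det = ((zsb A e).det : ℝ) := by
  rw [sbm_zsb, ← RingHom.map_det]; rfl

lemma adj_zsb {m n : ℕ} (A : Matrix (Fin m) (Fin n) ℤ) (e : Fin n → Fin m) (i j : Fin n) :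
    (sbm (ar A) e).adjugate i j = ((zsb A e).adjugate i j : ℝ) := by
  rw [sbm_zsb, ← RingHom.map_adjugate]; rfl

lemma mem_int_of_lt {m n : ℕ} (A : Matrix (Fin m) (Fin n) ℤ) (b : Fin m → ℤ) (z : Fin n → ℤ)
    (x : Fin n → ℝ) (hx : ∀ j, x j = (z j : ℝ)) (h : ∀ k, ar A k ⬝ᵥ x < b k + 1) :
    x ∈ intPoints m n A b := by
  refine ⟨fun j => ⟨z j, hx j⟩, fun i => ?_⟩
  have h1 := h i
  have h2 : ar A i ⬝ᵥ x = ((∑ j, A i j * z j : ℤ) : ℝ) := by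
    simp only [ar, dotProduct, hx]; push_cast; rfl
  have h3 : ∑ j, (A i j : ℝ) * x j = ar A i ⬝ᵥ x := rfl
  rw [h3, h2]
  rw [h2] at h1
  have : (∑ j, A i j * z j : ℤ) < b i + 1 := by exact_mod_cast h1
  have : (∑ j, A i j * z j : ℤ) ≤ b i := by omega
  exact_mod_cast this

lemma vert_sub {m n : ℕ} {A : Matrix (Fin m) (Fin n) ℤ} {b : Fin m → ℤ} {x : Fin n → ℝ}
    (hx : x ∈ vertN m n A b) : x ∈ intPoints m n A b :=
  extremePoints_convexHull_subset hx

lemma vert_mid {m n : ℕ} {A : Matrix (Fin m) (Fin n) ℤ} {b : Fin m → ℤ} {x y z : Fin n → ℝ}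
    (hx : x ∈ vertN m n A b) (hy : y ∈ intPoints m n A b) (hz : z ∈ intPoints m n A b)
    (h : ∀ j, 2 * x j = y j + z j) : y = x := by
  have := (mem_extremePoints.1 hx).2 y (subset_convexHull _ _ hy) z (subset_convexHull _ _ hz) (by
    refine ⟨1 / 2, 1 / 2, by norm_num, by norm_num, by norm_num, ?_⟩
    ext j
    have := h j
    simp only [Pi.add_apply, Pi.smul_apply, smul_eq_mul]
    linarith)
  exact this.1

lemma vert_H1 {m n : ℕ} {A : Matrix (Fin m) (Fin n) ℤ} {b : Fin m → ℤ} (β : Fin m → ℝ)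
    (hβ : ∀ k, β k < b k + 1) {x y : Fin n → ℝ}
    (hx : x ∈ vertN m n A b) (hy : y ∈ vertN m n A b) (hxy : x ≠ y) :
    ∃ k, 2 * (β k - ar A k ⬝ᵥ x) < β k - ar A k ⬝ᵥ y := by
  by_contra! hcon
  apply hxy
  symm
  have hy' := vert_sub hy
  choose zx hzx using (vert_sub hx).1
  choose zy hzy using hy'.1
  refine vert_mid hx hy' (z := (2:ℝ) • x - y) ?_ ?_
  · apply mem_int_of_lt A b (fun j => 2 * zx j - zy j)
    · intro j; simp [hzx, hzy]
    · intro k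
      rw [dotProduct_sub, dotProduct_smul, smul_eq_mul]
      linarith [hcon k, hβ k]
  · intro j; simp

lemma vert_H2 {m n : ℕ} {A : Matrix (Fin m) (Fin n) ℤ} {b : Fin m → ℤ} (β : Fin m → ℝ)
    (hβ : ∀ k, β k < b k + 1) {x : Fin n → ℝ}
    (hx : x ∈ vertN m n A b) (d : Fin n → ℝ) (z : Fin n → ℤ) (hz : ∀ j, d j = (z j : ℝ)) (hd : d ≠ 0) :
    ∃ k, β k - ar A k ⬝ᵥ x < |ar A k ⬝ᵥ d| := by
  by_contra! hcon
  apply hd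
  choose zx hzx using (vert_sub hx).1
  have : x + d = x := by
    refine vert_mid hx (y := x + d) (z := x - d) ?_ ?_ ?_
    · apply mem_int_of_lt A b (fun j => zx j + z j)
      · intro j; simp [hzx, hz]
      · intro k
        rw [dotProduct_add]
        have := abs_le.1 (hcon k)
        linarith [hβ k]
    · apply mem_int_of_lt A b (fun j => zx j - z j)
      · intro j; simp [hzx, hz]
      · intro k
        rw [dotProduct_sub]
        have := abs_le.1 (hcon k)
        linarith [hβ k]
    · intro j; simp; ring
  simpa using this

lemma exists_ker {m n : ℕ} (A : Matrix (Fin m) (Fin n) ℤ) (h : ∀ e, (zsb A e).det = 0) :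
    ∃ z : Fin n → ℤ, z ≠ 0 ∧ A *ᵥ z = 0 := by
  have hdet : (Aᵀ * A).det = 0 := by
    have h1 : (Aᵀ * A).det = Matrix.detRowAlternating (R := ℤ) (n := Fin n)
        (fun i => ∑ k : Fin m, A k i • (fun j => A k j)) := by
      congr 1
      ext i j
      simp [Matrix.mul_apply]
    rw [h1]
    have h2 := MultilinearMap.map_sum (Matrix.detRowAlternating (R := ℤ) (n := Fin n)).toMultilinearMap
      (fun (i : Fin n) (k : Fin m) => A k i • (fun j => A k j))
    refine h2.trans ?_
    apply Finset.sum_eq_zero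
    intro e _
    rw [MultilinearMap.map_smul_univ]
    have : (Matrix.detRowAlternating (R := ℤ) (n := Fin n)).toMultilinearMap (fun i j => A (e i) j) = 0 := h e
    rw [this, smul_zero]
  obtain ⟨z, hz, hz0⟩ := Matrix.exists_mulVec_eq_zero_iff.2 hdet
  refine ⟨z, hz, ?_⟩
  have h3 : (A *ᵥ z) ⬝ᵥ (A *ᵥ z) = 0 := by
    rw [Matrix.dotProduct_mulVec, ← Matrix.mulVec_transpose, Matrix.mulVec_mulVec, hz0, zero_dotProduct]
  exact dotProduct_self_eq_zero.1 h3

lemma vert_rank {m n : ℕ} {A : Matrix (Fin m) (Fin n) ℤ} {b : Fin m → ℤ} {x : Fin n → ℝ}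
    (hx : x ∈ vertN m n A b) : ∃ e, (sbm (ar A) e).det ≠ 0 := by
  by_contra! hcon
  obtain ⟨z, hz, hz0⟩ := exists_ker A (fun e => by
    have := hcon e
    rw [det_zsb] at this
    exact_mod_cast this)
  obtain ⟨k, hk⟩ := vert_H2 (fun k => (b k : ℝ)) (fun k => by simp) hx (fun j => (z j : ℝ)) z
    (fun j => rfl) (fun h => hz (by
      ext j
      have := congrFun h j
      simpa using this))
  have h1 : ar A k ⬝ᵥ (fun j => (z j : ℝ)) = ((A *ᵥ z) k : ℤ) := by
    simp [ar, Matrix.mulVec, dotProduct]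
  rw [h1, hz0] at hk
  have h2 := (vert_sub hx).2 k
  have h3 : ∑ j, (A k j : ℝ) * x j = ar A k ⬝ᵥ x := rfl
  rw [h3] at h2
  simp at hk
  linarith

open scoped Matrix

lemma choose_ratio (c k t : ℕ) : (c + k + t).choose k ≤ (c + k).choose k * (k + t).choose k := by
  induction t with
  | zero => simp
  | succ t ih =>
    have h1 := Nat.choose_mul_succ_eq (c + k + t) k
    have h2 := Nat.choose_mul_succ_eq (k + t) k
    have e1 : c + k + t + 1 - k = c + t + 1 := by omega
    have e2 : k + t + 1 - k = t + 1 := by omega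
    rw [e1] at h1
    rw [e2] at h2
    have e3 : c + k + (t + 1) = c + k + t + 1 := by ring
    have e4 : k + (t + 1) = k + t + 1 := by ring
    rw [e3, e4]
    have hpos : 0 < (c + t + 1) * (t + 1) := by positivity
    refine le_of_mul_le_mul_right ?_ hpos
    calc (c + k + t + 1).choose k * ((c + t + 1) * (t + 1))
        = (c + k + t).choose k * ((c + k + t + 1) * (t + 1)) := by rw [← mul_assoc, ← h1]; ring
      _ ≤ ((c + k).choose k * (k + t).choose k) * ((k + t + 1) * (c + t + 1)) := by
          apply Nat.mul_le_mul ih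
          nlinarith [Nat.zero_le (k * c)]
      _ = (c + k).choose k * ((k + t).choose k * (k + t + 1)) * (c + t + 1) := by ring
      _ = _ := by rw [h2]; ring

lemma choose_le_xi (n m : ℕ) (hn : 1 ≤ n) (h : n ≤ m) : m.choose (n / 2) ≤ 2 ^ n * xi n m := by
  obtain ⟨t, rfl⟩ := Nat.exists_eq_add_of_le h
  have h1 := choose_ratio (n - n / 2) (n / 2) t
  have e1 : n - n / 2 + n / 2 = n := by omega
  rw [e1] at h1
  refine h1.trans ?_
  apply Nat.mul_le_mul (Nat.choose_le_two_pow _ _)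
  unfold xi
  have e2 : n + t - (n - 1) / 2 - 1 = n / 2 + t := by omega
  rw [e2]
  exact Nat.le_add_right _ _

lemma numC (n : ℕ) (hn : 2 ≤ n) (Y : ℝ) (hY : 0 ≤ Y) :
    ((n:ℝ) ^ n * (2 * 2 ^ n)) * ((n * 3) * (n * (21 * n / 2) ^ n * (((22 / 21) ^ 2) ^ (n - 1) *
        (2 / (21 * n) * (n / 2 * Y) ^ (n - 1))))) ≤ (n:ℝ) ^ (7 * n) * Y ^ (n - 1) := by
  obtain ⟨N, rfl⟩ : ∃ N, n = N + 1 := ⟨n - 1, by omega⟩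
  set x : ℝ := ((N + 1 : ℕ) : ℝ) with hx
  have hx2 : 2 ≤ x := by rw [hx]; exact_mod_cast hn
  have hx0 : 0 < x := by linarith
  simp only [Nat.add_sub_cancel]
  have hid : (x ^ (N + 1) * (2 * 2 ^ (N + 1))) * ((x * 3) * (x * (21 * x / 2) ^ (N + 1) * (((22 / 21) ^ 2) ^ N *
        (2 / (21 * x) * (x / 2 * Y) ^ N)))) =
      x ^ (3 * (N + 1)) * (12 * (2 * (21 / 2) * (22 / 21) ^ 2 / 2) ^ N) * Y ^ N := by
    have e1 : (21 * x / 2) ^ (N + 1) = (21 / 2) ^ N * x ^ N * (21 * x / 2) := by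
      rw [pow_succ, ← mul_pow]; congr 2; ring
    have e2 : (x / 2 * Y) ^ N = x ^ N * (1 / 2) ^ N * Y ^ N := by
      rw [← mul_pow, ← mul_pow]; congr 1; ring
    have e3 : (2 * (21 / 2) * (22 / 21) ^ 2 / 2 : ℝ) ^ N = 2 ^ N * (21 / 2) ^ N * ((22 / 21) ^ 2) ^ N * (1 / 2) ^ N := by
      rw [← mul_pow, ← mul_pow, ← mul_pow]; congr 1
      ring
    rw [e1, e2, e3]
    have e4 : x ^ (3 * (N + 1)) = x ^ N * x ^ N * x ^ N * x ^ 3 := by ring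
    rw [e4, pow_succ x N, pow_succ (2:ℝ) N]
    field_simp
    ring
  rw [hid]
  apply mul_le_mul_of_nonneg_right _ (by positivity)
  have e5 : x ^ (7 * (N + 1)) = x ^ (3 * (N + 1)) * (x ^ 4) ^ (N + 1) := by ring
  rw [e5]
  apply mul_le_mul_of_nonneg_left _ (by positivity)
  have h16 : (16:ℝ) ≤ x ^ 4 := by
    calc (16:ℝ) = 2 ^ 4 := by norm_num
      _ ≤ x ^ 4 := by gcongr
  calc (12 * (2 * (21 / 2) * (22 / 21) ^ 2 / 2) ^ N : ℝ) ≤ 16 * 16 ^ N := by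
        apply mul_le_mul (by norm_num) _ (by positivity) (by norm_num)
        apply pow_le_pow_left₀ (by norm_num)
        norm_num
    _ = 16 ^ (N + 1) := by ring
    _ ≤ _ := by gcongr

lemma numA (n α : ℕ) (hn : 2 ≤ n) (hα : 1 ≤ α) (D : ℝ) (hD : 1 ≤ D) (hD2 : D ≤ (n.factorial : ℝ) * (α:ℝ) ^ n) :
    Real.log (5 / 2 * D) + (n - 1 : ℕ) ≤
      n / 2 * (6 * Real.logb 2 (1 + (α : ℝ)) + 3 * Real.logb 2 (n : ℝ)) := by
  have hn' : (2:ℝ) ≤ n := by exact_mod_cast hn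
  have hα' : (1:ℝ) ≤ α := by exact_mod_cast hα
  have h1 : Real.log (5 / 2 * D) = Real.log (5 / 2) + Real.log D := Real.log_mul (by norm_num) (by linarith)
  have h2 : Real.log (5 / 2) ≤ 1 := by
    rw [Real.log_le_iff_le_exp (by norm_num)]
    linarith [Real.exp_one_gt_d9]
  have hf : (n.factorial : ℝ) ≤ (n:ℝ) ^ n := by exact_mod_cast Nat.factorial_le_pow n
  have h3 : Real.log D ≤ n * Real.log n + n * Real.log α := by
    calc Real.log D ≤ Real.log ((n:ℝ) ^ n * (α:ℝ) ^ n) := by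
          apply Real.log_le_log (by linarith)
          exact hD2.trans (by gcongr)
      _ = _ := by
          rw [Real.log_mul (by positivity) (by positivity), Real.log_pow, Real.log_pow]
  have h4 : ((n - 1 : ℕ) : ℝ) = n - 1 := by rw [Nat.cast_sub (by omega)]; simp
  have hl2 : Real.log 2 ≤ 1 := by linarith [Real.log_two_lt_d9]
  have hl20 : 0 < Real.log 2 := Real.log_pos (by norm_num)
  have hlb : ∀ y : ℝ, 1 ≤ y → Real.log y ≤ Real.logb 2 y := by
    intro y hy
    unfold Real.logb
    rw [le_div_iff₀ hl20]
    have := Real.log_nonneg hy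
    nlinarith
  have h5 := hlb n (by linarith)
  have h6 : Real.log α ≤ Real.logb 2 (1 + α) := by
    refine le_trans ?_ (hlb (1 + α) (by linarith))
    exact Real.log_le_log (by linarith) (by linarith)
  have h7 : 1 ≤ Real.logb 2 (1 + (α:ℝ)) := by
    rw [Real.le_logb_iff_rpow_le (by norm_num) (by linarith)]
    rw [Real.rpow_one]; linarith
  have h8 : 0 ≤ Real.log n := Real.log_nonneg (by linarith)
  have h9 : 1 + Real.log n + Real.log α ≤ (6 * Real.logb 2 (1 + (α : ℝ)) + 3 * Real.logb 2 (n : ℝ)) / 2 := by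
    linarith
  rw [h1, h4]
  have h10 := mul_le_mul_of_nonneg_left h9 (show (0:ℝ) ≤ n by positivity)
  linarith

open Classical in
lemma card_X_le {m n : ℕ} (hn : 2 ≤ n) (A : Matrix (Fin m) (Fin n) ℤ) (b : Fin m → ℤ) (α : ℕ)
    (hA : ∀ i j, (A i j).natAbs ≤ α) (X : Finset (Fin n → ℝ)) (hX : ∀ x ∈ X, x ∈ vertN m n A b)
    (hne : X.Nonempty) :
    (X.card : ℝ) ≤ (n : ℝ) ^ (7 * n) * (xi n m : ℝ) *
          (6 * Real.logb 2 (1 + (α : ℝ)) + 3 * Real.logb 2 (n : ℝ)) ^ (n - 1) := by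
  set a := ar A with ha
  obtain ⟨x0, hx0⟩ := hne
  obtain ⟨e1, he1⟩ := vert_rank (hX x0 hx0)
  obtain ⟨β, hβ, hnd⟩ := exists_nondeg a (fun k => (b k : ℝ))
  set s : (Fin n → ℝ) → Fin m → ℝ := fun x k => β k - a k ⬝ᵥ x with hs
  have H0 : ∀ x ∈ X, ∀ k, 1 / 2 ≤ s x k := by
    intro x hx k
    have h1 : a k ⬝ᵥ x ≤ b k := (vert_sub (hX x hx)).2 k
    have := (hβ k).1
    simp only [hs]; linarith
  have H1 : ∀ x ∈ X, ∀ y ∈ X, x ≠ y → ∃ k, 2 * s x k < s y k := fun x hx y hy hxy =>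
    vert_H1 β (fun k => (hβ k).2) (hX x hx) (hX y hy) hxy
  have hdet1 : ∀ e, (sbm a e).det ≠ 0 → 1 ≤ |(sbm a e).det| := by
    intro e he
    rw [ha, det_zsb] at he ⊢
    have : (zsb A e).det ≠ 0 := by exact_mod_cast he
    exact_mod_cast Int.one_le_abs this
  have hdet2 : ∀ e, |(sbm a e).det| ≤ (n.factorial : ℝ) * (α:ℝ) ^ n := by
    intro e
    have := Matrix.det_le (A := sbm a e) (abv := AbsoluteValue.abs) (x := (α:ℝ)) (by
      intro i j
      have h := hA (e i) j
      simp only [sbm_apply, ha, ar, AbsoluteValue.abs_apply]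
      rw [← Int.cast_abs]
      have h' : |A (e i) j| ≤ (α:ℤ) := by
        rw [Int.abs_eq_natAbs]
        exact_mod_cast h
      exact_mod_cast h')
    simpa using this
  have H2 : ∀ e, (sbm a e).det ≠ 0 → ∀ p, ∀ x ∈ X, ∃ k, s x k < |a k ⬝ᵥ fun j => (sbm a e).adjugate j p| := by
    intro e he p x hx
    apply vert_H2 β (fun k => (hβ k).2) (hX x hx) _ (fun j => (zsb A e).adjugate j p) (fun j => adj_zsb A e j p)
    intro h
    apply he
    have := Matrix.det_eq_sum_mul_adjugate_row (sbm a e) p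
    rw [this]
    apply Finset.sum_eq_zero
    intro j _
    have h3 := congrFun h j
    simp only [Pi.zero_apply] at h3
    rw [h3, mul_zero]
  have hex : ∀ x, ∃ e0 : Fin n → Fin m, x ∈ X → (sbm a e0).det ≠ 0 ∧
      ∀ k d, |a k ⬝ᵥ d| / s x k ≤ ∑ i, |a (e0 i) ⬝ᵥ d| / s x (e0 i) := by
    intro x
    by_cases hx : x ∈ X
    · obtain ⟨e0, h⟩ := maxbasis a (s x) (fun k => by linarith [H0 x hx k]) e1 he1
      exact ⟨e0, fun _ => h⟩
    · exact ⟨e1, fun h => absurd h hx⟩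
  choose e0 he0 using hex
  set Fe := Finset.univ.filter (FeasS a β) with hFe
  have hcov : ∀ x ∈ X, 1 ≤ ∑ e ∈ Fe, wt a (s x) e (e0 x) := by
    intro x hx
    have hspos : ∀ k, 0 < s x k := fun k => by linarith [H0 x hx k]
    have h1 := L_cover (by omega) a (s x) hspos (e0 x) (he0 x hx).1
    have hpos : 0 < |(sbm a (e0 x)).det| / ∏ i, s x (e0 x i) :=
      div_pos (abs_pos.2 (he0 x hx).1) (Finset.prod_pos fun i _ => hspos _)
    have hsub : Finset.univ.filter (FeasS a (s x)) ⊆ Fe := by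
      intro e he
      simp only [hFe, Finset.mem_filter, Finset.mem_univ, true_and] at he ⊢
      obtain ⟨hd, y, hy1, hy2⟩ := he
      refine ⟨hd, y + x, fun k => ?_, fun i => ?_⟩
      · have := hy1 k
        simp only [hs] at this
        rw [dotProduct_add]; linarith
      · have := hy2 i
        simp only [hs] at this
        rw [dotProduct_add]; linarith
    have h2 : ∑ e ∈ Finset.univ.filter (FeasS a (s x)), |(sbm a e).det| / ∏ i, s x (e i) ≤
        ∑ e ∈ Fe, |(sbm a e).det| / ∏ i, s x (e i) := by
      apply Finset.sum_le_sum_of_subset_of_nonneg hsub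
      intro e _ _
      exact div_nonneg (abs_nonneg _) (Finset.prod_nonneg fun i _ => (hspos _).le)
    simp only [wt]
    rw [← Finset.sum_div, one_le_div hpos]
    exact h1.trans h2
  have hα1 : 1 ≤ α := by
    by_contra h
    have h0 : α = 0 := by omega
    have h1 := (hdet1 e1 he1).trans (hdet2 e1)
    rw [h0] at h1
    simp [show n ≠ 0 by omega] at h1
    linarith
  set Y := 6 * Real.logb 2 (1 + (α : ℝ)) + 3 * Real.logb 2 (n : ℝ) with hY
  have hn' : (2:ℝ) ≤ n := by exact_mod_cast hn
  have hY0 : 0 ≤ Y := by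
    have h1 : 0 ≤ Real.logb 2 (1 + (α:ℝ)) := Real.logb_nonneg (by norm_num) (by linarith [(Nat.cast_nonneg α : (0:ℝ) ≤ α)])
    have h2 : 0 ≤ Real.logb 2 (n:ℝ) := Real.logb_nonneg (by norm_num) (by linarith)
    positivity
  set K : ℝ := (n * 3) * (n * (21 * n / 2) ^ n * (((22 / 21) ^ 2) ^ (n - 1) *
        (2 / (21 * n) * (n / 2 * Y) ^ (n - 1)))) with hK
  have hK0 : 0 ≤ K := by positivity
  have hper : ∀ e ∈ Fe, ∑ x ∈ X, wt a (s x) e (e0 x) ≤ K := by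
    intro e he
    have hde : (sbm a e).det ≠ 0 := (Finset.mem_filter.1 he).2.1
    refine (per_e hn a β e hde (hdet1 e hde) X s (fun x _ k => rfl) H0 H1 (H2 e hde) e0
      (fun x hx => (he0 x hx).1) (fun x hx => (he0 x hx).2)).trans ?_
    have hI := numA n α hn hα1 _ (hdet1 e hde) (hdet2 e)
    have hI0 : 0 ≤ Real.log (5 / 2 * |(sbm a e).det|) + (n - 1 : ℕ) := by
      have : 0 ≤ Real.log (5 / 2 * |(sbm a e).det|) := Real.log_nonneg (by linarith [hdet1 e hde])
      positivity
    rw [hK]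
    gcongr
  have hmn : n ≤ m := by
    simpa using Fintype.card_le_of_injective e1 (sbm_inj a e1 he1)
  have hFc : (Fe.card : ℝ) ≤ ((n:ℝ) ^ n * (2 * 2 ^ n)) * xi n m := by
    have h1 := L_seidel a β hnd
    have h2 := choose_le_xi n m (by omega) hmn
    have h3 : Fe.card ≤ n ^ n * (2 * (2 ^ n * xi n m)) := h1.trans (by gcongr)
    calc (Fe.card : ℝ) ≤ ((n ^ n * (2 * (2 ^ n * xi n m)) : ℕ) : ℝ) := by exact_mod_cast h3
      _ = _ := by push_cast; ring
  calc (X.card : ℝ) = ∑ x ∈ X, (1:ℝ) := by simp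
    _ ≤ ∑ x ∈ X, ∑ e ∈ Fe, wt a (s x) e (e0 x) := Finset.sum_le_sum hcov
    _ = ∑ e ∈ Fe, ∑ x ∈ X, wt a (s x) e (e0 x) := Finset.sum_comm
    _ ≤ ∑ e ∈ Fe, K := Finset.sum_le_sum hper
    _ = Fe.card * K := by simp
    _ ≤ (((n:ℝ) ^ n * (2 * 2 ^ n)) * xi n m) * K := by gcongr
    _ = (((n:ℝ) ^ n * (2 * 2 ^ n)) * K) * xi n m := by ring
    _ ≤ ((n:ℝ) ^ (7 * n) * Y ^ (n - 1)) * xi n m := by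
        apply mul_le_mul_of_nonneg_right (numC n hn Y hY0) (by positivity)
    _ = _ := by ring

lemma finite_of_bound {E : Type*} (S : Set E) (c : ℝ) (h : ∀ X : Finset E, (∀ x ∈ X, x ∈ S) → (X.card : ℝ) ≤ c) :
    S.Finite ∧ (S.ncard : ℝ) ≤ c := by
  have hfin : S.Finite := by
    by_contra hinf
    have hinf : S.Infinite := hinf
    obtain ⟨X, hX, hc⟩ := hinf.exists_subset_card_eq (⌊c⌋₊ + 1)
    have h1 := h X (fun x hx => hX hx)
    rw [hc] at h1
    have := Nat.lt_floor_add_one c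
    push_cast at h1
    linarith
  refine ⟨hfin, ?_⟩
  rw [Set.ncard_eq_toFinset_card S hfin]
  apply h
  intro x hx
  simpa using hx

/-- Chirkov's bound: if `α = max |a_{ij}|`, then
`|N(A,b)| ≤ n^{7n}·ξₙ(m)·(6·log₂(1+α) + 3·log₂ n)^{n-1}`. -/
theorem card_vertN_le_chirkov (m n : ℕ) (A : Matrix (Fin m) (Fin n) ℤ) (b : Fin m → ℤ)
    (α : ℕ) (hα : α = Finset.univ.sup fun p : Fin m × Fin n => (A p.1 p.2).natAbs) :
    (vertN m n A b).Finite ∧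
      ((vertN m n A b).ncard : ℝ) ≤
        (n : ℝ) ^ (7 * n) * (xi n m : ℝ) *
          (6 * Real.logb 2 (1 + (α : ℝ)) + 3 * Real.logb 2 (n : ℝ)) ^ (n - 1) := by
  apply finite_of_bound
  intro X hX
  rcases Nat.lt_or_ge n 2 with hn | hn
  · interval_cases n
    · have h1 : X.card ≤ 1 := Finset.card_le_one.2 fun x _ y _ => Subsingleton.elim _ _
      have h2 : (X.card : ℝ) ≤ 1 := by exact_mod_cast h1
      simp [xi]
      linarith
    · have h1 : X.card ≤ 2 := by
        by_contra! h
        obtain ⟨x, y, z, hx, hy, hz, hxy, hxz, hyz⟩ := Finset.two_lt_card_iff.1 h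
        have key : ∀ x y z : Fin 1 → ℝ, x ∈ vertN m 1 A b → y ∈ vertN m 1 A b → z ∈ vertN m 1 A b →
            x 0 < y 0 → y 0 < z 0 → False := by
          intro x y z hx hy hz hxy hyz
          have := (mem_extremePoints.1 hy).2 x hx.1 z hz.1 (by
            have hp : 0 < z 0 - x 0 := by linarith
            refine ⟨(z 0 - y 0) / (z 0 - x 0), (y 0 - x 0) / (z 0 - x 0),
              div_pos (by linarith) hp, div_pos (by linarith) hp, ?_, ?_⟩
            · field_simp; ring
            · ext j
              rw [Subsingleton.elim j 0]
              simp only [Pi.add_apply, Pi.smul_apply, smul_eq_mul]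
              field_simp; ring)
          rw [this.1] at hxy
          exact lt_irrefl _ hxy
        have hne : ∀ u v : Fin 1 → ℝ, u ≠ v → u 0 ≠ v 0 := by
          intro u v huv h
          apply huv
          ext j
          rw [Subsingleton.elim j 0]; exact h
        have hx := hX x hx
        have hy := hX y hy
        have hz := hX z hz
        rcases lt_or_gt_of_ne (hne _ _ hxy) with h1 | h1 <;>
        rcases lt_or_gt_of_ne (hne _ _ hyz) with h2 | h2 <;>
        rcases lt_or_gt_of_ne (hne _ _ hxz) with h3 | h3
        · exact key x y z hx hy hz h1 h2
        · linarith
        · exact key x z y hx hz hy h3 h2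
        · exact key z x y hz hx hy h3 h1
        · exact key y x z hy hx hz h1 h3
        · exact key y z x hy hz hx h2 h3
        · linarith
        · exact key z y x hz hy hx h2 h1
      have h2 : (X.card : ℝ) ≤ 2 := by exact_mod_cast h1
      simp [xi]
      linarith
  · rcases X.eq_empty_or_nonempty with h | hne
    · subst h
      have hn' : (2:ℝ) ≤ n := by exact_mod_cast hn
      have h1 : 0 ≤ Real.logb 2 (1 + (α:ℝ)) :=
        Real.logb_nonneg (by norm_num) (by linarith [(Nat.cast_nonneg α : (0:ℝ) ≤ α)])
      have h2 : 0 ≤ Real.logb 2 (n:ℝ) := Real.logb_nonneg (by norm_num) (by linarith)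
      simp only [Finset.card_empty, Nat.cast_zero]
      positivity
    · refine card_X_le hn A b α ?_ X hX hne
      intro i j
      rw [hα]
      exact Finset.le_sup (f := fun p : Fin m × Fin n => (A p.1 p.2).natAbs) (Finset.mem_univ (i, j))
end
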